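/- Assume 0 ∈ Σf, assume f satisfies central isolation (0 is an isolated point of {z ∈ U : z_0 = ⋯ = z_{s−1} = 0 and ∂f/∂z_j(z) = 0 for all s ≤ j ≤ n}), and assume f satisfies the Jacobian set equality near 0 (there is an open neighborhood W₀ ⊆ U of 0 with Σf ∩ W₀ = {z ∈ W₀ : ∂f/∂z_j(z) = 0 for all s ≤ j ≤ n}). Then (U ∖ Σf, Σf) satisfies the a_f (Thom) condition near 0: there is an open neighborhood W ⊆ U of 0 such that for every p ∈ Σf ∩ W, for every sequence (q_k) in W ∖ Σf with q_k → p, and for every continuous ℂ-linear functional η on ℂ^{n+1} such that the normalized differentials Df(q_k)/‖Df(q_k)‖ converge to η in operator norm, one has η(v) = 0 for every vector v in the tangent cone (over ℝ) of Σf at p. -/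

import Mathlib

/-- ℂ^{n+1} identified with ℂ^s × ℂ^{n+1-s}. -/
abbrev Csp (n s : ℕ) : Type := (Fin s → ℂ) × (Fin (n + 1 - s) → ℂ)

/-- The critical locus Σf = {z ∈ U : Df(z) = 0}. -/
def SigmaF (n s : ℕ) (f : Csp n s → ℂ) (U : Set (Csp n s)) : Set (Csp n s) :=
  {z ∈ U | fderiv ℂ f z = 0}

/-- The partial derivatives ∂f/∂z_j for s ≤ j ≤ n all vanish at z. -/
def PartialsVanish (n s : ℕ) (f : Csp n s → ℂ) (z : Csp n s) : Prop :=
  ∀ j : Fin (n + 1 - s), fderiv ℂ f z (0, Pi.single j 1) = 0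

/-- Central isolation: 0 is an isolated point of
{z ∈ U : z' = 0 and ∂f/∂z_j(z) = 0 for all s ≤ j ≤ n}. -/
def CentralIsolation (n s : ℕ) (f : Csp n s → ℂ) (U : Set (Csp n s)) : Prop :=
  ∃ W : Set (Csp n s), IsOpen W ∧ (0 : Csp n s) ∈ W ∧
    ∀ z ∈ U ∩ W, z.1 = 0 → PartialsVanish n s f z → z = 0

/-- Jacobian set equality near 0: on some open neighborhood W₀ ⊆ U of 0,
Σf ∩ W₀ = {z ∈ W₀ : ∂f/∂z_j(z) = 0 for all s ≤ j ≤ n}. -/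
def JacobianEq (n s : ℕ) (f : Csp n s → ℂ) (U : Set (Csp n s)) : Prop :=
  ∃ W₀ : Set (Csp n s), IsOpen W₀ ∧ (0 : Csp n s) ∈ W₀ ∧ W₀ ⊆ U ∧
    SigmaF n s f U ∩ W₀ = {z ∈ W₀ | PartialsVanish n s f z}

/-- The a_f (Thom) condition near 0: on an open neighborhood W ⊆ U of 0, every
limit η of normalized differentials Df(q_k)/‖Df(q_k)‖ along non-critical points
q_k → p ∈ Σf kills the tangent cone (over ℝ) of Σf at p. -/
def AfCondition (n s : ℕ) (f : Csp n s → ℂ) (U : Set (Csp n s)) : Prop :=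
  ∃ W : Set (Csp n s), IsOpen W ∧ (0 : Csp n s) ∈ W ∧ W ⊆ U ∧
    ∀ p ∈ SigmaF n s f U ∩ W, ∀ q : ℕ → Csp n s,
      (∀ k, q k ∈ W ∧ q k ∉ SigmaF n s f U) →
      Filter.Tendsto q Filter.atTop (nhds p) →
      ∀ η : Csp n s →L[ℂ] ℂ,
        Filter.Tendsto (fun k => (‖fderiv ℂ f (q k)‖)⁻¹ • fderiv ℂ f (q k))
          Filter.atTop (nhds η) →
        ∀ v ∈ tangentConeAt ℝ (SigmaF n s f U) p, η v = 0

set_option linter.unusedSectionVars false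

open Set Filter Topology MeasureTheory

section

variable {ι : Type*} [Fintype ι] [DecidableEq ι]

/-- The transposed Jacobian matrix: row `i` is the `i`-th partial derivative. -/
noncomputable def jacRows (Φ : (ι → ℂ) → ι → ℂ) (x : ι → ℂ) : ι → ι → ℂ :=
  fun i => fderiv ℂ Φ x (Pi.single i 1)

/-- The complex Jacobian determinant. -/
noncomputable def jac (Φ : (ι → ℂ) → ι → ℂ) (x : ι → ℂ) : ℂ :=
  Matrix.det (Matrix.of (jacRows Φ x))

/-- The Cramer vector field solving `DΦ(x) Y = jac Φ x • h`. -/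
noncomputable def cramerField (Φ : (ι → ℂ) → ι → ℂ) (h : ι → ℂ) (x : ι → ℂ) (j : ι) : ℂ :=
  Matrix.det (Matrix.of (Function.update (jacRows Φ x) j h))

/-- The determinant as a continuous multilinear function of the rows. -/
noncomputable def detCM (ι : Type*) [Fintype ι] [DecidableEq ι] :
    ContinuousMultilinearMap ℂ (fun _ : ι => ι → ℂ) ℂ :=
  { (Matrix.detRowAlternating (R := ℂ) (n := ι)).toMultilinearMap with
    cont := by
      change Continuous fun A : ι → ι → ℂ => Matrix.det (Matrix.of A)
      exact Continuous.matrix_det continuous_id }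

theorem clm_apply_eq_sum {F : Type*} [NormedAddCommGroup F] [NormedSpace ℂ F]
    (L : (ι → ℂ) →L[ℂ] F) (v : ι → ℂ) :
    L v = ∑ i, v i • L (Pi.single i 1) := by
  conv_lhs => rw [pi_eq_sum_univ' v]
  rw [map_sum]
  refine Finset.sum_congr rfl fun i _ => ?_
  rw [map_smul]

theorem fderiv_cramerField (Φ : (ι → ℂ) → ι → ℂ) (h : ι → ℂ) (x : ι → ℂ) :
    fderiv ℂ Φ x (cramerField Φ h x) = jac Φ x • h := by
  have h1 := Matrix.mulVec_cramer (Matrix.of (jacRows Φ x)).transpose h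
  rw [Matrix.det_transpose] at h1
  have h2 : Matrix.cramer (Matrix.of (jacRows Φ x)).transpose h = cramerField Φ h x := by
    ext j
    rw [Matrix.cramer_transpose_apply]
    rfl
  rw [jac, ← h1, h2, clm_apply_eq_sum]
  ext k
  simp [Matrix.mulVec, dotProduct, jacRows, mul_comm]

theorem hasFDerivAt_jacRows {Φ : (ι → ℂ) → ι → ℂ} {x : ι → ℂ} (hΦ : AnalyticAt ℂ Φ x) (i : ι) :
    HasFDerivAt (fun y => jacRows Φ y i)
      ((fderiv ℂ (fderiv ℂ Φ) x).flip (Pi.single i 1)) x := by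
  have h1 := hΦ.fderiv.differentiableAt.hasFDerivAt
  have h2 : HasFDerivAt (fun y => jacRows Φ y i) _ x :=
    h1.clm_apply (hasFDerivAt_const (Pi.single i (1 : ℂ) : ι → ℂ) x)
  rwa [ContinuousLinearMap.comp_zero, zero_add] at h2

theorem piola {Φ : (ι → ℂ) → ι → ℂ} {x : ι → ℂ} (hΦ : AnalyticAt ℂ Φ x) (h : ι → ℂ) :
    ∑ j, fderiv ℂ (fun y => cramerField Φ h y j) x (Pi.single j 1) = 0 := by
  set R := jacRows Φ x with hR
  set H : ι → ι → ι → ℂ := fun j i => fderiv ℂ (fderiv ℂ Φ) x (Pi.single j 1) (Pi.single i 1) with hH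
  have hsymm : ∀ i j, H i j = H j i := fun i j =>
    (hΦ.contDiffAt (n := 2)).isSymmSndFDerivAt (by simp) _ _
  let M : ι → ι → ℂ := fun j i =>
    if i = j then 0 else Matrix.detRowAlternating (Function.update (Function.update R j h) i (H j i))
  have key : ∀ j, fderiv ℂ (fun y => cramerField Φ h y j) x (Pi.single j 1) = ∑ i, M j i := by
    intro j
    have hd : ∀ i, HasFDerivAt (fun y => Function.update (jacRows Φ y) j h i)
        (if i = j then 0 else (fderiv ℂ (fderiv ℂ Φ) x).flip (Pi.single i 1) :
          (ι → ℂ) →L[ℂ] ι → ℂ) x := by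
      intro i
      by_cases hij : i = j
      · subst hij
        simpa using hasFDerivAt_const (𝕜 := ℂ) h x
      · simpa [hij] using hasFDerivAt_jacRows hΦ i
    have h2 := HasFDerivAt.multilinear_comp (detCM ι) hd
    have h3 : fderiv ℂ (fun y => cramerField Φ h y j) x = _ := h2.fderiv
    rw [h3, sum_apply]
    refine Finset.sum_congr rfl fun i _ => ?_
    by_cases hij : i = j
    · simp [M, hij]
    · simp only [M, hij, if_false, ContinuousLinearMap.comp_apply]
      rfl
  have anti : ∀ j i, M j i = - M i j := by
    intro j i
    by_cases hij : i = j
    · subst hij; simp [M]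
    · have hji : ¬ j = i := fun h => hij h.symm
      simp only [M, hij, hji, if_false]
      rw [← AlternatingMap.map_swap _ _ hij]
      congr 1
      funext k
      simp only [Function.comp]
      by_cases hk : k = i
      · subst hk
        simp [hsymm j]
      · by_cases hk' : k = j
        · subst hk'
          simp [hji, hij]
        · rw [Equiv.swap_apply_of_ne_of_ne hk hk']
          simp [hk, hk']
  rw [Finset.sum_congr rfl fun j _ => key j]
  have h5 : ∑ j, ∑ i, M j i = - ∑ j, ∑ i, M j i := by
    conv_lhs => rw [Finset.sum_comm]
    rw [← Finset.sum_neg_distrib]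
    refine Finset.sum_congr rfl fun i _ => ?_
    rw [← Finset.sum_neg_distrib]
    exact Finset.sum_congr rfl fun j _ => anti _ _
  linear_combination (1 / 2 : ℂ) * h5

end

section

variable {ι : Type*} [Fintype ι] [DecidableEq ι]

/-- Twice the antilinear part of a real-linear functional. -/
noncomputable def dbar (L : (ι → ℂ) →L[ℝ] ℂ) (h : ι → ℂ) : ℂ := L h + Complex.I * L (Complex.I • h)

theorem dbar_smul (L : (ι → ℂ) →L[ℝ] ℂ) (c : ℂ) (h : ι → ℂ) :
    dbar L (c • h) = (starRingEnd ℂ) c * dbar L h := by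
  have h1 : c • h = c.re • h + c.im • (Complex.I • h) := by
    ext k
    simp only [Pi.add_apply, Pi.smul_apply, smul_eq_mul, Complex.real_smul]
    conv_lhs => rw [← Complex.re_add_im c]
    ring
  have h2 : Complex.I • c • h = c.re • (Complex.I • h) - c.im • h := by
    ext k
    simp only [Pi.sub_apply, Pi.smul_apply, smul_eq_mul, Complex.real_smul]
    conv_lhs => rw [← Complex.re_add_im c]
    linear_combination (c.im : ℂ) * h k * Complex.I_mul_I
  simp only [dbar]
  have hr : ∀ (r : ℝ) (k : ι → ℂ), L (r • k) = r * L k := fun r k => by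
    rw [L.map_smul, Complex.real_smul]
  rw [h2, h1, map_add, map_sub, hr, hr, hr, hr]
  have h3 : (starRingEnd ℂ) c = c.re - c.im * Complex.I := by
    apply Complex.ext <;> simp
  rw [h3]
  linear_combination (c.im * L (Complex.I • h)) * Complex.I_mul_I

theorem dbar_add (L : (ι → ℂ) →L[ℝ] ℂ) (h k : ι → ℂ) :
    dbar L (h + k) = dbar L h + dbar L k := by
  simp only [dbar, smul_add, map_add]; ring

theorem dbar_sum {α : Type*} (s : Finset α) (L : (ι → ℂ) →L[ℝ] ℂ) (h : α → ι → ℂ) :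
    dbar L (∑ i ∈ s, h i) = ∑ i ∈ s, dbar L (h i) := by
  classical
  induction s using Finset.induction_on with
  | empty => simp [dbar]
  | insert a s ha ih => rw [Finset.sum_insert ha, Finset.sum_insert ha, dbar_add, ih]

theorem dbar_eq_sum (L : (ι → ℂ) →L[ℝ] ℂ) (v : ι → ℂ) :
    dbar L v = ∑ j, (starRingEnd ℂ) (v j) * dbar L (Pi.single j 1) := by
  conv_lhs => rw [pi_eq_sum_univ' v]
  rw [dbar_sum]
  exact Finset.sum_congr rfl fun j _ => dbar_smul _ _ _

theorem integral_fderiv_eq_zero {E : Type*} [NormedAddCommGroup E] [NormedSpace ℝ E]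
    [FiniteDimensional ℝ E] [MeasurableSpace E] [BorelSpace E] (μ : Measure E) [μ.IsAddHaarMeasure]
    {W : E → ℂ} (hW : ContDiff ℝ 1 W)
    (hc : HasCompactSupport W) (v : E) : ∫ x, fderiv ℝ W x v ∂μ = 0 := by
  have h1 : Continuous (fun x => fderiv ℝ W x v) :=
    (hW.continuous_fderiv one_ne_zero).clm_apply continuous_const
  have h2 : HasCompactSupport (fun x => fderiv ℝ W x v) := by
    exact (hc.fderiv ℝ).comp_left (g := fun L : E →L[ℝ] ℂ => L v) (by simp)
  have := integral_mul_fderiv_eq_neg_fderiv_mul_of_integrable (μ := μ) (f := fun _ : E => (1 : ℂ))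
    (g := W) (v := v) (by simp) (by simpa using h1.integrable_of_hasCompactSupport h2)
    (by simpa using hW.continuous.integrable_of_hasCompactSupport hc)
    (fun x _ => by fun_prop) (fun x _ => (hW.differentiable one_ne_zero) x)
  simpa using this

/-- A function that is `C¹` on an open set `N` and vanishes there off a compact subset of `N`
extends by zero to a `C¹` function with compact support. -/
theorem contDiff_indicator {E F : Type*} [NormedAddCommGroup E] [NormedSpace ℝ E]
    [NormedAddCommGroup F] [NormedSpace ℝ F] {N K : Set E} {g : E → F} (hN : IsOpen N)
    (hK : IsCompact K) (hKN : K ⊆ N) (hg : ∀ x ∈ N, ContDiffAt ℝ 1 g x)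
    (h0 : ∀ x ∈ N, x ∉ K → g x = 0) :
    ContDiff ℝ 1 (N.indicator g) ∧ HasCompactSupport (N.indicator g) := by
  constructor
  · rw [contDiff_iff_contDiffAt]
    intro x
    by_cases hx : x ∈ N
    · refine (hg x hx).congr_of_eventuallyEq ?_
      filter_upwards [hN.mem_nhds hx] with y hy
      simp [hy]
    · have hxK : x ∈ Kᶜ := fun h => hx (hKN h)
      refine (contDiffAt_const (c := (0 : F))).congr_of_eventuallyEq ?_
      filter_upwards [hK.isClosed.isOpen_compl.mem_nhds hxK] with y hy
      by_cases hyN : y ∈ N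
      · simp [hyN, h0 y hyN hy]
      · simp [hyN]
  · refine HasCompactSupport.intro hK fun x hx => ?_
    by_cases hxN : x ∈ N
    · simp [hxN, h0 x hxN hx]
    · simp [hxN]

/-- `Φ` is holomorphic on the open set `N` and maps it properly to the open set `V`. -/
structure IsProperHol (Φ : (ι → ℂ) → ι → ℂ) (N V : Set (ι → ℂ)) : Prop where
  isOpen_source : IsOpen N
  isOpen_target : IsOpen V
  mapsTo : MapsTo Φ N V
  analytic : AnalyticOnNhd ℂ Φ N
  isCompact_preimage : ∀ K ⊆ V, IsCompact K → IsCompact (N ∩ Φ ⁻¹' K)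

/-- The push-forward of the density `u |jac Φ|²` under `Φ`, tested against `χ`. -/
noncomputable def smear (Φ : (ι → ℂ) → ι → ℂ) (N : Set (ι → ℂ)) (u χ : (ι → ℂ) → ℂ) : ℂ :=
  ∫ x in N, u x * jac Φ x * (starRingEnd ℂ) (jac Φ x) * χ (Φ x)

theorem analyticAt_jac {Φ : (ι → ℂ) → ι → ℂ} {x : ι → ℂ} (h : AnalyticAt ℂ Φ x) :
    AnalyticAt ℂ (jac Φ) x := by
  have h1 : AnalyticAt ℂ (fun y => jacRows Φ y) x := by
    rw [analyticAt_pi_iff]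
    intro i
    exact (ContinuousLinearMap.apply ℂ (ι → ℂ) (Pi.single i (1 : ℂ) : ι → ℂ)).analyticAt _ |>.comp h.fderiv
  exact (detCM ι).analyticAt.comp h1

theorem analyticAt_cramerField {Φ : (ι → ℂ) → ι → ℂ} {x : ι → ℂ} (h : AnalyticAt ℂ Φ x)
    (v : ι → ℂ) (j : ι) : AnalyticAt ℂ (fun y => cramerField Φ v y j) x := by
  have h1 : AnalyticAt ℂ (fun y => Function.update (jacRows Φ y) j v) x := by
    rw [analyticAt_pi_iff]
    intro i
    by_cases hij : i = j
    · subst hij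
      simpa using analyticAt_const
    · simp [hij]
      exact (ContinuousLinearMap.apply ℂ (ι → ℂ) (Pi.single i (1 : ℂ) : ι → ℂ)).analyticAt _ |>.comp h.fderiv
  exact (detCM ι).analyticAt.comp h1

theorem smear_dbar {Φ : (ι → ℂ) → ι → ℂ} {N V : Set (ι → ℂ)} (hP : IsProperHol Φ N V)
    {u : (ι → ℂ) → ℂ} (hu : AnalyticOnNhd ℂ u N) {χ : (ι → ℂ) → ℂ} (hχ : ContDiff ℝ 1 χ)
    {K : Set (ι → ℂ)} (hKV : K ⊆ V) (hK : IsCompact K) (h0 : ∀ v ∉ K, χ v = 0) (h : ι → ℂ) :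
    smear Φ N u (fun v => dbar (fderiv ℝ χ v) h) = 0 := by
  set Y : ι → (ι → ℂ) → ℂ := fun j x => cramerField Φ h x j with hY
  set a : (ι → ℂ) → ℂ := fun x => u x * jac Φ x with ha
  set w : ι → (ι → ℂ) → ℂ := fun j x => χ (Φ x) * (a x * (starRingEnd ℂ) (Y j x)) with hw
  have hcpt := hP.isCompact_preimage K hKV hK
  have haA : ∀ x ∈ N, AnalyticAt ℂ a x := fun x hx =>
    (hu x hx).mul (analyticAt_jac (hP.analytic x hx))
  have hYA : ∀ j, ∀ x ∈ N, AnalyticAt ℂ (Y j) x := fun j x hx =>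
    analyticAt_cramerField (hP.analytic x hx) h j
  have hconj : ContDiff ℝ 1 (fun z : ℂ => (starRingEnd ℂ) z) := Complex.conjCLE.contDiff
  have hwC : ∀ j, ContDiff ℝ 1 (N.indicator (w j)) ∧ HasCompactSupport (N.indicator (w j)) := by
    intro j
    refine contDiff_indicator hP.isOpen_source hcpt inter_subset_left (fun x hx => ?_) ?_
    · have h1 : ContDiffAt ℝ 1 Φ x := ((hP.analytic x hx).contDiffAt).restrict_scalars ℝ
      have h2 : ContDiffAt ℝ 1 a x := ((haA x hx).contDiffAt).restrict_scalars ℝ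
      have h3 : ContDiffAt ℝ 1 (Y j) x := ((hYA j x hx).contDiffAt).restrict_scalars ℝ
      exact (hχ.contDiffAt.comp x h1).mul (h2.mul (hconj.contDiffAt.comp x h3))
    · intro x hx hxK
      have : Φ x ∉ K := fun hh => hxK ⟨hx, hh⟩
      simp [hw, h0 _ this]
  have hInt : ∀ j, ∫ x, dbar (fderiv ℝ (N.indicator (w j)) x) (Pi.single j 1) = 0 := by
    intro j
    have hi : ∀ v, Integrable (fun x => fderiv ℝ (N.indicator (w j)) x v) := fun v =>
      (((hwC j).1.continuous_fderiv one_ne_zero).clm_apply continuous_const).integrable_of_hasCompactSupport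
        (((hwC j).2.fderiv ℝ).comp_left (g := fun L : (ι → ℂ) →L[ℝ] ℂ => L v) (by simp))
    simp only [dbar]
    rw [integral_add (hi _) ((hi _).const_mul _), integral_const_mul,
      integral_fderiv_eq_zero _ (hwC j).1 (hwC j).2, integral_fderiv_eq_zero _ (hwC j).1 (hwC j).2]
    simp
  have hpt : ∀ x, ∑ j, dbar (fderiv ℝ (N.indicator (w j)) x) (Pi.single j 1) =
      N.indicator (fun x => u x * jac Φ x * (starRingEnd ℂ) (jac Φ x) *
        dbar (fderiv ℝ χ (Φ x)) h) x := by
    intro x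
    by_cases hx : x ∈ N
    · rw [indicator_of_mem hx]
      have hd : ∀ j v, fderiv ℝ (N.indicator (w j)) x v =
          fderiv ℝ χ (Φ x) (fderiv ℂ Φ x v) * (a x * (starRingEnd ℂ) (Y j x)) +
          χ (Φ x) * (fderiv ℂ a x v * (starRingEnd ℂ) (Y j x) +
            a x * (starRingEnd ℂ) (fderiv ℂ (Y j) x v)) := by
        intro j v
        have e1 : N.indicator (w j) =ᶠ[𝓝 x] w j := by
          filter_upwards [hP.isOpen_source.mem_nhds hx] with y hy
          simp [hy]
        have g1 : HasFDerivAt Φ ((fderiv ℂ Φ x).restrictScalars ℝ) x :=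
          ((hP.analytic x hx).differentiableAt.hasFDerivAt).restrictScalars ℝ
        have g2 : HasFDerivAt a ((fderiv ℂ a x).restrictScalars ℝ) x :=
          ((haA x hx).differentiableAt.hasFDerivAt).restrictScalars ℝ
        have g3 : HasFDerivAt (Y j) ((fderiv ℂ (Y j) x).restrictScalars ℝ) x :=
          ((hYA j x hx).differentiableAt.hasFDerivAt).restrictScalars ℝ
        have g4 : HasFDerivAt (fun y => (starRingEnd ℂ) (Y j y)) _ x :=
          (Complex.conjCLE.hasFDerivAt (x := Y j x)).comp x g3
        have g5 : HasFDerivAt (fun y => χ (Φ y)) _ x :=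
          (((hχ.differentiable one_ne_zero) (Φ x)).hasFDerivAt).comp x g1
        have g6 : HasFDerivAt (w j) _ x := g5.mul (g2.mul g4)
        rw [e1.fderiv_eq, g6.fderiv]
        simp
        ring
      have hd2 : ∀ j, dbar (fderiv ℝ (N.indicator (w j)) x) (Pi.single j 1) =
          a x * ((starRingEnd ℂ) (Y j x) * dbar ((fderiv ℝ χ (Φ x)).comp
            ((fderiv ℂ Φ x).restrictScalars ℝ)) (Pi.single j 1)) +
          2 * χ (Φ x) * a x * (starRingEnd ℂ) (fderiv ℂ (Y j) x (Pi.single j 1)) := by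
        intro j
        simp only [dbar, hd, ContinuousLinearMap.comp_apply, map_smul,
          ContinuousLinearMap.coe_restrictScalars', smul_eq_mul, map_mul, Complex.conj_I]
        linear_combination (χ (Φ x) * (fderiv ℂ a x (Pi.single j 1) * (starRingEnd ℂ) (Y j x)) -
          χ (Φ x) * (a x * (starRingEnd ℂ) (fderiv ℂ (Y j) x (Pi.single j 1)))) * Complex.I_mul_I
      rw [Finset.sum_congr rfl fun j _ => hd2 j, Finset.sum_add_distrib, ← Finset.mul_sum,
        ← Finset.mul_sum, ← map_sum, piola (hP.analytic x hx) h, map_zero, mul_zero, add_zero]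
      have e2 : (fun j => Y j x) = cramerField Φ h x := rfl
      have e3 := dbar_eq_sum ((fderiv ℝ χ (Φ x)).comp ((fderiv ℂ Φ x).restrictScalars ℝ))
        (cramerField Φ h x)
      rw [show (∑ j, (starRingEnd ℂ) (Y j x) * dbar ((fderiv ℝ χ (Φ x)).comp
            ((fderiv ℂ Φ x).restrictScalars ℝ)) (Pi.single j 1)) = _ from e3.symm]
      have e4 : dbar ((fderiv ℝ χ (Φ x)).comp ((fderiv ℂ Φ x).restrictScalars ℝ))
        (cramerField Φ h x) = dbar (fderiv ℝ χ (Φ x)) (jac Φ x • h) := by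
        simp only [dbar, ContinuousLinearMap.comp_apply,
          ContinuousLinearMap.coe_restrictScalars', map_smul, fderiv_cramerField]
      rw [e4, dbar_smul]
      ring
    · rw [indicator_of_notMem hx]
      refine Finset.sum_eq_zero fun j _ => ?_
      have e1 : N.indicator (w j) =ᶠ[𝓝 x] fun _ => 0 := by
        have hxK : x ∈ (N ∩ Φ ⁻¹' K)ᶜ := fun hh => hx hh.1
        filter_upwards [hcpt.isClosed.isOpen_compl.mem_nhds hxK] with y hy
        by_cases hyN : y ∈ N
        · have : Φ y ∉ K := fun hh => hy ⟨hyN, hh⟩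
          simp [hyN, hw, h0 _ this]
        · simp [hyN]
      rw [e1.fderiv_eq]
      simp [dbar]
  have hinteg : ∀ j, Integrable (fun x => dbar (fderiv ℝ (N.indicator (w j)) x) (Pi.single j 1)) := by
    intro j
    have hi : ∀ v, Integrable (fun x => fderiv ℝ (N.indicator (w j)) x v) := fun v =>
      (((hwC j).1.continuous_fderiv one_ne_zero).clm_apply continuous_const).integrable_of_hasCompactSupport
        (((hwC j).2.fderiv ℝ).comp_left (g := fun L : (ι → ℂ) →L[ℝ] ℂ => L v) (by simp))
    exact (hi _).add ((hi _).const_mul _)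
  have h1 : smear Φ N u (fun v => dbar (fderiv ℝ χ v) h) =
      ∫ x, ∑ j, dbar (fderiv ℝ (N.indicator (w j)) x) (Pi.single j 1) := by
    rw [smear, ← integral_indicator hP.isOpen_source.measurableSet]
    exact integral_congr_ae (Eventually.of_forall fun x => (hpt x).symm)
  rw [h1, integral_finsetSum _ fun j _ => hinteg j]
  simp [hInt]

end

section

variable {ι : Type*} [Fintype ι] [DecidableEq ι]

/-- The weight `u |jac Φ|²`. -/
noncomputable def smearWeight (Φ : (ι → ℂ) → ι → ℂ) (u : (ι → ℂ) → ℂ) (x : ι → ℂ) : ℂ :=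
  u x * jac Φ x * (starRingEnd ℂ) (jac Φ x)

theorem continuousOn_smearWeight {Φ : (ι → ℂ) → ι → ℂ} {N V : Set (ι → ℂ)}
    (hP : IsProperHol Φ N V) {u : (ι → ℂ) → ℂ} (hu : AnalyticOnNhd ℂ u N) :
    ContinuousOn (smearWeight Φ u) N := by
  intro x hx
  have h1 := (hu x hx).continuousAt
  have h2 := (analyticAt_jac (hP.analytic x hx)).continuousAt
  exact ((h1.mul h2).mul (Complex.continuous_conj.continuousAt.comp h2)).continuousWithinAt

/-- A function on `N` bounded and vanishing off a compact set is integrable. -/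
theorem integrableOn_of_bound {F : Type*} [NormedAddCommGroup F] {N K : Set (ι → ℂ)} {g : (ι → ℂ) → F}
    (hN : IsOpen N) (hg : AEStronglyMeasurable g (volume.restrict N))
    (hK : IsCompact K) {C : ℝ} (hC : ∀ x ∈ N, ‖g x‖ ≤ K.indicator (fun _ => C) x) :
    IntegrableOn g N := by
  have h1 : Integrable (K.indicator (fun _ : ι → ℂ => C)) := by
    rw [integrable_indicator_iff hK.measurableSet]
    exact integrableOn_const hK.measure_lt_top.ne
  refine (h1.integrableOn (s := N)).mono' hg ?_
  exact (ae_restrict_iff' hN.measurableSet).2 (Eventually.of_forall hC)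

theorem smear_hasFDerivAt {P : Type*} [NormedAddCommGroup P] [NormedSpace ℝ P]
    {Φ : (ι → ℂ) → ι → ℂ} {N V : Set (ι → ℂ)} (hP : IsProperHol Φ N V)
    {u : (ι → ℂ) → ℂ} (hu : AnalyticOnNhd ℂ u N) {θ : P × (ι → ℂ) → ℂ} (hθ : ContDiff ℝ 1 θ)
    {K : Set (ι → ℂ)} (hKV : K ⊆ V) (hK : IsCompact K) {p₀ : P}
    (h0 : ∀ᶠ p in 𝓝 p₀, ∀ v ∉ K, θ (p, v) = 0) :
    ∃ F' : P →L[ℝ] ℂ, HasFDerivAt (fun p => smear Φ N u (fun v => θ (p, v))) F' p₀ ∧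
      ∀ h, F' h = smear Φ N u (fun v => fderiv ℝ θ (p₀, v) (h, 0)) := by
  have hcpt := hP.isCompact_preimage K hKV hK
  set K' := N ∩ Φ ⁻¹' K with hK'
  have hwt := continuousOn_smearWeight hP hu
  obtain ⟨C1, hC1⟩ := hcpt.exists_bound_of_continuousOn (hwt.mono inter_subset_left)
  let D : P × (ι → ℂ) → P →L[ℝ] ℂ := fun q => (fderiv ℝ θ q).comp (ContinuousLinearMap.inl ℝ P (ι → ℂ))
  have hDc : Continuous D := (hθ.continuous_fderiv one_ne_zero).clm_comp continuous_const
  obtain ⟨C2, hC2⟩ := hK.exists_bound_of_continuousOn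
    (hDc.comp (Continuous.prodMk_right p₀)).continuousOn
  have hC2' : ∀ᶠ p in 𝓝 p₀, ∀ v ∈ K, ‖D (p, v)‖ < C2 + 1 := by
    refine hK.eventually_forall_of_forall_eventually fun v hv => ?_
    have : ‖D (p₀, v)‖ < C2 + 1 := (hC2 v hv).trans_lt (lt_add_one _)
    exact hDc.norm.continuousAt.eventually_lt continuousAt_const this
  have hΦc : ContinuousOn Φ N := fun x hx => (hP.analytic x hx).continuousAt.continuousWithinAt
  let F : P → (ι → ℂ) → ℂ := fun p x => smearWeight Φ u x * θ (p, Φ x)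
  let F' : P → (ι → ℂ) → P →L[ℝ] ℂ := fun p x => smearWeight Φ u x • D (p, Φ x)
  have hNm := hP.isOpen_source.measurableSet
  have hFc : ∀ p, ContinuousOn (F p) N := fun p =>
    hwt.mul ((hθ.continuous.comp (Continuous.prodMk_right p)).comp_continuousOn hΦc)
  have hF'c : ContinuousOn (F' p₀) N :=
    hwt.smul ((hDc.comp (Continuous.prodMk_right p₀)).comp_continuousOn hΦc)
  have hθd : ∀ p v, HasFDerivAt (fun p => θ (p, v)) (D (p, v)) p := fun p v =>
    ((hθ.differentiable one_ne_zero) (p, v)).hasFDerivAt.comp p (hasFDerivAt_prodMk_left p v)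
  set s := {p | (∀ᶠ p' in 𝓝 p, ∀ v ∉ K, θ (p', v) = 0) ∧ ∀ v ∈ K, ‖D (p, v)‖ < C2 + 1} with hs
  have hsn : s ∈ 𝓝 p₀ := (eventually_eventually_nhds.2 h0).and hC2'
  have hp₀ : p₀ ∈ s := mem_of_mem_nhds hsn
  have hb : ∀ x ∈ N, ∀ p ∈ s, ‖F' p x‖ ≤ K'.indicator (fun _ => C1 * (C2 + 1)) x := by
    intro x hx p hp
    by_cases hxK : Φ x ∈ K
    · rw [indicator_of_mem (show x ∈ K' from ⟨hx, hxK⟩)]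
      simp only [F', norm_smul]
      have e1 := hC1 x ⟨hx, hxK⟩
      exact mul_le_mul e1 (hp.2 _ hxK).le (norm_nonneg _) ((norm_nonneg _).trans e1)
    · rw [indicator_of_notMem (fun hh => hxK hh.2)]
      have e1 : (fun p => θ (p, Φ x)) =ᶠ[𝓝 p] fun _ => 0 := by
        filter_upwards [hp.1] with p' hp'
        exact hp' _ hxK
      have e2 : D (p, Φ x) = 0 := by
        rw [← (hθd p (Φ x)).fderiv, e1.fderiv_eq]
        simp
      simp only [F', norm_smul, e2]
      rw [norm_zero, mul_zero]
  have key := hasFDerivAt_integral_of_dominated_of_fderiv_le (μ := volume.restrict N) (𝕜 := ℝ)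
    (F := F) (F' := F') (x₀ := p₀) (bound := K'.indicator fun _ => C1 * (C2 + 1))
    (s := s) hsn
    (Eventually.of_forall fun p => (hFc p).aestronglyMeasurable hNm) ?_
    (hF'c.aestronglyMeasurable hNm) ?_ ?_ ?_
  · refine ⟨_, key, fun h => ?_⟩
    have hi : Integrable (F' p₀) (volume.restrict N) := by
      refine integrableOn_of_bound (C := C1 * (C2 + 1)) hP.isOpen_source (hF'c.aestronglyMeasurable hNm)
        hcpt fun x hx => hb x hx p₀ hp₀
    rw [ContinuousLinearMap.integral_apply hi]
    rfl
  · obtain ⟨C3, hC3⟩ := hcpt.exists_bound_of_continuousOn ((hFc p₀).mono inter_subset_left)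
    refine integrableOn_of_bound (C := C3) hP.isOpen_source ((hFc p₀).aestronglyMeasurable hNm)
        hcpt fun x hx => ?_
    by_cases hxK : Φ x ∈ K
    · rw [indicator_of_mem (show x ∈ K' from ⟨hx, hxK⟩)]
      exact hC3 x ⟨hx, hxK⟩
    · rw [indicator_of_notMem (fun hh => hxK hh.2)]
      simp [F, h0.self_of_nhds _ hxK]
  · exact (ae_restrict_iff' hNm).2 (Eventually.of_forall hb)
  · rw [integrable_indicator_iff hcpt.measurableSet]
    refine integrableOn_const ?_
    exact ((Measure.restrict_apply_le _ _).trans_lt hcpt.measure_lt_top).ne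
  · exact Eventually.of_forall fun x p _ => (hθd p (Φ x)).const_mul _

end

section

variable {ι : Type*} [Fintype ι] [DecidableEq ι]

/-- A circularly symmetric `C¹` probability density supported in the closed unit ball. -/
structure IsBump (φ : (ι → ℂ) → ℝ) : Prop where
  contDiff : ContDiff ℝ 1 φ
  eq_zero : ∀ v, 1 < ‖v‖ → φ v = 0
  nonneg : ∀ v, 0 ≤ φ v
  pos_zero : 0 < φ 0
  integral_eq_one : ∫ v, φ v = 1
  fderiv_I_smul : ∀ v, fderiv ℝ φ v (Complex.I • v) = 0

/-- There is a `C¹` probability density supported in the closed unit ball and invariant under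
multiplication by unit complex numbers. -/
theorem exists_isBump (ι : Type*) [Fintype ι] [DecidableEq ι] : ∃ φ : (ι → ℂ) → ℝ, IsBump φ := by
  let φ0 : (ι → ℂ) → ℝ := fun v => Real.smoothTransition (1 - ∑ j, ‖v j‖ ^ 2)
  have hc : ContDiff ℝ 1 φ0 := by
    refine Real.smoothTransition.contDiff.comp (contDiff_const.sub (ContDiff.sum fun j _ => ?_))
    exact (contDiff_apply ℝ ℂ j).norm_sq ℝ
  have hz : ∀ v, 1 < ‖v‖ → φ0 v = 0 := by
    intro v hv
    refine Real.smoothTransition.zero_of_nonpos ?_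
    obtain ⟨j, hj⟩ : ∃ j, 1 < ‖v j‖ := by
      by_contra! hcon
      exact absurd ((pi_norm_le_iff_of_nonneg zero_le_one).2 hcon) (not_le.2 hv)
    have h1 : ‖v j‖ ^ 2 ≤ ∑ j, ‖v j‖ ^ 2 :=
      Finset.single_le_sum (f := fun j => ‖v j‖ ^ 2) (fun i _ => sq_nonneg _) (Finset.mem_univ j)
    nlinarith
  have hnn : ∀ v, 0 ≤ φ0 v := fun v => Real.smoothTransition.nonneg _
  have hsupp : HasCompactSupport φ0 := by
    refine HasCompactSupport.intro (isCompact_closedBall (0 : ι → ℂ) 1) fun v hv => hz v ?_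
    simpa using hv
  have h0 : φ0 0 = 1 := by simp [φ0]
  have hInt : 0 < ∫ v, φ0 v := by
    refine hc.continuous.integral_pos_of_hasCompactSupport_nonneg_nonzero hsupp hnn (x := 0) ?_
    rw [h0]; exact one_ne_zero
  have hI : ∀ v, fderiv ℝ φ0 v (Complex.I • v) = 0 := by
    intro v
    have h1 : HasDerivAt (fun t : ℝ => Complex.exp (t * Complex.I) • v) (Complex.I • v) 0 := by
      have h2 : HasDerivAt (fun t : ℝ => Complex.exp (t * Complex.I)) Complex.I 0 := by
        simpa using (((Complex.ofRealCLM.hasDerivAt (x := (0 : ℝ))).mul_const Complex.I).cexp)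
      exact h2.smul_const v
    have h3 : HasFDerivAt φ0 (fderiv ℝ φ0 v) (Complex.exp ((0 : ℝ) * Complex.I) • v) := by
      simpa using ((hc.differentiable one_ne_zero) v).hasFDerivAt
    have h4 := h3.comp_hasDerivAt 0 h1
    have h5 : (φ0 ∘ fun t : ℝ => Complex.exp (t * Complex.I) • v) = fun _ => φ0 v := by
      funext t
      simp [φ0, Complex.norm_exp_ofReal_mul_I]
    rw [h5] at h4
    exact h4.unique (hasDerivAt_const _ _)
  refine ⟨fun v => (∫ v, φ0 v)⁻¹ • φ0 v, hc.const_smul (∫ v, φ0 v)⁻¹, fun v hv => by simp [hz v hv],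
    fun v => mul_nonneg (inv_nonneg.2 hInt.le) (hnn v), ?_, ?_, fun v => ?_⟩
  · rw [h0, smul_eq_mul, mul_one]; exact inv_pos.2 hInt
  · rw [integral_smul, smul_eq_mul, inv_mul_cancel₀ hInt.ne']
  · have := ((hc.differentiable one_ne_zero) v).hasFDerivAt.const_smul (∫ v, φ0 v)⁻¹
    change fderiv ℝ ((∫ v, φ0 v)⁻¹ • φ0) v _ = 0
    rw [HasFDerivAt.fderiv this]
    simp [hI v]

/-- The rescaled density `a^(2 * n) φ(a(v - z))`. -/
noncomputable def kern (φ : (ι → ℂ) → ℝ) (q : (ℝ × (ι → ℂ)) × (ι → ℂ)) : ℂ :=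
  ((q.1.1 ^ (2 * Fintype.card ι) * φ (q.1.1 • (q.2 - q.1.2)) : ℝ) : ℂ)

theorem kern_contDiff {φ : (ι → ℂ) → ℝ} (hφ : IsBump φ) : ContDiff ℝ 1 (kern φ) := by
  have := hφ.contDiff
  have h : ContDiff ℝ 1 fun q : (ℝ × (ι → ℂ)) × (ι → ℂ) =>
      q.1.1 ^ (2 * Fintype.card ι) * φ (q.1.1 • (q.2 - q.1.2)) := by
    fun_prop
  exact Complex.ofRealCLM.contDiff.comp h

theorem kern_eq_zero {φ : (ι → ℂ) → ℝ} (hφ : IsBump φ) {a : ℝ} (ha : 0 < a) {z v : ι → ℂ}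
    (hv : v ∉ Metric.closedBall z (1 / a)) : kern φ ((a, z), v) = 0 := by
  have : φ (a • (v - z)) = 0 := by
    refine hφ.eq_zero _ ?_
    rw [norm_smul, Real.norm_of_nonneg ha.le]
    rw [Metric.mem_closedBall, not_le, dist_eq_norm, div_lt_iff₀ ha] at hv
    linarith [mul_comm a ‖v - z‖]
  simp [kern, this]

theorem fderiv_kern {φ : (ι → ℂ) → ℝ} (hφ : IsBump φ) (a : ℝ) (z v : ι → ℂ) (b : ℝ) (h k : ι → ℂ) :
    fderiv ℝ (kern φ) ((a, z), v) ((b, h), k) =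
      (((2 * Fintype.card ι : ℕ) * a ^ (2 * Fintype.card ι - 1) * b * φ (a • (v - z)) +
       a ^ (2 * Fintype.card ι) * fderiv ℝ φ (a • (v - z)) (b • (v - z) + a • (k - h)) : ℝ) : ℂ) := by
  have h1 : HasFDerivAt (fun q : (ℝ × (ι → ℂ)) × (ι → ℂ) => q.1.1)
    ((ContinuousLinearMap.fst ℝ ℝ (ι → ℂ)).comp (ContinuousLinearMap.fst ℝ _ _)) ((a, z), v) :=
    (hasFDerivAt_fst (𝕜 := ℝ) (p := (a, z))).comp ((a, z), v) hasFDerivAt_fst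
  have h2 : HasFDerivAt (fun q : (ℝ × (ι → ℂ)) × (ι → ℂ) => q.2 - q.1.2)
    (ContinuousLinearMap.snd ℝ _ _ - (ContinuousLinearMap.snd ℝ ℝ (ι → ℂ)).comp (ContinuousLinearMap.fst ℝ _ _)) ((a, z), v) :=
    hasFDerivAt_snd.sub ((hasFDerivAt_snd (𝕜 := ℝ) (p := (a, z))).comp ((a, z), v) hasFDerivAt_fst)
  have h3 := ((hφ.contDiff.differentiable one_ne_zero) (a • (v - z))).hasFDerivAt.comp ((a, z), v)
    (h1.fun_smul h2)
  have h4 := (h1.pow (2 * Fintype.card ι)).mul h3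
  have h5 := Complex.ofRealCLM.hasFDerivAt.comp ((a, z), v) h4
  have h6 : fderiv ℝ (kern φ) ((a, z), v) = _ := HasFDerivAt.fderiv h5
  rw [h6]
  simp
  ring

end

section

variable {ι : Type*} [Fintype ι] [DecidableEq ι]

theorem integrableOn_smear {Φ : (ι → ℂ) → ι → ℂ} {N V : Set (ι → ℂ)} (hP : IsProperHol Φ N V)
    {u : (ι → ℂ) → ℂ} (hu : AnalyticOnNhd ℂ u N) {χ : (ι → ℂ) → ℂ} (hχ : Continuous χ)
    {K : Set (ι → ℂ)} (hKV : K ⊆ V) (hK : IsCompact K) (h0 : ∀ v ∉ K, χ v = 0) :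
    IntegrableOn (fun x => u x * jac Φ x * (starRingEnd ℂ) (jac Φ x) * χ (Φ x)) N := by
  have hcpt := hP.isCompact_preimage K hKV hK
  have hΦc : ContinuousOn Φ N := fun x hx => (hP.analytic x hx).continuousAt.continuousWithinAt
  have hc : ContinuousOn (fun x => u x * jac Φ x * (starRingEnd ℂ) (jac Φ x) * χ (Φ x)) N :=
    (continuousOn_smearWeight hP hu).mul (hχ.comp_continuousOn hΦc)
  obtain ⟨C3, hC3⟩ := hcpt.exists_bound_of_continuousOn (hc.mono inter_subset_left)
  refine integrableOn_of_bound (K := N ∩ Φ ⁻¹' K) (C := C3) hP.isOpen_source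
    (hc.aestronglyMeasurable hP.isOpen_source.measurableSet) hcpt fun x hx => ?_
  by_cases hxK : Φ x ∈ K
  · rw [indicator_of_mem (show x ∈ N ∩ Φ ⁻¹' K from ⟨hx, hxK⟩)]
    exact hC3 x ⟨hx, hxK⟩
  · rw [indicator_of_notMem (fun hh => hxK hh.2)]
    simp [h0 _ hxK]

theorem smear_const_mul (Φ : (ι → ℂ) → ι → ℂ) (N : Set (ι → ℂ)) (u χ : (ι → ℂ) → ℂ) (c : ℂ) :
    smear Φ N u (fun v => c * χ v) = c * smear Φ N u χ := by
  unfold smear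
  rw [← integral_const_mul]
  congr 1; ext x; ring

theorem smear_sum {Φ : (ι → ℂ) → ι → ℂ} {N V : Set (ι → ℂ)} (hP : IsProperHol Φ N V)
    {u : (ι → ℂ) → ℂ} (hu : AnalyticOnNhd ℂ u N) {χ : ι → (ι → ℂ) → ℂ} (hχ : ∀ j, Continuous (χ j))
    {K : Set (ι → ℂ)} (hKV : K ⊆ V) (hK : IsCompact K) (h0 : ∀ j, ∀ v ∉ K, χ j v = 0) :
    smear Φ N u (fun v => ∑ j, χ j v) = ∑ j, smear Φ N u (χ j) := by
  unfold smear
  rw [← integral_finsetSum]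
  · congr 1; ext x; rw [Finset.mul_sum]
  · exact fun j _ => integrableOn_smear hP hu (hχ j) hKV hK (h0 j)

theorem smear_add {Φ : (ι → ℂ) → ι → ℂ} {N V : Set (ι → ℂ)} (hP : IsProperHol Φ N V)
    {u : (ι → ℂ) → ℂ} (hu : AnalyticOnNhd ℂ u N) {χ₁ χ₂ : (ι → ℂ) → ℂ} (hχ₁ : Continuous χ₁)
    (hχ₂ : Continuous χ₂) {K : Set (ι → ℂ)} (hKV : K ⊆ V) (hK : IsCompact K)
    (h₁ : ∀ v ∉ K, χ₁ v = 0) (h₂ : ∀ v ∉ K, χ₂ v = 0) :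
    smear Φ N u (fun v => χ₁ v + χ₂ v) = smear Φ N u χ₁ + smear Φ N u χ₂ := by
  unfold smear
  rw [← integral_add (integrableOn_smear hP hu hχ₁ hKV hK h₁)
    (integrableOn_smear hP hu hχ₂ hKV hK h₂)]
  congr 1; ext x; ring

theorem differentiableAt_of_dbar_eq_zero {E : Type*} [NormedAddCommGroup E] [NormedSpace ℂ E]
    {g : E → ℂ} {z : E} {L : E →L[ℝ] ℂ} (hg : HasFDerivAt g L z)
    (hL : ∀ h, L h + Complex.I * L (Complex.I • h) = 0) : DifferentiableAt ℂ g z := by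
  have hI : ∀ h, L (Complex.I • h) = Complex.I * L h := fun h => by
    linear_combination (-Complex.I) * hL h + L (Complex.I • h) * Complex.I_mul_I
  let L' : E →L[ℂ] ℂ :=
    { toFun := L
      map_add' := L.map_add
      map_smul' := fun c h => by
        have h1 : c • h = c.re • h + c.im • (Complex.I • h) := by
          conv_lhs => rw [← Complex.re_add_im c, add_smul, mul_smul]
          rfl
        rw [h1, map_add, L.map_smul, L.map_smul, hI]
        simp only [Complex.real_smul, RingHom.id_apply, smul_eq_mul]
        conv_rhs => rw [← Complex.re_add_im c]
        ring
      cont := L.continuous }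
  rw [differentiableAt_iff_restrictScalars ℝ hg.differentiableAt]
  refine ⟨L', ?_⟩
  rw [hg.fderiv]
  ext; rfl

theorem smear_kern_hasFDerivAt {Φ : (ι → ℂ) → ι → ℂ} {N V : Set (ι → ℂ)} (hP : IsProperHol Φ N V)
    {u : (ι → ℂ) → ℂ} (hu : AnalyticOnNhd ℂ u N) {φ : (ι → ℂ) → ℝ} (hφ : IsBump φ)
    {a : ℝ} (ha : 0 < a) {z : ι → ℂ} (hz : Metric.closedBall z (1 / a) ⊆ V) :
    ∃ F' : ℝ × (ι → ℂ) →L[ℝ] ℂ,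
      HasFDerivAt (fun p => smear Φ N u (fun v => kern φ (p, v))) F' (a, z) ∧ F' (1, 0) = 0 ∧
      ∀ h, F' (0, h) + Complex.I * F' (0, Complex.I • h) = 0 := by
  have hkz := fun v => kern_eq_zero hφ ha (z := z) (v := v)
  have hB := isCompact_closedBall z (1 / a)
  obtain ⟨δ, hδ, hδV⟩ := hB.exists_cthickening_subset_open hP.isOpen_target hz
  rw [cthickening_closedBall hδ.le (by positivity)] at hδV
  set K := Metric.closedBall z (δ + 1 / a) with hK
  have hKc : IsCompact K := isCompact_closedBall _ _
  have hev : ∀ᶠ p : ℝ × (ι → ℂ) in 𝓝 (a, z), ∀ v ∉ K, kern φ (p, v) = 0 := by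
    have h1 : ∀ᶠ p : ℝ × (ι → ℂ) in 𝓝 (a, z), 0 < p.1 :=
      continuous_fst.continuousAt.eventually_const_lt (by simpa using ha)
    have h2 : ∀ᶠ p : ℝ × (ι → ℂ) in 𝓝 (a, z), 1 / p.1 + dist p.2 z < δ + 1 / a := by
      have : ContinuousAt (fun p : ℝ × (ι → ℂ) => 1 / p.1 + dist p.2 z) (a, z) := by
        refine ContinuousAt.add (continuousAt_const.div continuousAt_fst ha.ne') ?_
        fun_prop
      exact this.eventually_lt continuousAt_const (by simpa using hδ)
    filter_upwards [h1, h2] with p hp1 hp2 v hv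
    refine kern_eq_zero hφ hp1 fun hv' => hv ?_
    rw [Metric.mem_closedBall] at hv' ⊢
    linarith [dist_triangle v p.2 z]
  have hkd := kern_contDiff hφ
  obtain ⟨F', hF, hF'⟩ := smear_hasFDerivAt hP hu hkd hδV hKc (p₀ := (a, z)) hev
  set n := Fintype.card ι with hn
  refine ⟨F', hF, ?_, fun h => ?_⟩
  · let χ : ι → (ι → ℂ) → ℂ := fun j v => (starRingEnd ℂ) (v j - z j) * kern φ ((a, z), v)
    have hconj : ContDiff ℝ 1 fun c : ℂ => (starRingEnd ℂ) c := Complex.conjCLE.contDiff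
    have hk2 : ContDiff ℝ 1 (fun v => kern φ ((a, z), v)) := hkd.comp (contDiff_prodMk_right _)
    have hχ1 : ∀ j, ContDiff ℝ 1 (χ j) := fun j =>
      (hconj.comp ((contDiff_apply ℝ ℂ j).sub contDiff_const)).mul hk2
    have hχd : ∀ j v h, fderiv ℝ (χ j) v h = (starRingEnd ℂ) (v j - z j) *
        fderiv ℝ (kern φ) ((a, z), v) (0, h) + kern φ ((a, z), v) * (starRingEnd ℂ) (h j) := by
      intro j v h
      have h1 : HasFDerivAt (fun v : ι → ℂ => (starRingEnd ℂ) (v j - z j))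
          ((Complex.conjCLE : ℂ →L[ℝ] ℂ).comp (ContinuousLinearMap.proj (R := ℝ) (φ := fun _ : ι => ℂ) j)) v :=
        (Complex.conjCLE : ℂ →L[ℝ] ℂ).hasFDerivAt.comp v ((hasFDerivAt_apply j v).sub_const (z j))
      have h2 : HasFDerivAt (fun v => kern φ ((a, z), v)) _ v :=
        ((hkd.differentiable one_ne_zero) ((a, z), v)).hasFDerivAt.comp v (hasFDerivAt_prodMk_right (a, z) v)
      have h3 : fderiv ℝ (χ j) v = _ := (h1.mul h2).fderiv
      rw [h3]
      simp
    have hsum : ∀ v, a * fderiv ℝ (kern φ) ((a, z), v) ((1, 0), 0) =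
        ∑ j, dbar (fderiv ℝ (χ j) v) (Pi.single j 1) := by
      intro v
      have h1 : ∀ j, dbar (fderiv ℝ (χ j) v) (Pi.single j 1) = (starRingEnd ℂ) (v j - z j) *
        dbar ((fderiv ℝ (kern φ) ((a, z), v)).comp (ContinuousLinearMap.inr ℝ _ _)) (Pi.single j 1)
          + 2 * kern φ ((a, z), v) := by
        intro j
        simp only [dbar, hχd, ContinuousLinearMap.comp_apply, ContinuousLinearMap.inr_apply,
          Pi.smul_apply, Pi.single_eq_same, smul_eq_mul, mul_one, map_one, Complex.conj_I]
        linear_combination (-kern φ ((a, z), v)) * Complex.I_mul_I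
      simp only [h1]
      rw [Finset.sum_add_distrib]
      have h2 := dbar_eq_sum ((fderiv ℝ (kern φ) ((a, z), v)).comp (ContinuousLinearMap.inr ℝ _ _)) (v - z)
      simp only [Pi.sub_apply] at h2
      rw [← h2]
      simp only [dbar, ContinuousLinearMap.comp_apply, ContinuousLinearMap.inr_apply]
      have e0 : ((0 : ℝ), (0 : ι → ℂ)) = 0 := rfl
      rw [← e0, fderiv_kern hφ, fderiv_kern hφ, fderiv_kern hφ]
      have h3 := hφ.fderiv_I_smul (a • (v - z))
      have h4 : a • (Complex.I • (v - z)) = Complex.I • (a • (v - z)) := smul_comm _ _ _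
      simp only [zero_smul, zero_add, sub_zero, smul_zero, add_zero, mul_zero, h4, h3, zero_mul,
        Complex.ofReal_zero, one_smul, kern, Finset.sum_const, Finset.card_univ, nsmul_eq_mul, map_smul,
        smul_eq_mul, mul_one]
      rcases Nat.eq_zero_or_pos (Fintype.card ι) with h0 | h0
      · simp [h0]
      · obtain ⟨m, hm⟩ : ∃ m, 2 * Fintype.card ι = m + 1 := ⟨2 * Fintype.card ι - 1, by omega⟩
        have hm' : (Fintype.card ι : ℂ) * 2 = m + 1 := by exact_mod_cast (by omega : Fintype.card ι * 2 = m + 1)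
        rw [hm]
        simp only [Nat.add_sub_cancel]
        push_cast
        linear_combination (-(a : ℂ) ^ (m + 1) * φ (a • (v - z))) * hm'
    rw [hF']
    have h5 : (a : ℂ) * smear Φ N u (fun v => fderiv ℝ (kern φ) ((a, z), v) ((1, 0), 0)) = 0 := by
      rw [← smear_const_mul]
      simp only [hsum]
      have hχ0 : ∀ j, ∀ v ∉ Metric.closedBall z (1 / a), χ j v = 0 := fun j v hv => by
        simp only [χ]; rw [hkz v hv, mul_zero]
      rw [smear_sum hP hu (K := Metric.closedBall z (1 / a)) _ hz hB]
      · exact Finset.sum_eq_zero fun j _ => smear_dbar hP hu (hχ1 j) hz hB (hχ0 j) _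
      · intro j v hv
        have : fderiv ℝ (χ j) v = 0 := by
          have : χ j =ᶠ[𝓝 v] fun _ => 0 := by
            filter_upwards [Metric.isClosed_closedBall.isOpen_compl.mem_nhds hv] with w hw
            exact hχ0 j w hw
          rw [this.fderiv_eq]; simp
        simp [this, dbar]
      · intro j
        have := (hχ1 j).continuous_fderiv one_ne_zero
        unfold dbar
        fun_prop
    exact (mul_eq_zero.1 h5).resolve_left (by exact_mod_cast ha.ne')
  · have hk2 : ContDiff ℝ 1 (fun v => kern φ ((a, z), v)) := hkd.comp (contDiff_prodMk_right _)
    have h1 : ∀ v h, fderiv ℝ (kern φ) ((a, z), v) ((0, h), 0) =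
        - fderiv ℝ (fun v => kern φ ((a, z), v)) v h := by
      intro v h
      have h2 : HasFDerivAt (fun v => kern φ ((a, z), v)) _ v :=
        ((hkd.differentiable one_ne_zero) ((a, z), v)).hasFDerivAt.comp v (hasFDerivAt_prodMk_right (a, z) v)
      rw [h2.fderiv]
      simp only [ContinuousLinearMap.comp_apply, ContinuousLinearMap.inr_apply]
      have e0 : ((0 : ℝ), (0 : ι → ℂ)) = 0 := rfl
      rw [← e0, fderiv_kern hφ, fderiv_kern hφ]
      simp
    have h3 := smear_dbar hP hu hk2 hz hB (fun v hv => hkz v hv) h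
    rw [hF', hF', ← smear_const_mul]
    simp only [h1]
    have h4 : ∀ v ∉ Metric.closedBall z (1 / a), fderiv ℝ (fun v => kern φ ((a, z), v)) v = 0 := by
      intro v hv
      have : (fun v => kern φ ((a, z), v)) =ᶠ[𝓝 v] fun _ => 0 := by
        filter_upwards [Metric.isClosed_closedBall.isOpen_compl.mem_nhds hv] with w hw
        exact hkz w hw
      rw [this.fderiv_eq]; simp
    have h5 := hk2.continuous_fderiv one_ne_zero
    rw [← smear_add hP hu (K := Metric.closedBall z (1 / a)) _ _ hz hB]
    · rw [← neg_eq_zero, ← h3, ← neg_one_mul, ← smear_const_mul]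
      congr 1; ext v; simp only [dbar]; ring
    · intro v hv; simp [h4 v hv]
    · intro v hv; simp [h4 v hv]
    · fun_prop
    · fun_prop

/-- The smeared trace does not depend on the scale. -/
theorem smear_kern_eq {Φ : (ι → ℂ) → ι → ℂ} {N V : Set (ι → ℂ)} (hP : IsProperHol Φ N V)
    {u : (ι → ℂ) → ℂ} (hu : AnalyticOnNhd ℂ u N) {φ : (ι → ℂ) → ℝ} (hφ : IsBump φ)
    {a b : ℝ} (ha : 0 < a) (hab : a ≤ b) {z : ι → ℂ} (hz : Metric.closedBall z (1 / a) ⊆ V) :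
    smear Φ N u (fun v => kern φ ((b, z), v)) = smear Φ N u (fun v => kern φ ((a, z), v)) := by
  have hd : ∀ c, a ≤ c → HasDerivAt (fun c => smear Φ N u (fun v => kern φ ((c, z), v))) 0 c := by
    intro c hc
    have hc0 : 0 < c := ha.trans_le hc
    have hzc : Metric.closedBall z (1 / c) ⊆ V :=
      (Metric.closedBall_subset_closedBall (one_div_le_one_div_of_le ha hc)).trans hz
    obtain ⟨F', hF, hF1, -⟩ := smear_kern_hasFDerivAt hP hu hφ hc0 hzc
    have := hF.comp_hasDerivAt c ((hasDerivAt_id c).prodMk (hasDerivAt_const c z))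
    rw [hF1] at this
    exact this
  exact constant_of_has_deriv_right_zero
    (fun c hc => (hd c hc.1).continuousAt.continuousWithinAt)
    (fun c hc => (hd c hc.1).hasDerivWithinAt) b ⟨hab, le_rfl⟩

theorem exists_trace {Φ : (ι → ℂ) → ι → ℂ} {N V : Set (ι → ℂ)} (hP : IsProperHol Φ N V)
    {u : (ι → ℂ) → ℂ} (hu : AnalyticOnNhd ℂ u N) {φ : (ι → ℂ) → ℝ} (hφ : IsBump φ) :
    ∃ g : (ι → ℂ) → ℂ, DifferentiableOn ℂ g V ∧
      ∀ z a, 0 < a → Metric.closedBall z (1 / a) ⊆ V →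
        g z = smear Φ N u (fun v => kern φ ((a, z), v)) := by
  have hex : ∀ z ∈ V, ∃ a, 0 < a ∧ Metric.closedBall z (1 / a) ⊆ V := fun z hz => by
    obtain ⟨r, hr, hrV⟩ := Metric.nhds_basis_closedBall.mem_iff.1 (hP.isOpen_target.mem_nhds hz)
    exact ⟨1 / r, by positivity, by simpa using hrV⟩
  choose! A hA0 hA using hex
  have key : ∀ z a, 0 < a → Metric.closedBall z (1 / a) ⊆ V →
      smear Φ N u (fun v => kern φ ((A z, z), v)) = smear Φ N u (fun v => kern φ ((a, z), v)) := by
    intro z a ha hz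
    have hzV : z ∈ V := hz (Metric.mem_closedBall_self (by positivity))
    rcases le_total a (A z) with h | h
    · exact smear_kern_eq hP hu hφ ha h hz
    · exact (smear_kern_eq hP hu hφ (hA0 z hzV) h (hA z hzV)).symm
  refine ⟨fun z => smear Φ N u (fun v => kern φ ((A z, z), v)), fun z hz => ?_, key⟩
  refine DifferentiableAt.differentiableWithinAt ?_
  set a := A z with ha
  have ha0 : 0 < a := hA0 z hz
  have hb : Metric.closedBall z (1 / (2 * a)) ⊆ V :=
    (Metric.closedBall_subset_closedBall (one_div_le_one_div_of_le ha0 (by linarith))).trans (hA z hz)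
  obtain ⟨F', hF, -, hF'⟩ := smear_kern_hasFDerivAt hP hu hφ (a := 2 * a) (by positivity) hb
  have h1 := hF.comp z (hasFDerivAt_prodMk_right (2 * a) z)
  have h2 := differentiableAt_of_dbar_eq_zero h1 (by simpa using hF')
  refine h2.congr_of_eventuallyEq ?_
  filter_upwards [Metric.ball_mem_nhds z (show 0 < 1 / (2 * a) by positivity)] with w hw
  refine key w (2 * a) (by positivity) (fun v hv => hA z hz ?_)
  rw [Metric.mem_closedBall] at hv ⊢
  rw [Metric.mem_ball] at hw
  have : 1 / a = 1 / (2 * a) + 1 / (2 * a) := by field_simp; norm_num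
  have := dist_triangle v w z
  linarith

end

section

variable {ι : Type*} [Fintype ι] [DecidableEq ι]

theorem det_fderiv_eq_jac (Φ : (ι → ℂ) → ι → ℂ) (x : ι → ℂ) :
    LinearMap.det ((fderiv ℂ Φ x : (ι → ℂ) →L[ℂ] ι → ℂ) : (ι → ℂ) →ₗ[ℂ] ι → ℂ) = jac Φ x := by
  rw [← LinearMap.det_toMatrix', jac, ← Matrix.det_transpose]
  congr 1

/-- The local inverse of a holomorphic map at a point where the Jacobian is nonzero. -/
theorem exists_localInverse {Φ : (ι → ℂ) → ι → ℂ} {N O : Set (ι → ℂ)} (hΦ : AnalyticOnNhd ℂ Φ N)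
    (hO : IsOpen O) (hON : O ⊆ N) {x : ι → ℂ} (hx : x ∈ O) (hj : jac Φ x ≠ 0) :
    ∃ e : OpenPartialHomeomorph (ι → ℂ) (ι → ℂ), (e : (ι → ℂ) → ι → ℂ) = Φ ∧ x ∈ e.source ∧
      e.source ⊆ O ∧ (∀ y ∈ e.source, jac Φ y ≠ 0) ∧
      ∀ v ∈ e.target, DifferentiableAt ℂ e.symm v := by
  have hequiv : ∀ y, jac Φ y ≠ 0 → ∃ L : (ι → ℂ) ≃L[ℂ] (ι → ℂ), (L : (ι → ℂ) →L[ℂ] ι → ℂ) = fderiv ℂ Φ y := by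
    intro y hy
    refine ⟨ContinuousLinearMap.toContinuousLinearEquivOfDetNeZero (fderiv ℂ Φ y) ?_, ?_⟩
    · rwa [ContinuousLinearMap.det, det_fderiv_eq_jac]
    · ext; simp
  obtain ⟨L, hL⟩ := hequiv x hj
  have hs : HasStrictFDerivAt Φ (L : (ι → ℂ) →L[ℂ] ι → ℂ) x := by
    rw [hL]; exact (hΦ x (hON hx)).hasStrictFDerivAt
  have hopen : IsOpen (O ∩ {y | jac Φ y ≠ 0}) := by
    rw [isOpen_iff_mem_nhds]
    rintro y ⟨hy, hyj⟩
    exact inter_mem (hO.mem_nhds hy)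
      ((analyticAt_jac (hΦ y (hON hy))).continuousAt.eventually_ne hyj)
  refine ⟨hs.toOpenPartialHomeomorph.restrOpen _ hopen, ?_, ?_, ?_, ?_, ?_⟩
  · simp
  · exact ⟨hs.mem_toOpenPartialHomeomorph_source, hx, hj⟩
  · rintro y ⟨-, hy, -⟩; exact hy
  · rintro y ⟨-, -, hy⟩; exact hy
  · intro v hv
    set e := hs.toOpenPartialHomeomorph.restrOpen _ hopen with he
    have h1 : e.symm v ∈ e.source := e.map_target hv
    obtain ⟨L', hL'⟩ := hequiv _ h1.2.2
    refine (e.hasFDerivAt_symm (f' := L') hv ?_).differentiableAt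
    rw [hL']
    have : (e : (ι → ℂ) → ι → ℂ) = Φ := by simp [he]
    rw [this]
    exact (hΦ _ (hON h1.2.1)).differentiableAt.hasFDerivAt

/-- All points of `N` over `z` are noncritical. -/
def IsRegVal (Φ : (ι → ℂ) → ι → ℂ) (N : Set (ι → ℂ)) (z : ι → ℂ) : Prop :=
  ∀ x ∈ N, Φ x = z → jac Φ x ≠ 0

/-- A proper holomorphic map shrinks: away from a relatively open set containing the fibre,
nothing maps near the base point. -/
theorem IsProperHol.exists_ball {Φ : (ι → ℂ) → ι → ℂ} {N V : Set (ι → ℂ)} (hP : IsProperHol Φ N V)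
    {z : ι → ℂ} (hz : z ∈ V) {O : Set (ι → ℂ)} (hO : IsOpen O)
    (hf : ∀ x ∈ N, Φ x = z → x ∈ O) :
    ∃ r > 0, Metric.ball z r ⊆ V ∧ ∀ x ∈ N, Φ x ∈ Metric.ball z r → x ∈ O := by
  obtain ⟨r, hr, hrV⟩ := Metric.nhds_basis_closedBall.mem_iff.1 (hP.isOpen_target.mem_nhds hz)
  have hc := hP.isCompact_preimage _ hrV (isCompact_closedBall z r)
  have hc2 : IsCompact ((N ∩ Φ ⁻¹' Metric.closedBall z r) \ O) := hc.diff hO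
  have hΦc : ContinuousOn Φ ((N ∩ Φ ⁻¹' Metric.closedBall z r) \ O) := fun x hx =>
    (hP.analytic x hx.1.1).continuousAt.continuousWithinAt
  have hc3 := hc2.image_of_continuousOn hΦc
  have hz' : z ∉ Φ '' ((N ∩ Φ ⁻¹' Metric.closedBall z r) \ O) := by
    rintro ⟨x, hx, hxz⟩
    exact hx.2 (hf x hx.1.1 hxz)
  obtain ⟨r', hr', hr'O⟩ := Metric.isOpen_iff.1 hc3.isClosed.isOpen_compl z hz'
  refine ⟨min r r', lt_min hr hr', (Metric.ball_subset_closedBall.trans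
    (Metric.closedBall_subset_closedBall (min_le_left _ _))).trans hrV, fun x hx hxr => ?_⟩
  by_contra hxO
  refine hr'O (Metric.ball_subset_ball (min_le_right _ _) hxr) ⟨x, ⟨⟨hx, ?_⟩, hxO⟩, rfl⟩
  exact Metric.ball_subset_closedBall (Metric.ball_subset_ball (min_le_left _ _) hxr)

theorem IsProperHol.exists_sheets {Φ : (ι → ℂ) → ι → ℂ} {N V : Set (ι → ℂ)} (hP : IsProperHol Φ N V)
    {z : ι → ℂ} (hz : z ∈ V) (hreg : IsRegVal Φ N z) :
    ∃ (S : Finset (ι → ℂ)) (r : ℝ) (σ : (ι → ℂ) → (ι → ℂ) → ι → ℂ), 0 < r ∧ Metric.ball z r ⊆ V ∧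
      (∀ x ∈ S, σ x z = x) ∧
      (∀ x ∈ S, ∀ v ∈ Metric.ball z r, σ x v ∈ N ∧ Φ (σ x v) = v ∧ jac Φ (σ x v) ≠ 0 ∧
        DifferentiableAt ℂ (σ x) v) ∧
      ∀ v ∈ Metric.ball z r, BijOn (fun x => σ x v) S (N ∩ Φ ⁻¹' {v}) := by
  have hN := hP.isOpen_source
  have hcpt : IsCompact (N ∩ Φ ⁻¹' {z}) :=
    hP.isCompact_preimage {z} (singleton_subset_iff.2 hz) isCompact_singleton
  have hfin : (N ∩ Φ ⁻¹' {z}).Finite := by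
    have h1 : ∀ x ∈ N ∩ Φ ⁻¹' {z}, ∃ O ∈ 𝓝 x, ∀ y ∈ O, Φ y = z → y = x := by
      rintro x ⟨hx, hxz⟩
      obtain ⟨e, he, hxe, heO, -, -⟩ := exists_localInverse hP.analytic hN subset_rfl hx (hreg x hx hxz)
      refine ⟨e.source, e.open_source.mem_nhds hxe, fun y hy hyz => e.injOn hy hxe ?_⟩
      rw [he, hyz, hxz]
    choose! O hO hO' using h1
    obtain ⟨t, ht, htO⟩ := hcpt.elim_nhds_subcover O hO
    refine t.finite_toSet.subset fun y hy => ?_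
    obtain ⟨x, hx, hyx⟩ := mem_iUnion₂.1 (htO hy)
    rw [hO' x (ht x hx) y hyx hy.2]
    exact hx
  obtain ⟨Q, hQ, hQd⟩ := hfin.t2_separation
  have h2 : ∀ x ∈ N ∩ Φ ⁻¹' {z}, ∃ e : OpenPartialHomeomorph (ι → ℂ) (ι → ℂ), (e : (ι → ℂ) → ι → ℂ) = Φ ∧ x ∈ e.source ∧
      e.source ⊆ N ∩ Q x ∧ (∀ y ∈ e.source, jac Φ y ≠ 0) ∧
      ∀ v ∈ e.target, DifferentiableAt ℂ e.symm v := fun x hx =>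
    exists_localInverse hP.analytic (hN.inter (hQ x).2) inter_subset_left ⟨hx.1, (hQ x).1⟩
      (hreg x hx.1 hx.2)
  have : Nonempty (OpenPartialHomeomorph (ι → ℂ) (ι → ℂ)) := ⟨OpenPartialHomeomorph.refl _⟩
  choose! e he hxe heO hej hed using h2
  set S := hfin.toFinset with hS
  have hmem : ∀ x, x ∈ S ↔ x ∈ N ∩ Φ ⁻¹' {z} := fun x => hfin.mem_toFinset
  obtain ⟨r, hr, hrV, hrO⟩ := hP.exists_ball hz (O := ⋃ x ∈ S, (e x).source)
    (isOpen_biUnion fun x _ => (e x).open_source) (fun x hx hxz => by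
      have : x ∈ N ∩ Φ ⁻¹' {z} := ⟨hx, hxz⟩
      exact mem_biUnion ((hmem x).2 this) (hxe x this))
  have h3 : ∀ᶠ v in 𝓝 z, ∀ x ∈ S, v ∈ (e x).target := by
    rw [Filter.eventually_all_finset]
    intro x hx
    have hx' := (hmem x).1 hx
    refine (e x).open_target.mem_nhds ?_
    have := (e x).map_source (hxe x hx')
    rwa [he x hx', hx'.2] at this
  obtain ⟨r', hr', hr'e⟩ := Metric.eventually_nhds_iff_ball.1 h3
  have hb1 : Metric.ball z (min r r') ⊆ Metric.ball z r := Metric.ball_subset_ball (min_le_left _ _)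
  have hb2 : Metric.ball z (min r r') ⊆ Metric.ball z r' := Metric.ball_subset_ball (min_le_right _ _)
  have hright : ∀ x ∈ S, ∀ v ∈ Metric.ball z (min r r'), Φ ((e x).symm v) = v := by
    intro x hx v hv
    have := (e x).right_inv (hr'e v (hb2 hv) x hx)
    rwa [he x ((hmem x).1 hx)] at this
  have hsrc : ∀ x ∈ S, ∀ v ∈ Metric.ball z (min r r'), (e x).symm v ∈ (e x).source :=
    fun x hx v hv => (e x).map_target (hr'e v (hb2 hv) x hx)
  refine ⟨S, min r r', fun x => (e x).symm, lt_min hr hr', hb1.trans hrV, ?_, ?_, ?_⟩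
  · intro x hx
    have hx' := (hmem x).1 hx
    have := (e x).left_inv (hxe x hx')
    rwa [he x hx', hx'.2] at this
  · intro x hx v hv
    have hx' := (hmem x).1 hx
    exact ⟨(heO x hx' (hsrc x hx v hv)).1, hright x hx v hv, hej x hx' _ (hsrc x hx v hv),
      hed x hx' v (hr'e v (hb2 hv) x hx)⟩
  · intro v hv
    refine ⟨fun x hx => ⟨(heO x ((hmem x).1 hx) (hsrc x hx v hv)).1, hright x hx v hv⟩, ?_, ?_⟩
    · intro x hx y hy hxy
      by_contra hne
      have h4 := hQd ((hmem x).1 hx) ((hmem y).1 hy) hne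
      refine Set.disjoint_left.1 h4 (heO x ((hmem x).1 hx) (hsrc x hx v hv)).2 ?_
      simp only at hxy
      rw [hxy]
      exact (heO y ((hmem y).1 hy) (hsrc y hy v hv)).2
    · rintro x' ⟨hx'N, hx'v⟩
      have hpv' : Φ x' = v := hx'v
      obtain ⟨x, hx, hxx'⟩ := mem_iUnion₂.1 (hrO x' hx'N (by rw [hpv']; exact hb1 hv))
      refine ⟨x, hx, ?_⟩
      have := (e x).left_inv hxx'
      rw [he x ((hmem x).1 hx), hpv'] at this
      exact this

end

section

variable {ι : Type*} [Fintype ι] [DecidableEq ι]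

theorem det_restrictScalars_fderiv (Φ : (ι → ℂ) → ι → ℂ) (x : ι → ℂ) :
    ((fderiv ℂ Φ x).restrictScalars ℝ).det = Complex.normSq (jac Φ x) := by
  have h := LinearMap.det_restrictScalars (R := ℝ) (S := ℂ)
    (f := ((fderiv ℂ Φ x : (ι → ℂ) →L[ℂ] ι → ℂ) : (ι → ℂ) →ₗ[ℂ] ι → ℂ))
  rw [det_fderiv_eq_jac, Algebra.norm_complex_apply] at h
  exact h

theorem tendsto_integral_kern {φ : (ι → ℂ) → ℝ} (hφ : IsBump φ) {h : (ι → ℂ) → ℂ} {z : ι → ℂ} {r : ℝ}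
    (hr : 0 < r) (hh : ContinuousOn h (Metric.closedBall z r)) :
    Tendsto (fun a : ℝ => ∫ v in Metric.closedBall z r, h v * kern φ ((a, z), v)) atTop (𝓝 (h z)) := by
  set B := Metric.closedBall z r with hB
  have hfr : Module.finrank ℝ (ι → ℂ) = 2 * Fintype.card ι := by
    rw [Module.finrank_pi_fintype]
    simp [Complex.finrank_real_complex, mul_comm]
  have hInt : Integrable (B.indicator h) :=
    (hh.integrableOn_compact (isCompact_closedBall z r)).integrable_indicator Metric.isClosed_closedBall.measurableSet
  have h1 := tendsto_integral_comp_smul_smul_of_integrable (μ := volume) hφ.nonneg hφ.integral_eq_one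
    (tendsto_const_nhds.congr' (f₁ := fun _ => (0 : ℝ)) ?_)
    (g := fun w => B.indicator h (w + z)) (hInt.comp_add_right z) ?_
  · have h2 : B.indicator h (0 + z) = h z := by
      rw [zero_add, indicator_of_mem]
      exact Metric.mem_closedBall_self hr.le
    rw [h2] at h1
    refine h1.congr fun a => ?_
    rw [← integral_indicator Metric.isClosed_closedBall.measurableSet,
      ← integral_add_right_eq_self (B.indicator fun v => h v * kern φ ((a, z), v)) z]
    congr 1; ext w
    by_cases hw : w + z ∈ B
    · rw [indicator_of_mem hw, indicator_of_mem hw]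
      simp only [kern, hfr, add_sub_cancel_right, Complex.real_smul]
      ring
    · rw [indicator_of_notMem hw, indicator_of_notMem hw, smul_zero]
  · have : ∀ᶠ v in Bornology.cobounded (ι → ℂ), 1 < ‖v‖ :=
      tendsto_norm_cobounded_atTop.eventually_gt_atTop 1
    filter_upwards [this] with v hv
    rw [hφ.eq_zero v hv, mul_zero]
  · have h3 : ContinuousAt (B.indicator h) (0 + z) := by
      rw [zero_add]
      have h4 : B ∈ 𝓝 z := Metric.closedBall_mem_nhds z hr
      refine (hh.continuousAt h4).congr ?_
      filter_upwards [h4] with v hv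
      rw [indicator_of_mem hv]
    exact ContinuousAt.comp (f := fun w => w + z) h3 (by fun_prop)

theorem smear_tendsto {Φ : (ι → ℂ) → ι → ℂ} {N V : Set (ι → ℂ)} (hP : IsProperHol Φ N V)
    {u : (ι → ℂ) → ℂ} (hu : AnalyticOnNhd ℂ u N) {φ : (ι → ℂ) → ℝ} (hφ : IsBump φ)
    {z : ι → ℂ} (hz : z ∈ V) (hreg : IsRegVal Φ N z) :
    (N ∩ Φ ⁻¹' {z}).Finite ∧
    Tendsto (fun a => smear Φ N u (fun v => kern φ ((a, z), v))) atTop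
      (𝓝 (∑ᶠ x ∈ N ∩ Φ ⁻¹' {z}, u x)) := by
  obtain ⟨S, r, σ, hr, hrV, hσz, hσ, hbij⟩ := hP.exists_sheets hz hreg
  have hSeq : (N ∩ Φ ⁻¹' {z}) = ↑S := by
    rw [← (hbij z (Metric.mem_ball_self hr)).image_eq]
    ext x
    constructor
    · rintro ⟨y, hy, rfl⟩
      simpa [hσz y hy] using hy
    · intro hx
      exact ⟨x, hx, hσz x hx⟩
  rw [hSeq, finsum_mem_coe_finset]
  refine ⟨S.finite_toSet, ?_⟩
  set B := Metric.closedBall z (r / 2) with hB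
  have hBr : B ⊆ Metric.ball z r := Metric.closedBall_subset_ball (by linarith)
  have hBc : IsCompact B := isCompact_closedBall _ _
  have hσc : ∀ x ∈ S, ContinuousOn (σ x) B := fun x hx v hv =>
    (hσ x hx v (hBr hv)).2.2.2.continuousAt.continuousWithinAt
  have hlim : ∀ x ∈ S, Tendsto (fun a : ℝ => ∫ v in B, u (σ x v) * kern φ ((a, z), v)) atTop (𝓝 (u x)) := by
    intro x hx
    have h1 : ContinuousOn (fun v => u (σ x v)) B := by
      intro v hv
      have h2 := (hu _ (hσ x hx v (hBr hv)).1).continuousAt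
      exact h2.comp_continuousWithinAt (hσc x hx v hv)
    have := tendsto_integral_kern hφ (by positivity) h1
    simpa only [hσz x hx] using this
  refine (tendsto_finsetSum S hlim).congr' ?_
  filter_upwards [eventually_ge_atTop (2 / r)] with a ha
  have ha0 : 0 < a := lt_of_lt_of_le (by positivity) ha
  have haB : Metric.closedBall z (1 / a) ⊆ B := by
    refine Metric.closedBall_subset_closedBall ?_
    have := one_div_le_one_div_of_le (by positivity) ha
    rwa [one_div_div] at this
  have hk0 : ∀ v ∉ B, kern φ ((a, z), v) = 0 := fun v hv => kern_eq_zero hφ ha0 fun h => hv (haB h)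
  have hkc : Continuous fun v => kern φ ((a, z), v) :=
    (kern_contDiff hφ).continuous.comp (Continuous.prodMk_right _)
  have hunion : N ∩ Φ ⁻¹' B = ⋃ x ∈ S, σ x '' B := by
    ext y
    simp only [mem_iUnion]
    constructor
    · rintro ⟨hyN, hyB⟩
      obtain ⟨x, hx, hxy⟩ := (hbij (Φ y) (hBr hyB)).surjOn ⟨hyN, rfl⟩
      exact ⟨x, hx, Φ y, hyB, hxy⟩
    · rintro ⟨x, hx, v, hv, rfl⟩
      obtain ⟨h1, h2, -⟩ := hσ x hx v (hBr hv)
      exact ⟨h1, by rwa [mem_preimage, h2]⟩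
  have hmeas : ∀ x ∈ S, MeasurableSet (σ x '' B) := fun x hx =>
    (hBc.image_of_continuousOn (hσc x hx)).measurableSet
  have hInt := integrableOn_smear hP hu hkc (hBr.trans hrV) hBc hk0
  unfold smear
  have h5 : ∫ x in N, u x * jac Φ x * (starRingEnd ℂ) (jac Φ x) * kern φ ((a, z), Φ x) =
      ∫ x in N ∩ Φ ⁻¹' B, u x * jac Φ x * (starRingEnd ℂ) (jac Φ x) * kern φ ((a, z), Φ x) := by
    refine (setIntegral_eq_of_subset_of_forall_sdiff_eq_zero hP.isOpen_source.measurableSet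
      inter_subset_left fun x hx => ?_)
    rw [hk0, mul_zero]
    exact fun h => hx.2 ⟨hx.1, h⟩
  rw [h5, hunion, integral_biUnion_finset S hmeas]
  · refine Finset.sum_congr rfl fun x hx => ?_
    have himg : Φ '' (σ x '' B) = B := by
      rw [image_image]
      have : ∀ v ∈ B, Φ (σ x v) = v := fun v hv => (hσ x hx v (hBr hv)).2.1
      rw [image_congr this, image_id']
    have hinj : InjOn Φ (σ x '' B) := by
      rintro _ ⟨v, hv, rfl⟩ _ ⟨w, hw, rfl⟩ h
      rw [(hσ x hx v (hBr hv)).2.1, (hσ x hx w (hBr hw)).2.1] at h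
      rw [h]
    have hcv := integral_image_eq_integral_abs_det_fderiv_smul volume (hmeas x hx)
      (f := Φ) (f' := fun y => (fderiv ℂ Φ y).restrictScalars ℝ) (fun y hy => ?_) hinj
      (fun v => u (σ x v) * kern φ ((a, z), v))
    · rw [himg] at hcv
      rw [hcv]
      refine setIntegral_congr_fun (hmeas x hx) ?_
      rintro _ ⟨v, hv, rfl⟩
      simp only [(hσ x hx v (hBr hv)).2.1]
      rw [det_restrictScalars_fderiv, abs_of_nonneg (Complex.normSq_nonneg _), Complex.real_smul,
        ← Complex.mul_conj]
      ring
    · obtain ⟨v, hv, rfl⟩ := hy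
      exact (((hP.analytic _ (hσ x hx v (hBr hv)).1).differentiableAt.hasFDerivAt).restrictScalars ℝ).hasFDerivWithinAt
  · intro x hx y hy hxy
    refine Set.disjoint_left.2 ?_
    rintro _ ⟨v, hv, rfl⟩ ⟨w, hw, hwv⟩
    have h1 := (hσ x hx v (hBr hv)).2.1
    have h2 := (hσ y hy w (hBr hw)).2.1
    rw [hwv, h1] at h2
    subst h2
    exact hxy ((hbij v (hBr hv)).injOn hx hy hwv.symm)
  · intro x hx
    refine hInt.mono_set ?_
    have : σ x '' B ⊆ ⋃ x ∈ S, σ x '' B := subset_biUnion_of_mem (u := fun x => σ x '' B) hx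
    rw [← hunion] at this
    exact this.trans inter_subset_left

theorem IsRegVal.finite_fiber {Φ : (ι → ℂ) → ι → ℂ} {N V : Set (ι → ℂ)} (hP : IsProperHol Φ N V)
    {z : ι → ℂ} (hz : z ∈ V) (hreg : IsRegVal Φ N z) : (N ∩ Φ ⁻¹' {z}).Finite := by
  obtain ⟨φ, hφ⟩ := exists_isBump ι
  exact (smear_tendsto hP (u := fun _ => 0) (fun x _ => analyticAt_const) hφ hz hreg).1

/-- The trace of a holomorphic function along a proper holomorphic map is holomorphic. -/
theorem exists_trace_eq_finsum {Φ : (ι → ℂ) → ι → ℂ} {N V : Set (ι → ℂ)} (hP : IsProperHol Φ N V)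
    {u : (ι → ℂ) → ℂ} (hu : AnalyticOnNhd ℂ u N) {φ : (ι → ℂ) → ℝ} (hφ : IsBump φ) :
    ∃ g : (ι → ℂ) → ℂ, DifferentiableOn ℂ g V ∧
      (∀ z a, 0 < a → Metric.closedBall z (1 / a) ⊆ V →
        g z = smear Φ N u (fun v => kern φ ((a, z), v))) ∧
      ∀ z ∈ V, IsRegVal Φ N z → g z = ∑ᶠ x ∈ N ∩ Φ ⁻¹' {z}, u x := by
  obtain ⟨g, hg, hg'⟩ := exists_trace hP hu hφ
  refine ⟨g, hg, hg', fun z hz hreg => ?_⟩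
  refine tendsto_nhds_unique ?_ (smear_tendsto hP hu hφ hz hreg).2
  obtain ⟨r, hr, hrV⟩ := Metric.nhds_basis_closedBall.mem_iff.1 (hP.isOpen_target.mem_nhds hz)
  refine tendsto_const_nhds.congr' ?_
  filter_upwards [eventually_ge_atTop (1 / r)] with a ha
  have ha0 : 0 < a := lt_of_lt_of_le (by positivity) ha
  refine hg' z a ha0 ((Metric.closedBall_subset_closedBall ?_).trans hrV)
  have := one_div_le_one_div_of_le (by positivity) ha
  rwa [one_div_one_div] at this

end

section

variable {ι : Type*} [Fintype ι] [DecidableEq ι]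

section basic
variable {Φ : (ι → ℂ) → ι → ℂ} {N V : Set (ι → ℂ)}

theorem IsProperHol.continuousOn (hP : IsProperHol Φ N V) : ContinuousOn Φ N :=
  fun x hx => (hP.analytic x hx).continuousAt.continuousWithinAt

/-- Restriction of a proper holomorphic map over an open set of the base. -/
theorem IsProperHol.restrict (hP : IsProperHol Φ N V) {V' : Set (ι → ℂ)} (hV' : IsOpen V')
    (hsub : V' ⊆ V) : IsProperHol Φ (N ∩ Φ ⁻¹' V') V' where
  isOpen_source := hP.continuousOn.isOpen_inter_preimage hP.isOpen_source hV'
  isOpen_target := hV'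
  mapsTo := fun _ hx => hx.2
  analytic := hP.analytic.mono inter_subset_left
  isCompact_preimage := fun K hK hKc => by
    have := hP.isCompact_preimage K (hK.trans hsub) hKc
    convert this using 1
    ext x
    exact ⟨fun h => ⟨h.1.1, h.2⟩, fun h => ⟨⟨h.1, hK h.2⟩, h.2⟩⟩

/-- Restriction of a proper holomorphic map to a clopen part of the source. -/
theorem IsProperHol.clopen (hP : IsProperHol Φ N V) {N₁ : Set (ι → ℂ)} (h₁ : IsOpen N₁)
    (hsub : N₁ ⊆ N) (h₂ : IsOpen (N \ N₁)) : IsProperHol Φ N₁ V where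
  isOpen_source := h₁
  isOpen_target := hP.isOpen_target
  mapsTo := hP.mapsTo.mono_left hsub
  analytic := hP.analytic.mono hsub
  isCompact_preimage := fun K hK hKc => by
    have := (hP.isCompact_preimage K hK hKc).diff h₂
    convert this using 1
    ext x
    constructor
    · exact fun h => ⟨⟨hsub h.1, h.2⟩, fun h' => h'.2 h.1⟩
    · exact fun h => ⟨by by_contra h'; exact h.2 ⟨h.1.1, h'⟩, h.1.2⟩

theorem volume_image_crit (hP : IsProperHol Φ N V) :
    volume {z | ¬ IsRegVal Φ N z} = 0 := by
  have h1 := addHaar_image_eq_zero_of_det_fderivWithin_eq_zero (μ := volume) (s := {x ∈ N | jac Φ x = 0})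
    (f := Φ) (f' := fun y => (fderiv ℂ Φ y).restrictScalars ℝ)
    (fun x hx => ((hP.analytic x hx.1).differentiableAt.hasFDerivAt.restrictScalars ℝ).hasFDerivWithinAt)
    (fun x hx => by rw [det_restrictScalars_fderiv, hx.2, map_zero])
  refine measure_mono_null ?_ h1
  intro z hz
  simp only [IsRegVal, mem_ofPred_eq, not_forall, not_not] at hz
  obtain ⟨x, hx, hxz, hj⟩ := hz
  exact ⟨x, ⟨hx, hj⟩, hxz⟩

theorem IsProperHol.dense_regVal (hP : IsProperHol Φ N V) (z : ι → ℂ) :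
    ∃ᶠ w in 𝓝 z, IsRegVal Φ N w := by
  intro h
  obtain ⟨r, hr, hrz⟩ := Metric.eventually_nhds_iff_ball.1 h
  have : volume (Metric.ball z r) = 0 := measure_mono_null (fun w hw => hrz w hw) (volume_image_crit hP)
  exact (Metric.measure_ball_pos volume z hr).ne' this

/-- If the trace of `1` is small at a point, it vanishes there. -/
theorem trace_one_eq_zero (hP : IsProperHol Φ N V) {g : (ι → ℂ) → ℂ} {z : ι → ℂ} (hz : z ∈ V)
    (hg : ContinuousAt g z) (hreg : ∀ w ∈ V, IsRegVal Φ N w → g w = ∑ᶠ x ∈ N ∩ Φ ⁻¹' {w}, (1 : ℂ))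
    (hlt : ‖g z‖ < 1 / 2) : g z = 0 := by
  have h1 : ∀ᶠ w in 𝓝 z, ‖g w‖ < 1 / 2 := hg.norm.eventually_lt continuousAt_const hlt
  have h2 : ∃ᶠ w in 𝓝 z, g w = 0 := by
    refine ((hP.dense_regVal z).and_eventually (h1.and (hP.isOpen_target.mem_nhds hz))).mono ?_
    rintro w ⟨hw, hw1, hwV⟩
    have hfin := hw.finite_fiber hP hwV
    have h3 := hreg w hwV hw
    rw [finsum_mem_eq_finite_toFinset_sum _ hfin, Finset.sum_const, nsmul_eq_mul, mul_one] at h3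
    rw [h3] at hw1 ⊢
    rw [Complex.norm_natCast] at hw1
    have : (hfin.toFinset.card : ℝ) < 1 := by linarith
    have : hfin.toFinset.card = 0 := by exact_mod_cast Nat.lt_one_iff.1 (by exact_mod_cast this)
    rw [this]; simp
  by_contra hne
  exact h2 (hg.eventually_ne hne)

theorem smear_one_ne_zero (hP : IsProperHol Φ N V) {φ : (ι → ℂ) → ℝ} (hφ : IsBump φ)
    (hφ0 : 0 < φ 0) {x₀ : ι → ℂ} (hx₀ : x₀ ∈ N) (hj : jac Φ x₀ ≠ 0) {a : ℝ} (ha : 0 < a)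
    (hz : Metric.closedBall (Φ x₀) (1 / a) ⊆ V) :
    smear Φ N (fun _ => 1) (fun v => kern φ ((a, Φ x₀), v)) ≠ 0 := by
  have hInt := integrableOn_smear hP (u := fun _ => 1) (fun x _ => analyticAt_const)
    ((kern_contDiff hφ).continuous.comp (Continuous.prodMk_right (a, Φ x₀))) hz (isCompact_closedBall _ _)
    (fun v hv => kern_eq_zero hφ ha hv)
  let G : (ι → ℂ) → ℝ := fun x => Complex.normSq (jac Φ x) *
    (a ^ (2 * Fintype.card ι) * φ (a • (Φ x - Φ x₀)))
  have hG : ∀ x, (1 : ℂ) * jac Φ x * (starRingEnd ℂ) (jac Φ x) * kern φ ((a, Φ x₀), Φ x) = (G x : ℂ) := by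
    intro x
    rw [one_mul, Complex.mul_conj, kern]
    simp only [G]
    push_cast
    ring
  have hG0 : ∀ x, 0 ≤ G x := fun x => mul_nonneg (Complex.normSq_nonneg _)
    (mul_nonneg (by positivity) (hφ.nonneg _))
  unfold smear
  simp only [Function.comp_apply, hG] at hInt ⊢
  rw [integral_complex_ofReal]
  have hintG : IntegrableOn G N := hInt.re
  have hpos : 0 < ∫ x in N, G x := by
    rw [setIntegral_pos_iff_support_of_nonneg_ae (Eventually.of_forall hG0) hintG]
    have hGc : ContinuousAt G x₀ := by
      have h1 := (analyticAt_jac (hP.analytic x₀ hx₀)).continuousAt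
      have h2 := (hP.analytic x₀ hx₀).continuousAt
      refine (Complex.continuous_normSq.continuousAt.comp h1).mul (continuousAt_const.mul ?_)
      exact ContinuousAt.comp (f := fun x => a • (Φ x - Φ x₀)) hφ.contDiff.continuous.continuousAt
        ((h2.sub continuousAt_const).const_smul a)
    have hGx : 0 < G x₀ := by
      simp only [G, sub_self, smul_zero]
      have := Complex.normSq_pos.2 hj
      positivity
    have h3 : {x | 0 < G x} ∩ N ∈ 𝓝 x₀ :=
      inter_mem (hGc.eventually_const_lt hGx) (hP.isOpen_source.mem_nhds hx₀)
    exact (Measure.measure_pos_of_mem_nhds volume h3).trans_le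
      (measure_mono (inter_subset_inter_left _ fun x hx => (ne_of_gt hx : G x ≠ 0)))
  exact_mod_cast hpos.ne'
end basic

end

section

variable {ι : Type*} [Fintype ι] [DecidableEq ι]
variable {Φ : (ι → ℂ) → ι → ℂ} {N V : Set (ι → ℂ)}

/-- Linear perturbation of a map, fixing the value at `x₀`. -/
noncomputable def perturb (Φ : (ι → ℂ) → ι → ℂ) (x₀ : ι → ℂ) (ε : ℂ) (x : ι → ℂ) : ι → ℂ :=
  Φ x + ε • (x - x₀)

/-- The Jacobian determinant of the linear perturbation. -/
noncomputable def perturbJac (Φ : (ι → ℂ) → ι → ℂ) (ε : ℂ) (x : ι → ℂ) : ℂ :=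
  Matrix.det (Matrix.of (jacRows Φ x) + ε • (1 : Matrix ι ι ℂ))

theorem jac_perturb (x₀ : ι → ℂ) (ε : ℂ) {x : ι → ℂ} (hx : AnalyticAt ℂ Φ x) :
    jac (perturb Φ x₀ ε) x = perturbJac Φ ε x := by
  have h1 : HasFDerivAt (perturb Φ x₀ ε) (fderiv ℂ Φ x + ε • ContinuousLinearMap.id ℂ (ι → ℂ)) x :=
    hx.differentiableAt.hasFDerivAt.add (((hasFDerivAt_id x).sub_const x₀).const_smul ε)
  rw [jac, perturbJac]
  congr 1
  ext i j
  simp [jacRows, h1.fderiv, Matrix.one_apply, Pi.single_apply, eq_comm]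

theorem perturbJac_frequently_ne (Φ : (ι → ℂ) → ι → ℂ) (x : ι → ℂ) :
    ∀ᶠ ε in 𝓝[≠] (0 : ℂ), perturbJac Φ ε x ≠ 0 := by
  set p := (-Matrix.of (jacRows Φ x)).charpoly with hp
  have h1 : ∀ ε, p.eval ε = perturbJac Φ ε x := by
    intro ε
    rw [hp, Matrix.eval_charpoly, perturbJac]
    congr 1
    ext i j
    simp [Matrix.scalar_apply, Matrix.diagonal_apply, Matrix.one_apply]
    ring
  have hfin : {ε | p.IsRoot ε}.Finite := Polynomial.finite_setOfPred_isRoot (Matrix.charpoly_monic _).ne_zero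
  have h2 : ({ε | p.IsRoot ε} \ {0})ᶜ ∈ 𝓝 (0 : ℂ) :=
    (hfin.subset sdiff_subset).isClosed.isOpen_compl.mem_nhds (by simp)
  filter_upwards [nhdsWithin_le_nhds h2, self_mem_nhdsWithin] with ε hε hne h0
  exact hε ⟨by simp only [mem_ofPred_eq, Polynomial.IsRoot.def, h1, h0], hne⟩

theorem trace_one_ne_zero (hP : IsProperHol Φ N V) {φ : (ι → ℂ) → ℝ} (hφ : IsBump φ)
    {x₀ : ι → ℂ} (hx₀ : x₀ ∈ N) {g : (ι → ℂ) → ℂ}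
    (hg : ∀ z a, 0 < a → Metric.closedBall z (1 / a) ⊆ V →
        g z = smear Φ N (fun _ => 1) (fun v => kern φ ((a, z), v))) : g (Φ x₀) ≠ 0 := by
  intro hg0
  set z₀ := Φ x₀ with hz₀
  have hzV : z₀ ∈ V := hP.mapsTo hx₀
  obtain ⟨r, hr, hrV⟩ := Metric.nhds_basis_closedBall.mem_iff.1 (hP.isOpen_target.mem_nhds hzV)
  set δ := r / 2 with hδ
  have hδ0 : 0 < δ := by positivity
  set a := 2 / δ with ha
  have ha0 : 0 < a := by positivity
  have h1a : 1 / a = δ / 2 := by rw [ha, one_div_div]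
  have hK2 : IsCompact (N ∩ Φ ⁻¹' Metric.closedBall z₀ r) :=
    hP.isCompact_preimage _ hrV (isCompact_closedBall _ _)
  set K2 := N ∩ Φ ⁻¹' Metric.closedBall z₀ r with hK2d
  set N1 := N ∩ Φ ⁻¹' Metric.ball z₀ r with hN1
  have hN1K : N1 ⊆ K2 := fun x hx => ⟨hx.1, Metric.ball_subset_closedBall hx.2⟩
  have hN1o : IsOpen N1 := hP.continuousOn.isOpen_inter_preimage hP.isOpen_source Metric.isOpen_ball
  obtain ⟨R, hR⟩ := hK2.exists_bound_of_continuousOn (f := fun x => x - x₀) (by fun_prop)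
  have hR0 : 0 ≤ R := (norm_nonneg _).trans (hR x₀ ⟨hx₀, Metric.mem_closedBall_self hr.le⟩)
  set ε₁ := δ / (2 * (R + 1)) with hε₁
  have hε₁0 : 0 < ε₁ := by positivity
  have hnear : ∀ ε : ℂ, ‖ε‖ < ε₁ → ∀ x ∈ K2, dist (perturb Φ x₀ ε x) (Φ x) ≤ δ / 2 := by
    intro ε hε x hx
    rw [perturb, dist_eq_norm, add_sub_cancel_left, norm_smul]
    calc ‖ε‖ * ‖x - x₀‖ ≤ ε₁ * (R + 1) := by
          gcongr
          exact (hR x hx).trans (by linarith)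
      _ = δ / 2 := by rw [hε₁]; field_simp
  have hPc : ∀ ε, ContinuousOn (perturb Φ x₀ ε) N := fun ε =>
    hP.continuousOn.add (by fun_prop)
  have hPan : ∀ ε, AnalyticOnNhd ℂ (perturb Φ x₀ ε) N := fun ε x hx => by
    have : AnalyticAt ℂ (fun x => ε • (x - x₀)) x := by fun_prop
    exact (hP.analytic x hx).add this
  have hPε : ∀ ε : ℂ, ‖ε‖ < ε₁ → IsProperHol (perturb Φ x₀ ε)
      (N1 ∩ perturb Φ x₀ ε ⁻¹' Metric.ball z₀ δ) (Metric.ball z₀ δ) := by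
    intro ε hε
    refine ⟨((hPc ε).mono inter_subset_left).isOpen_inter_preimage hN1o Metric.isOpen_ball,
      Metric.isOpen_ball, fun x hx => hx.2, (hPan ε).mono fun x hx => hx.1.1, fun K hK hKc => ?_⟩
    have h1 : IsClosed (K2 ∩ perturb Φ x₀ ε ⁻¹' K) :=
      ((hPc ε).mono inter_subset_left).preimage_isClosed_of_isClosed hK2.isClosed hKc.isClosed
    convert hK2.of_isClosed_subset h1 inter_subset_left using 1
    ext x
    refine ⟨fun h => ⟨hN1K h.1.1, h.2⟩, fun h => ⟨⟨⟨h.1.1, ?_⟩, hK h.2⟩, h.2⟩⟩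
    have h2 := hnear ε hε x h.1
    have h3 : dist (perturb Φ x₀ ε x) z₀ < δ := hK h.2
    have h4 := dist_triangle_left (Φ x) z₀ (perturb Φ x₀ ε x)
    rw [mem_preimage, Metric.mem_ball]
    linarith
  let F : ℂ → (ι → ℂ) → ℂ := fun ε x => 1 * perturbJac Φ ε x * (starRingEnd ℂ) (perturbJac Φ ε x) *
    kern φ ((a, z₀), perturb Φ x₀ ε x)
  have hk : Continuous fun v => kern φ ((a, z₀), v) :=
    (kern_contDiff hφ).continuous.comp (Continuous.prodMk_right (a, z₀))
  have hkz : ∀ v, v ∉ Metric.ball z₀ δ → kern φ ((a, z₀), v) = 0 := fun v hv =>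
    kern_eq_zero hφ ha0 fun h => hv (by
      rw [h1a] at h
      exact Metric.closedBall_subset_ball (by linarith) h)
  have hFc : ContinuousOn (Function.uncurry F) (univ ×ˢ N) := by
    rintro ⟨ε, x⟩ ⟨-, hx⟩
    refine ContinuousAt.continuousWithinAt ?_
    have h1 : ContinuousAt (fun q : ℂ × (ι → ℂ) => perturb Φ x₀ q.1 q.2) (ε, x) := by
      have : ContinuousAt (fun q : ℂ × (ι → ℂ) => Φ q.2) (ε, x) :=
        ContinuousAt.comp (f := Prod.snd) (hP.analytic x hx).continuousAt continuousAt_snd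
      exact this.add (by fun_prop)
    have h2 : ContinuousAt (fun q : ℂ × (ι → ℂ) => perturbJac Φ q.1 q.2) (ε, x) := by
      have h3 : ContinuousAt (fun q : ℂ × (ι → ℂ) => Matrix.of (jacRows Φ q.2) + q.1 • (1 : Matrix ι ι ℂ)) (ε, x) := by
        refine ContinuousAt.add ?_ (by fun_prop)
        refine continuousAt_pi.2 fun i => ?_
        exact ContinuousAt.comp (f := Prod.snd) (g := fun y => jacRows Φ y i) (x := (ε, x))
          (hasFDerivAt_jacRows (hP.analytic x hx) i).continuousAt continuousAt_snd
      exact ContinuousAt.comp (f := fun q : ℂ × (ι → ℂ) => Matrix.of (jacRows Φ q.2) + q.1 • (1 : Matrix ι ι ℂ)) (continuous_id.matrix_det.continuousAt) h3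
    exact ((continuousAt_const.mul h2).mul (Complex.continuous_conj.continuousAt.comp h2)).mul
      (ContinuousAt.comp (f := fun q : ℂ × (ι → ℂ) => perturb Φ x₀ q.1 q.2) hk.continuousAt h1)
  obtain ⟨C, hC⟩ := ((isCompact_closedBall (0 : ℂ) 1).prod hK2).exists_bound_of_continuousOn
    (hFc.mono (prod_mono (subset_univ _) inter_subset_left))
  have hI : ContinuousAt (fun ε => ∫ x in N1, F ε x) 0 := by
    refine continuousAt_of_dominated (bound := fun _ => C) (Eventually.of_forall fun ε => ?_) ?_ ?_ ?_
    · refine ContinuousOn.aestronglyMeasurable ?_ hN1o.measurableSet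
      exact hFc.comp (f := fun x => (ε, x)) (by fun_prop) fun x hx => ⟨mem_univ _, hx.1⟩
    · filter_upwards [Metric.closedBall_mem_nhds (0 : ℂ) one_pos] with ε hε
      refine (ae_restrict_iff' hN1o.measurableSet).2 (Eventually.of_forall fun x hx => ?_)
      exact hC (ε, x) ⟨hε, hN1K hx⟩
    · exact integrableOn_const ((measure_mono hN1K).trans_lt hK2.measure_lt_top).ne
    · refine (ae_restrict_iff' hN1o.measurableSet).2 (Eventually.of_forall fun x hx => ?_)
      have := (hFc.continuousAt ((isOpen_univ.prod hP.isOpen_source).mem_nhds (x := ((0 : ℂ), x)) ⟨mem_univ _, hx.1⟩))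
      exact ContinuousAt.comp (f := fun ε : ℂ => (ε, x)) this (by fun_prop)
  have hsmear : ∀ ε, smear (perturb Φ x₀ ε) (N1 ∩ perturb Φ x₀ ε ⁻¹' Metric.ball z₀ δ) (fun _ => 1)
      (fun v => kern φ ((a, z₀), v)) = ∫ x in N1, F ε x := by
    intro ε
    unfold smear
    rw [setIntegral_eq_of_subset_of_forall_sdiff_eq_zero hN1o.measurableSet (s := N1 ∩ perturb Φ x₀ ε ⁻¹' Metric.ball z₀ δ) inter_subset_left]
    · refine setIntegral_congr_fun ((((hPc ε).mono inter_subset_left).isOpen_inter_preimage hN1o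
        Metric.isOpen_ball).measurableSet) fun x hx => ?_
      simp only [F, jac_perturb x₀ ε (hP.analytic x hx.1.1)]
    · rintro x ⟨hx, hx2⟩
      simp only [F]
      rw [hkz, mul_zero]
      exact fun h => hx2 ⟨hx, h⟩
  have hI0 : ∫ x in N1, F 0 x = 0 := by
    refine Eq.trans ?_ hg0
    rw [hg z₀ a ha0 ((Metric.closedBall_subset_closedBall (by rw [h1a]; linarith)).trans hrV)]
    unfold smear
    rw [setIntegral_eq_of_subset_of_forall_sdiff_eq_zero hP.isOpen_source.measurableSet (s := N1) (t := N)
      inter_subset_left]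
    · refine setIntegral_congr_fun hN1o.measurableSet fun x hx => ?_
      simp [F, perturbJac, perturb, jac]
    · rintro x ⟨hx, hx2⟩
      simp only
      rw [hkz, mul_zero]
      exact fun h => hx2 ⟨hx, Metric.ball_subset_ball (by linarith) h⟩
  have hsmall : ∀ᶠ ε in 𝓝 (0 : ℂ), ‖∫ x in N1, F ε x‖ < 1 / 2 :=
    hI.norm.eventually_lt continuousAt_const (by simp only [hI0]; norm_num)
  have hball : ∀ᶠ ε in 𝓝 (0 : ℂ), ‖ε‖ < ε₁ :=
    continuous_norm.continuousAt.eventually_lt continuousAt_const (by simpa using hε₁0)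
  obtain ⟨ε, ⟨hε1, hε2⟩, hε3⟩ := (((hsmall.and hball).filter_mono nhdsWithin_le_nhds).and
    (perturbJac_frequently_ne Φ x₀)).exists
  have hQ := hPε ε hε2
  obtain ⟨gε, hgε1, hgε2, hgε3⟩ := exists_trace_eq_finsum hQ (u := fun _ => 1) (fun x _ => analyticAt_const) hφ
  have hz₀m : z₀ ∈ Metric.ball z₀ δ := Metric.mem_ball_self hδ0
  have hab : Metric.closedBall z₀ (1 / a) ⊆ Metric.ball z₀ δ :=
    Metric.closedBall_subset_ball (by rw [h1a]; linarith)
  have hval := hgε2 z₀ a ha0 hab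
  have hzero := trace_one_eq_zero hQ hz₀m
    (hgε1.continuousOn.continuousAt (Metric.isOpen_ball.mem_nhds hz₀m)) hgε3
    (by rw [hval, hsmear]; exact hε1)
  have hpx : perturb Φ x₀ ε x₀ = z₀ := by simp [perturb, hz₀]
  refine smear_one_ne_zero hQ hφ hφ.pos_zero (x₀ := x₀) ⟨⟨hx₀, Metric.mem_ball_self hr⟩, ?_⟩ ?_ ha0 ?_ (a := a) ?_
  · rw [mem_preimage, hpx]; exact hz₀m
  · rw [jac_perturb x₀ ε (hP.analytic x₀ hx₀)]; exact hε3
  · rw [hpx]; exact hab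
  · rw [hpx, ← hval, hzero]

end

section

variable {ι : Type*} [Fintype ι] [DecidableEq ι]
variable {Φ : (ι → ℂ) → ι → ℂ} {N V : Set (ι → ℂ)}

theorem isOpen_diff_connectedComponentIn {X : Type*} [TopologicalSpace X] [LocallyConnectedSpace X]
    {N : Set X} (hN : IsOpen N) (x : X) : IsOpen (N \ connectedComponentIn N x) := by
  rw [isOpen_iff_mem_nhds]
  rintro y ⟨hy, hyx⟩
  refine mem_of_superset (hN.connectedComponentIn.mem_nhds (mem_connectedComponentIn hy)) fun w hw => ?_
  refine ⟨connectedComponentIn_subset _ _ hw, fun hw2 => hyx ?_⟩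
  rw [connectedComponentIn_eq hw2, ← connectedComponentIn_eq hw]
  exact mem_connectedComponentIn hy

/-- Points over regular values are dense in the source of a proper holomorphic map. -/
theorem IsProperHol.exists_isRegVal_mem (hP : IsProperHol Φ N V) {O : Set (ι → ℂ)} (hO : IsOpen O)
    {x₀ : ι → ℂ} (hx₀ : x₀ ∈ N) (hx₀O : x₀ ∈ O) : ∃ x ∈ N ∩ O, IsRegVal Φ N (Φ x) := by
  by_contra! hcon
  have hNO : IsOpen (N ∩ O) := hP.isOpen_source.inter hO
  have hj : ∀ y ∈ N ∩ O, jac Φ y = 0 := by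
    intro y hy
    by_contra hne
    obtain ⟨e, he, hye, hes, -, -⟩ := exists_localInverse hP.analytic hNO inter_subset_left hy hne
    have h1 : e.target ∈ 𝓝 (Φ y) := by rw [← he]; exact e.open_target.mem_nhds (e.map_source hye)
    obtain ⟨w, hw, hwt⟩ := ((hP.dense_regVal (Φ y)).and_eventually h1).exists
    refine hcon (e.symm w) (hes (e.map_target hwt)) ?_
    have h2 : Φ (e.symm w) = w := by rw [← he]; exact e.right_inv hwt
    rwa [h2]
  set N1 := connectedComponentIn N x₀
  have hP1 : IsProperHol Φ N1 V := hP.clopen hP.isOpen_source.connectedComponentIn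
    (connectedComponentIn_subset _ _) (isOpen_diff_connectedComponentIn hP.isOpen_source x₀)
  have hx1 : x₀ ∈ N1 := mem_connectedComponentIn hx₀
  have hz : EqOn (jac Φ) 0 N1 := by
    refine AnalyticOnNhd.eqOn_zero_of_preconnected_of_eventuallyEq_zero
      (fun x hx => analyticAt_jac (hP1.analytic x hx)) isPreconnected_connectedComponentIn hx1 ?_
    filter_upwards [hNO.mem_nhds ⟨hx₀, hx₀O⟩] with y hy using hj y hy
  obtain ⟨φ, hφ⟩ := exists_isBump ι
  obtain ⟨g, -, hg, -⟩ := exists_trace_eq_finsum hP1 (u := fun _ => 1) (fun x _ => analyticAt_const) hφ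
  refine trace_one_ne_zero hP1 hφ hx1 hg ?_
  obtain ⟨r, hr, hrV⟩ := Metric.nhds_basis_closedBall.mem_iff.1 (hP.isOpen_target.mem_nhds (hP.mapsTo hx₀))
  rw [hg (Φ x₀) r⁻¹ (inv_pos.2 hr) (by simpa using hrV)]
  unfold smear
  rw [setIntegral_congr_fun (g := fun _ => 0) hP1.isOpen_source.measurableSet, integral_zero]
  intro x hx
  simp [hz hx]

/-- The fibres of a proper holomorphic map over regular values have constant positive size. -/
theorem IsProperHol.exists_degree (hP : IsProperHol Φ N V) (hV : IsPreconnected V) :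
    ∃ μ : ℕ, (N.Nonempty → μ ≠ 0) ∧ ∀ z ∈ V, IsRegVal Φ N z → (N ∩ Φ ⁻¹' {z}).ncard = μ := by
  obtain ⟨φ, hφ⟩ := exists_isBump ι
  obtain ⟨g, hgd, hgs, hg⟩ := exists_trace_eq_finsum hP (u := fun _ => 1) (fun x _ => analyticAt_const) hφ
  have hg' : ∀ z ∈ V, IsRegVal Φ N z → g z = ((N ∩ Φ ⁻¹' {z}).ncard : ℂ) := by
    intro z hz hr
    rw [hg z hz hr, finsum_mem_eq_finite_toFinset_sum _ (hr.finite_fiber hP hz)]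
    simp [ncard_eq_toFinset_card _ (hr.finite_fiber hP hz)]
  have hemb : IsClosedEmbedding ((↑) : ℕ → ℂ) :=
    Complex.isometry_ofReal.isClosedEmbedding.comp Nat.isClosedEmbedding_coe_real
  have hcl : IsClosed (range ((↑) : ℕ → ℂ)) := hemb.isClosed_range
  have hmem : ∀ z ∈ V, g z ∈ range ((↑) : ℕ → ℂ) := by
    intro z hz
    rw [← hcl.closure_eq]
    rw [mem_closure_iff_frequently]
    have h1 : Tendsto g (𝓝 z) (𝓝 (g z)) :=
      (hgd.continuousOn.continuousAt (hP.isOpen_target.mem_nhds hz))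
    refine h1.frequently (((hP.dense_regVal z).and_eventually (hP.isOpen_target.mem_nhds hz)).mono ?_)
    rintro w ⟨hw, hwV⟩
    exact ⟨_, (hg' w hwV hw).symm⟩
  have hdisc : IsDiscrete (range ((↑) : ℕ → ℂ)) := by
    rw [← image_univ]
    exact (IsDiscrete.univ).image hemb.isInducing
  have hconst : ∀ z ∈ V, ∀ w ∈ V, g z = g w := fun z hz w hw =>
    hV.constant_of_mapsTo hdisc hgd.continuousOn hmem hz hw
  rcases N.eq_empty_or_nonempty with rfl | ⟨x₀, hx₀⟩
  · exact ⟨0, by simp, by simp⟩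
  · obtain ⟨μ, hμ⟩ := hmem _ (hP.mapsTo hx₀)
    refine ⟨μ, fun _ h0 => trace_one_ne_zero hP hφ hx₀ hgs (by rw [← hμ, h0, Nat.cast_zero]), fun z hz hr => ?_⟩
    have := (hg' z hz hr).symm.trans ((hconst z hz _ (hP.mapsTo hx₀)).trans hμ.symm)
    exact_mod_cast this

theorem newton_finset {α : Type*} (S : Finset α) (u : α → ℂ) (k : ℕ) :
    k * (S.val.map u).esymm k = (-1) ^ (k + 1) *
      ∑ a ∈ Finset.HasAntidiagonal.antidiagonal k with a.1 < k,
        (-1) ^ a.1 * (S.val.map u).esymm a.1 * ∑ x ∈ S, u x ^ a.2 := by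
  classical
  have h := congrArg (MvPolynomial.aeval (fun x : S => u x)) (MvPolynomial.mul_esymm_eq_sum S ℂ k)
  have h2 : Finset.univ.val.map (fun x : S => u x) = S.val.map u := by
    rw [← Multiset.attach_map_val S.val, Multiset.map_map]
    rfl
  simp only [map_mul, map_natCast, map_pow, map_neg, map_one, map_sum,
    MvPolynomial.aeval_esymm_eq_multiset_esymm, h2, MvPolynomial.psum, MvPolynomial.aeval_X] at h
  rw [h]
  congr 1
  refine Finset.sum_congr rfl fun a _ => ?_
  congr 1
  exact Finset.sum_coe_sort S (fun x => u x ^ a.2)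

/-- Elementary symmetric functions of a holomorphic function along the fibres are holomorphic. -/
theorem IsProperHol.exists_esymm (hP : IsProperHol Φ N V) {u : (ι → ℂ) → ℂ}
    (hu : AnalyticOnNhd ℂ u N) (k : ℕ) : ∃ e : (ι → ℂ) → ℂ, DifferentiableOn ℂ e V ∧
      ∀ z ∈ V, IsRegVal Φ N z → ∀ S : Finset (ι → ℂ), (S : Set (ι → ℂ)) = N ∩ Φ ⁻¹' {z} →
        e z = (S.val.map u).esymm k := by
  obtain ⟨φ, hφ⟩ := exists_isBump ι
  have hp : ∀ j : ℕ, ∃ g : (ι → ℂ) → ℂ, DifferentiableOn ℂ g V ∧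
      ∀ z ∈ V, IsRegVal Φ N z → ∀ S : Finset (ι → ℂ), (S : Set (ι → ℂ)) = N ∩ Φ ⁻¹' {z} →
        g z = ∑ x ∈ S, u x ^ j := by
    intro j
    obtain ⟨g, hgd, -, hg⟩ := exists_trace_eq_finsum hP (u := fun x => u x ^ j) (fun x hx => (hu x hx).pow j) hφ
    refine ⟨g, hgd, fun z hz hr S hS => ?_⟩
    rw [hg z hz hr, ← hS, finsum_mem_coe_finset]
  choose p hpd hp using hp
  induction k using Nat.strong_induction_on with
  | _ k ih =>
    have ih' : ∀ m, ∃ e : (ι → ℂ) → ℂ, m < k → DifferentiableOn ℂ e V ∧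
      ∀ z ∈ V, IsRegVal Φ N z → ∀ S : Finset (ι → ℂ), (S : Set (ι → ℂ)) = N ∩ Φ ⁻¹' {z} →
        e z = (S.val.map u).esymm m := by
      intro m
      by_cases hm : m < k
      · obtain ⟨e, he⟩ := ih m hm
        exact ⟨e, fun _ => he⟩
      · exact ⟨0, fun h => absurd h hm⟩
    choose e he using ih'
    rcases Nat.eq_zero_or_pos k with rfl | hk
    · exact ⟨fun _ => 1, by fun_prop, fun z _ _ S _ => by simp [Multiset.esymm]⟩
    refine ⟨fun z => (k : ℂ)⁻¹ * ((-1) ^ (k + 1) *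
      ∑ a ∈ Finset.HasAntidiagonal.antidiagonal k with a.1 < k, (-1) ^ a.1 * e a.1 z * p a.2 z), ?_, ?_⟩
    · refine DifferentiableOn.const_mul (DifferentiableOn.const_mul (DifferentiableOn.fun_sum fun a ha => ?_) _) _
      exact ((he a.1 (Finset.mem_filter.1 ha).2).1.const_mul _).mul (hpd a.2)
    · intro z hz hr S hS
      have hk0 : (k : ℂ) ≠ 0 := by exact_mod_cast hk.ne'
      rw [inv_mul_eq_iff_eq_mul₀ hk0, newton_finset]
      congr 1
      refine Finset.sum_congr rfl fun a ha => ?_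
      rw [(he a.1 (Finset.mem_filter.1 ha).2).2 z hz hr S hS, hp a.2 z hz hr S hS]

open Polynomial in
/-- The monic polynomial of degree `μ` with prescribed lower coefficients. -/
noncomputable def monicPoly (μ : ℕ) (c : ℕ → ℂ) : ℂ[X] :=
  X ^ μ + ∑ j ∈ Finset.range μ, C (c j) * X ^ j

open Polynomial in
theorem monicPoly_degree_lt (μ : ℕ) (c : ℕ → ℂ) :
    (∑ j ∈ Finset.range μ, C (c j) * X ^ j).degree < (μ : WithBot ℕ) := by
  rw [← mem_degreeLT]
  refine Submodule.sum_mem _ fun j hj => mem_degreeLT.2 ?_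
  exact (degree_C_mul_X_pow_le j (c j)).trans_lt (by exact_mod_cast Finset.mem_range.1 hj)

theorem monic_monicPoly (μ : ℕ) (c : ℕ → ℂ) : (monicPoly μ c).Monic :=
  Polynomial.monic_X_pow_add (monicPoly_degree_lt μ c)

theorem natDegree_monicPoly (μ : ℕ) (c : ℕ → ℂ) : (monicPoly μ c).natDegree = μ := by
  refine Polynomial.natDegree_eq_of_degree_eq_some ?_
  rw [monicPoly, Polynomial.degree_add_eq_left_of_degree_lt] <;> rw [Polynomial.degree_X_pow]
  exact monicPoly_degree_lt μ c

theorem eval_monicPoly (μ : ℕ) (c : ℕ → ℂ) (t : ℂ) :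
    (monicPoly μ c).eval t = t ^ μ + ∑ j ∈ Finset.range μ, c j * t ^ j := by
  simp [monicPoly, Polynomial.eval_finsetSum]

theorem coeff_monicPoly (μ : ℕ) (c : ℕ → ℂ) {j : ℕ} (hj : j < μ) : (monicPoly μ c).coeff j = c j := by
  simp only [monicPoly, Polynomial.coeff_add, Polynomial.coeff_X_pow, hj.ne, if_false, zero_add,
    Polynomial.finsetSum_coeff, Polynomial.coeff_C_mul, mul_ite, mul_one, mul_zero]
  rw [Finset.sum_ite_eq]
  simp [hj]

theorem eq_monicPoly {p : Polynomial ℂ} (hp : p.Monic) : p = monicPoly p.natDegree p.coeff := by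
  conv_lhs => rw [hp.as_sum]
  rfl

/-- The characteristic polynomial of a holomorphic function along a proper holomorphic map. -/
theorem IsProperHol.exists_charpoly (hP : IsProperHol Φ N V) (hV : IsPreconnected V) :
    ∃ μ : ℕ, (N.Nonempty → μ ≠ 0) ∧ ∀ u : (ι → ℂ) → ℂ, AnalyticOnNhd ℂ u N →
      ∃ c : ℕ → (ι → ℂ) → ℂ, (∀ j, DifferentiableOn ℂ (c j) V) ∧
        ∀ z ∈ V, ∀ t, (monicPoly μ fun j => c j z).IsRoot t ↔ ∃ x ∈ N, Φ x = z ∧ u x = t := by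
  obtain ⟨μ, hμ, hcard⟩ := hP.exists_degree hV
  refine ⟨μ, hμ, fun u hu => ?_⟩
  choose e hed he using hP.exists_esymm hu
  set c : ℕ → (ι → ℂ) → ℂ := fun j z => (-1) ^ (μ - j) * e (μ - j) z with hc
  have hcd : ∀ j, DifferentiableOn ℂ (c j) V := fun j => (hed _).const_mul _
  refine ⟨c, hcd, ?_⟩
  have hreg : ∀ z ∈ V, IsRegVal Φ N z → ∀ S : Finset (ι → ℂ), (S : Set (ι → ℂ)) = N ∩ Φ ⁻¹' {z} →
      S.card = μ ∧ ∀ t, (monicPoly μ fun j => c j z).eval t = ∏ x ∈ S, (t - u x) := by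
    intro z hz hr S hS
    have hSc : S.card = μ := by rw [← hcard z hz hr, ← hS, ncard_coe_finset]
    refine ⟨hSc, fun t => ?_⟩
    have h1 : ((S.val.map u).map fun t => Polynomial.X - Polynomial.C t).prod = monicPoly μ fun j => c j z := by
      have hcd : Multiset.card (S.val.map u) = μ := by simpa using hSc
      have hm : (((S.val.map u).map fun t => Polynomial.X - Polynomial.C t).prod).Monic :=
        Polynomial.monic_multiset_prod_of_monic _ _ fun i _ => Polynomial.monic_X_sub_C i
      have hnd : (((S.val.map u).map fun t => Polynomial.X - Polynomial.C t).prod).natDegree = μ := by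
        rw [Polynomial.natDegree_multiset_prod_X_sub_C_eq_card, hcd]
      rw [eq_monicPoly hm, hnd]
      unfold monicPoly
      congr 1
      refine Finset.sum_congr rfl fun j hj => ?_
      rw [Multiset.prod_X_sub_C_coeff _ (by rw [hcd]; exact (Finset.mem_range.1 hj).le), hcd, hc]
      simp only
      rw [he _ z hz hr S hS]
    rw [← h1, Polynomial.eval_multiset_prod, Multiset.map_map, Multiset.map_map]
    simp only [Finset.prod_eq_multiset_prod, Function.comp_def, Polynomial.eval_sub, Polynomial.eval_X, Polynomial.eval_C]
  have hcont : ∀ z ∈ V, ∀ t, ContinuousAt (fun q : (ι → ℂ) × ℂ => (monicPoly μ fun j => c j q.1).eval q.2) (z, t) := by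
    intro z hz t
    simp only [eval_monicPoly]
    have h1 : ∀ j, ContinuousAt (fun q : (ι → ℂ) × ℂ => c j q.1) (z, t) := fun j =>
      ContinuousAt.comp (f := Prod.fst) (g := c j)
        (((hcd j).continuousOn.continuousAt (hP.isOpen_target.mem_nhds hz))) continuousAt_fst
    refine ContinuousAt.add (by fun_prop) (tendsto_finsetSum _ fun j _ => (h1 j).mul (by fun_prop))
  intro z hz t
  constructor
  · intro hroot
    by_contra! hcon
    have hcompact : IsCompact (N ∩ Φ ⁻¹' {z}) :=
      hP.isCompact_preimage _ (singleton_subset_iff.2 hz) isCompact_singleton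
    obtain ⟨ε, hε, hfib⟩ : ∃ ε > 0, ∀ x ∈ N, Φ x = z → ε < ‖t - u x‖ := by
      have hcu : ContinuousOn (fun x => ‖t - u x‖) (N ∩ Φ ⁻¹' {z}) := fun x hx =>
        ((continuousAt_const.sub (hu x hx.1).continuousAt).norm).continuousWithinAt
      rcases (N ∩ Φ ⁻¹' {z}).eq_empty_or_nonempty with h | h
      · exact ⟨1, one_pos, fun x hx hxz => absurd (h ▸ (⟨hx, hxz⟩ : x ∈ N ∩ Φ ⁻¹' {z})) (notMem_empty x)⟩
      · obtain ⟨x, hx, hmin⟩ := hcompact.exists_isMinOn h hcu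
        have hpos : 0 < ‖t - u x‖ := norm_pos_iff.2 (sub_ne_zero.2 fun h => hcon x hx.1 hx.2 h.symm)
        exact ⟨‖t - u x‖ / 2, by positivity, fun y hy hyz => (half_lt_self hpos).trans_le (hmin ⟨hy, hyz⟩)⟩
    have hO : IsOpen {x ∈ N | ε < ‖t - u x‖} := by
      rw [isOpen_iff_mem_nhds]
      rintro y ⟨hy, hyj⟩
      exact inter_mem (hP.isOpen_source.mem_nhds hy)
        ((continuousAt_const.sub (hu y hy).continuousAt).norm.eventually (lt_mem_nhds hyj))
    obtain ⟨r, hr, hrV, hrO⟩ := hP.exists_ball hz hO fun x hx hxz => ⟨hx, hfib x hx hxz⟩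
    have h2 : Tendsto (fun w => ‖(monicPoly μ fun j => c j w).eval t‖) (𝓝 z) (𝓝 0) := by
      have := (ContinuousAt.comp (f := fun w => (w, t)) (hcont z hz t) (by fun_prop)).norm
      have h0 : (monicPoly μ fun j => c j z).eval t = 0 := hroot
      simpa [ContinuousAt, Function.comp_def, h0] using this
    have h3 := h2.eventually (gt_mem_nhds (pow_pos hε μ))
    obtain ⟨w, hw, hwlt, hwb⟩ := ((hP.dense_regVal z).and_eventually
      (h3.and (Metric.ball_mem_nhds z hr))).exists
    have hfin := hw.finite_fiber hP (hrV hwb)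
    obtain ⟨hc1, hc2⟩ := hreg w (hrV hwb) hw hfin.toFinset hfin.coe_toFinset
    rw [hc2, norm_prod] at hwlt
    refine not_le.2 hwlt ?_
    rw [← hc1, ← Finset.prod_const]
    refine Finset.prod_le_prod (fun _ _ => hε.le) fun x hx => ?_
    rw [Set.Finite.mem_toFinset] at hx
    exact (hrO x hx.1 (by rw [show Φ x = w from hx.2]; exact hwb)).2.le
  · rintro ⟨x, hx, rfl, rfl⟩
    by_contra hne
    have h1 : ContinuousAt (fun y => (monicPoly μ fun j => c j (Φ y)).eval (u y)) x :=
      ContinuousAt.comp (f := fun y => (Φ y, u y)) (hcont (Φ x) hz (u x))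
        ((hP.analytic x hx).continuousAt.prodMk (hu x hx).continuousAt)
    obtain ⟨O, hOs, hO, hxO⟩ := mem_nhds_iff.1 (h1.eventually_ne hne)
    obtain ⟨y, ⟨hyN, hyO⟩, hy⟩ := hP.exists_isRegVal_mem hO hx hxO
    have hyV := hP.mapsTo hyN
    have hfin := hy.finite_fiber hP hyV
    refine hOs hyO ?_
    rw [(hreg _ hyV hy hfin.toFinset hfin.coe_toFinset).2]
    exact Finset.prod_eq_zero (i := y) (by simp [hyN]) (sub_self _)

end

section

variable {ι : Type*} [Fintype ι] [DecidableEq ι]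
variable {Φ : (ι → ℂ) → ι → ℂ} {N V : Set (ι → ℂ)}

theorem IsProperHol.surjOn (hP : IsProperHol Φ N V) (hV : IsPreconnected V) (hN : N.Nonempty) {z : ι → ℂ}
    (hz : z ∈ V) : ∃ x ∈ N, Φ x = z := by
  obtain ⟨μ, hμ, h⟩ := hP.exists_charpoly hV
  obtain ⟨c, -, hc⟩ := h (fun _ => 0) fun _ _ => analyticAt_const
  obtain ⟨t, ht⟩ := IsAlgClosed.exists_root (monicPoly μ fun j => c j z) (by
    rw [Polynomial.degree_eq_natDegree (monic_monicPoly _ _).ne_zero, natDegree_monicPoly]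
    exact_mod_cast hμ hN)
  obtain ⟨x, hx, hxz, -⟩ := (hc z hz t).1 ht
  exact ⟨x, hx, hxz⟩

theorem IsProperHol.finite_fiber (hP : IsProperHol Φ N V) {z : ι → ℂ} (hz : z ∈ V) :
    (N ∩ Φ ⁻¹' {z}).Finite := by
  obtain ⟨r, hr, hrV⟩ := Metric.isOpen_iff.1 hP.isOpen_target z hz
  have hQ := hP.restrict Metric.isOpen_ball hrV
  obtain ⟨μ, -, h⟩ := hQ.exists_charpoly (convex_ball z r).isPreconnected
  choose c _ hc using fun i : ι => h (fun x => x i) fun x _ =>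
    (ContinuousLinearMap.proj (R := ℂ) (φ := fun _ : ι => ℂ) i).analyticAt x
  refine (Set.Finite.pi (t := fun i => {t | (monicPoly μ fun j => c i j z).IsRoot t}) fun i =>
    Polynomial.finite_setOfPred_isRoot (monic_monicPoly _ _).ne_zero).subset ?_
  rintro x ⟨hx, rfl⟩ i -
  exact (hc i _ (Metric.mem_ball_self hr) _).2 ⟨x, ⟨hx, Metric.mem_ball_self hr⟩, rfl, rfl⟩

theorem IsProperHol.exists_discriminant (hP : IsProperHol Φ N V) (hV : IsPreconnected V) :
    ∃ d : (ι → ℂ) → ℂ, DifferentiableOn ℂ d V ∧ ∀ z ∈ V, IsRegVal Φ N z ↔ d z ≠ 0 := by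
  rcases N.eq_empty_or_nonempty with rfl | hN
  · exact ⟨fun _ => 1, by fun_prop, fun z _ => by simp [IsRegVal]⟩
  obtain ⟨μ, hμ, h⟩ := hP.exists_charpoly hV
  obtain ⟨c, hcd, hc⟩ := h (jac Φ) fun x hx => analyticAt_jac (hP.analytic x hx)
  refine ⟨c 0, hcd 0, fun z hz => ?_⟩
  have h1 : (monicPoly μ fun j => c j z).IsRoot 0 ↔ c 0 z = 0 := by
    rw [Polynomial.IsRoot.def, ← Polynomial.coeff_zero_eq_eval_zero,
      coeff_monicPoly _ _ (Nat.pos_of_ne_zero (hμ hN))]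
  rw [ne_eq, ← h1, hc z hz]
  simp [IsRegVal]

/-- A holomorphic map is proper near an isolated point of its fibre. -/
theorem exists_properNhd {D : Set (ι → ℂ)} (hΦ : AnalyticOnNhd ℂ Φ D) {x : ι → ℂ} {r : ℝ} (hr : 0 < r)
    (hsub : Metric.closedBall x r ⊆ D) (hiso : ∀ y ∈ Metric.closedBall x r, Φ y = Φ x → y = x) :
    ∃ δ₀ > 0, ∀ δ, 0 < δ → δ ≤ δ₀ →
      IsProperHol Φ (Metric.ball x r ∩ Φ ⁻¹' Metric.ball (Φ x) δ) (Metric.ball (Φ x) δ) := by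
  have hc : ContinuousOn Φ (Metric.closedBall x r) := fun y hy => (hΦ y (hsub hy)).continuousAt.continuousWithinAt
  have hs : IsCompact (Φ '' Metric.sphere x r) :=
    (isCompact_sphere x r).image_of_continuousOn (hc.mono Metric.sphere_subset_closedBall)
  have hx : Φ x ∉ Φ '' Metric.sphere x r := by
    rintro ⟨y, hy, hyx⟩
    have := hiso y (Metric.sphere_subset_closedBall hy) hyx
    rw [this, Metric.mem_sphere, dist_self] at hy
    exact hr.ne hy
  obtain ⟨δ₀, hδ₀, hd⟩ := Metric.isOpen_iff.1 hs.isClosed.isOpen_compl (Φ x) hx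
  refine ⟨δ₀, hδ₀, fun δ hδ hδδ => ⟨(hc.mono Metric.ball_subset_closedBall).isOpen_inter_preimage
    Metric.isOpen_ball Metric.isOpen_ball, Metric.isOpen_ball, fun y hy => hy.2,
    fun y hy => hΦ y (hsub (Metric.ball_subset_closedBall hy.1)), fun K hK hKc => ?_⟩⟩
  have h1 : IsCompact (Metric.closedBall x r ∩ Φ ⁻¹' K) :=
    (isCompact_closedBall x r).of_isClosed_subset
      (hc.preimage_isClosed_of_isClosed Metric.isClosed_closedBall hKc.isClosed) inter_subset_left
  convert h1 using 1
  ext y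
  refine ⟨fun h => ⟨Metric.ball_subset_closedBall h.1.1, h.2⟩, fun h => ⟨⟨?_, hK h.2⟩, h.2⟩⟩
  rcases (Metric.mem_closedBall.1 h.1).lt_or_eq with h2 | h2
  · exact h2
  · exact absurd (mem_image_of_mem Φ (Metric.mem_sphere.2 h2)) (hd (Metric.ball_subset_ball hδδ (hK h.2)))

/-- Points of the source are isolated in their fibres. -/
theorem IsProperHol.exists_isolating (hP : IsProperHol Φ N V) {x : ι → ℂ} (hx : x ∈ N) {O : Set (ι → ℂ)}
    (hO : IsOpen O) (hxO : x ∈ O) :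
    ∃ r > 0, Metric.closedBall x r ⊆ N ∩ O ∧ ∀ y ∈ Metric.closedBall x r, Φ y = Φ x → y = x := by
  have hfin : ((N ∩ Φ ⁻¹' {Φ x}) \ {x}).Finite := (hP.finite_fiber (hP.mapsTo hx)).sdiff
  obtain ⟨r, hr, h⟩ := Metric.nhds_basis_closedBall.mem_iff.1
    (((hP.isOpen_source.inter hO).inter hfin.isClosed.isOpen_compl).mem_nhds ⟨⟨hx, hxO⟩, fun h => h.2 rfl⟩)
  refine ⟨r, hr, fun y hy => (h hy).1, fun y hy hyx => ?_⟩
  by_contra hne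
  exact (h hy).2 ⟨⟨(h hy).1.1, hyx⟩, hne⟩

/-- Proper holomorphic maps are open. -/
theorem IsProperHol.eventually_exists (hP : IsProperHol Φ N V) {x : ι → ℂ} (hx : x ∈ N) {O : Set (ι → ℂ)}
    (hO : O ∈ 𝓝 x) : ∀ᶠ z in 𝓝 (Φ x), ∃ y ∈ N ∩ O, Φ y = z := by
  obtain ⟨O', hO', hO'o, hxO⟩ := mem_nhds_iff.1 hO
  obtain ⟨r, hr, hrN, hiso⟩ := hP.exists_isolating hx hO'o hxO
  obtain ⟨δ, hδ, h⟩ := exists_properNhd hP.analytic hr (hrN.trans inter_subset_left) hiso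
  filter_upwards [Metric.ball_mem_nhds (Φ x) hδ] with z hz
  obtain ⟨y, hy, hyz⟩ := (h δ hδ le_rfl).surjOn (convex_ball _ _).isPreconnected
    ⟨x, Metric.mem_ball_self hr, Metric.mem_ball_self hδ⟩ hz
  have := hrN (Metric.ball_subset_closedBall hy.1)
  exact ⟨y, ⟨this.1, hO' this.2⟩, hyz⟩

/-- If a preimage over an open subset splits into two open pieces, each is proper. -/
theorem IsProperHol.split (hP : IsProperHol Φ N V) {V' N₁ N₂ : Set (ι → ℂ)} (hV' : IsOpen V') (hsub : V' ⊆ V)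
    (h₁ : IsOpen N₁) (h₂ : IsOpen N₂) (hd : Disjoint N₁ N₂) (hu : N ∩ Φ ⁻¹' V' = N₁ ∪ N₂) :
    IsProperHol Φ N₁ V' := by
  refine (hP.restrict hV' hsub).clopen h₁ (hu ▸ subset_union_left) ?_
  rwa [hu, union_sdiff_left, hd.symm.sdiff_eq_left]

/-- The source is connected as soon as some fibre is a single point. -/
theorem IsProperHol.isPreconnected_source (hP : IsProperHol Φ N V) (hV : IsPreconnected V) {z₀ x₀ : ι → ℂ}
    (hz₀ : z₀ ∈ V) (h : ∀ x ∈ N, Φ x = z₀ → x = x₀) : IsPreconnected N := by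
  rintro A B hA hB hAB ⟨a, haN, ha⟩ ⟨b, hbN, hb⟩
  by_contra hne
  have hd : Disjoint (N ∩ A) (N ∩ B) := by
    rw [disjoint_left]
    rintro x ⟨hx, hxA⟩ ⟨-, hxB⟩
    exact hne ⟨x, hx, hxA, hxB⟩
  have hu : N ∩ Φ ⁻¹' V = (N ∩ A) ∪ (N ∩ B) := by
    rw [← inter_union_distrib_left, inter_eq_left.2 hAB, inter_eq_left]
    exact hP.mapsTo
  have hoA := hP.isOpen_source.inter hA
  have hoB := hP.isOpen_source.inter hB
  obtain ⟨x, hx, hxz⟩ := (hP.split hP.isOpen_target Subset.rfl hoA hoB hd hu).surjOn hV ⟨a, haN, ha⟩ hz₀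
  obtain ⟨y, hy, hyz⟩ := (hP.split hP.isOpen_target Subset.rfl hoB hoA hd.symm
    (by rw [hu, union_comm])).surjOn hV ⟨b, hbN, hb⟩ hz₀
  rw [h x hx.1 hxz] at hx
  rw [h y hy.1 hyz] at hy
  exact disjoint_left.1 hd hx hy

section Identity

variable {E : Type*} [NormedAddCommGroup E] [NormedSpace ℂ E] {f : E → ℂ} {U : Set E}

theorem eqOn_zero_of_convex (hU : IsOpen U) (hc : Convex ℝ U) (hf : DifferentiableOn ℂ f U) {a : E} (ha : a ∈ U)
    (h0 : f =ᶠ[𝓝 a] 0) {w : E} (hw : w ∈ U) : f w = 0 := by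
  let l : ℂ → E := fun t => a + t • (w - a)
  have hl : Differentiable ℂ l := by fun_prop
  set A := l ⁻¹' U with hA
  have hAo : IsOpen A := hU.preimage hl.continuous
  have hAc : Convex ℝ A := by
    have := hc.affine_preimage (((LinearMap.toSpanSingleton ℂ E (w - a)).restrictScalars ℝ).toAffineMap +
      AffineMap.const ℝ ℂ a)
    convert! this using 1
    ext t
    simp [hA, l, add_comm]
  have hg : AnalyticOnNhd ℂ (f ∘ l) A :=
    (hf.comp hl.differentiableOn fun t ht => ht).analyticOnNhd hAo
  have h0A : (0 : ℂ) ∈ A := by simpa [hA, l] using ha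
  have h1A : (1 : ℂ) ∈ A := by simpa [hA, l] using hw
  have hev : (f ∘ l) =ᶠ[𝓝 0] 0 := by
    have : Tendsto l (𝓝 0) (𝓝 a) := by simpa [l] using hl.continuous.tendsto 0
    exact this.eventually h0
  have := hg.eqOn_zero_of_preconnected_of_eventuallyEq_zero hAc.isPreconnected h0A hev h1A
  simpa [l] using this

/-- The identity principle for complex differentiable functions of several variables. -/
theorem eqOn_zero_of_isPreconnected (hU : IsOpen U) (hc : IsPreconnected U) (hf : DifferentiableOn ℂ f U)
    {a : E} (ha : a ∈ U) (h0 : f =ᶠ[𝓝 a] 0) {w : E} (hw : w ∈ U) : f w = 0 := by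
  have hsub : U ⊆ {z | f =ᶠ[𝓝 z] 0} := by
    refine hc.subset_of_closure_inter_subset isOpen_setOfPred_eventually_nhds ⟨a, ha, h0⟩ ?_
    rintro z ⟨hz, hzU⟩
    obtain ⟨r, hr, hrU⟩ := Metric.isOpen_iff.1 hU z hzU
    obtain ⟨z', hz', hzz⟩ := Metric.mem_closure_iff.1 hz r hr
    filter_upwards [Metric.ball_mem_nhds z hr] with y hy
    exact eqOn_zero_of_convex Metric.isOpen_ball (convex_ball z r) (hf.mono hrU)
      (Metric.mem_ball'.2 hzz) hz' hy
  exact (hsub hw).self_of_nhds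

end Identity

end

section

variable {ι : Type*} [Fintype ι] [DecidableEq ι]
variable {Φ : (ι → ℂ) → ι → ℂ} {N V : Set (ι → ℂ)}

theorem IsProperHol.isCoveringMapOn (hP : IsProperHol Φ N V) :
    IsCoveringMapOn (hP.mapsTo.restrict Φ N V) {z : V | IsRegVal Φ N z} := by
  have hcont : Continuous (hP.mapsTo.restrict Φ N V) := hP.continuousOn.mapsToRestrict hP.mapsTo
  have : LocallyCompactSpace V := hP.isOpen_target.locallyCompactSpace
  have hproper : IsProperMap (hP.mapsTo.restrict Φ N V) := by
    rw [isProperMap_iff_isCompact_preimage]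
    refine ⟨hcont, fun K hK => ?_⟩
    have h1 := hP.isCompact_preimage (Subtype.val '' K) (Subtype.coe_image_subset _ _)
      (hK.image continuous_subtype_val)
    rw [Topology.IsInducing.subtypeVal.isCompact_iff]
    convert h1 using 1
    ext x
    constructor
    · rintro ⟨y, hy, rfl⟩
      exact ⟨y.2, _, hy, rfl⟩
    · rintro ⟨hx, v, hv, hvx⟩
      refine ⟨⟨x, hx⟩, ?_, rfl⟩
      have : hP.mapsTo.restrict Φ N V ⟨x, hx⟩ = v := Subtype.ext hvx.symm
      rwa [mem_preimage, this]
  refine hproper.isClosedMap.isCoveringMapOn_of_isLocalHomeomorphOn (fun z _ => ?_) ?_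
  · refine Set.Finite.of_finite_image (f := Subtype.val) ((hP.finite_fiber z.2).subset ?_)
      Subtype.val_injective.injOn
    rintro _ ⟨y, hy, rfl⟩
    exact ⟨y.2, congrArg Subtype.val hy⟩
  · have h1 : IsLocalHomeomorphOn Φ {x ∈ N | jac Φ x ≠ 0} := by
      rintro x ⟨hx, hj⟩
      obtain ⟨e, he, hxe, -⟩ := exists_localInverse hP.analytic hP.isOpen_source Subset.rfl hx hj
      exact ⟨e, hxe, he.symm⟩
    have h2 : IsLocalHomeomorphOn (Φ ∘ (Subtype.val : N → ι → ℂ))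
        (hP.mapsTo.restrict Φ N V ⁻¹' {z : V | IsRegVal Φ N z}) :=
      h1.comp (hP.isOpen_source.isOpenEmbedding_subtypeVal.isLocalHomeomorph.isLocalHomeomorphOn) fun x hx =>
        ⟨x.2, hx x x.2 rfl⟩
    exact IsLocalHomeomorphOn.of_comp_left (g := (Subtype.val : V → ι → ℂ)) h2
      (hP.isOpen_target.isOpenEmbedding_subtypeVal.isLocalHomeomorph.isLocalHomeomorphOn)
      fun x _ => hcont.continuousAt

/-- Holomorphic sections over convex plane domains mapping to regular values. -/
theorem IsProperHol.exists_section (hP : IsProperHol Φ N V) {A : Set ℂ} (hA : IsOpen A) (hAc : Convex ℝ A)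
    {g : ℂ → ι → ℂ} (hg : Differentiable ℂ g) (hgV : ∀ t ∈ A, g t ∈ V) (hgr : ∀ t ∈ A, IsRegVal Φ N (g t))
    {a : ℂ} (ha : a ∈ A) {x : ι → ℂ} (hx : x ∈ N) (hxa : Φ x = g a) :
    ∃ σ : ℂ → ι → ℂ, σ a = x ∧ ∀ t ∈ A, σ t ∈ N ∧ Φ (σ t) = g t ∧ DifferentiableAt ℂ σ t := by
  have : ContractibleSpace A := hAc.contractibleSpace ⟨a, ha⟩
  have : LocallyPathConnectedSpace A := hA.locallyPathConnectedSpace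
  have hcov := hP.isCoveringMapOn
  let f : C(A, V) := ⟨fun t => ⟨g t, hgV t t.2⟩, (hg.continuous.comp continuous_subtype_val).subtype_mk _⟩
  obtain ⟨F, ⟨hF0, hF⟩, -⟩ := hcov.existsUnique_continuousMap_lifts f (a₀ := ⟨a, ha⟩) (e₀ := ⟨x, hx⟩)
    (Subtype.ext hxa) fun t => hgr t t.2
  classical
  let σ : ℂ → ι → ℂ := fun t => if ht : t ∈ A then (F ⟨t, ht⟩ : ι → ℂ) else 0
  have hσ : ∀ t (ht : t ∈ A), σ t = F ⟨t, ht⟩ := fun t ht => dif_pos ht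
  have hσN : ∀ t ∈ A, σ t ∈ N := fun t ht => by rw [hσ t ht]; exact (F ⟨t, ht⟩).2
  have hσΦ : ∀ t ∈ A, Φ (σ t) = g t := fun t ht => by
    rw [hσ t ht]
    exact congrArg Subtype.val (congrFun hF ⟨t, ht⟩)
  have hσc : ContinuousOn σ A := by
    rw [continuousOn_iff_continuous_domRestrict]
    have : A.domRestrict σ = fun t => (F t : ι → ℂ) := by
      funext t
      exact hσ t t.2
    rw [this]
    exact continuous_subtype_val.comp F.continuous
  refine ⟨σ, by rw [hσ a ha, hF0], fun t ht => ⟨hσN t ht, hσΦ t ht, ?_⟩⟩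
  obtain ⟨e, he, hxe, -, -, hed⟩ := exists_localInverse hP.analytic hP.isOpen_source Subset.rfl (hσN t ht)
    (hgr t ht _ (hσN t ht) (hσΦ t ht))
  have hev : σ =ᶠ[𝓝 t] fun s => e.symm (g s) := by
    filter_upwards [hA.mem_nhds ht, (hσc.continuousAt (hA.mem_nhds ht)) (e.open_source.mem_nhds hxe)] with s hs hse
    rw [← hσΦ s hs, ← he, e.left_inv hse]
  refine DifferentiableAt.congr_of_eventuallyEq ?_ hev
  refine DifferentiableAt.comp (g := e.symm) t (hed _ ?_) (hg t)
  rw [← hσΦ t ht, ← he]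
  exact e.map_source hxe

end

section

variable {ι : Type*} [Fintype ι] [DecidableEq ι]
variable {Φ : (ι → ℂ) → ι → ℂ} {N V : Set (ι → ℂ)}

/-- A line not contained in the zero set of a holomorphic function can be shifted off the zero set
along `[0, 1]`. -/
theorem eventually_shift_ne_zero {q : ℂ → ℂ} {A : Set ℂ} (hA : IsOpen A) (hAc : IsPreconnected A)
    (hq : DifferentiableOn ℂ q A) (h01 : ∀ t ∈ Icc (0 : ℝ) 1, (t : ℂ) ∈ A) (h1 : q 1 ≠ 0) :
    ∀ᶠ η : ℝ in 𝓝 (0 : ℝ), ∀ t ∈ Icc (0 : ℝ) 1, (t + η * Complex.I : ℂ) ∈ A ∧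
      (η ≠ 0 → q (t + η * Complex.I) ≠ 0) := by
  have hqa : AnalyticOnNhd ℂ q A := hq.analyticOnNhd hA
  refine (isCompact_Icc : IsCompact (Icc (0 : ℝ) 1)).eventually_forall_of_forall_eventually fun t ht => ?_
  have hev : ∀ᶠ s in 𝓝 (t : ℂ), s ∈ A ∧ (s ≠ t → q s ≠ 0) := by
    refine Filter.Eventually.and (hA.mem_nhds (h01 t ht)) ?_
    rcases (hqa t (h01 t ht)).eventually_eq_zero_or_eventually_ne_zero with h | h
    · exact absurd (hqa.eqOn_zero_of_preconnected_of_eventuallyEq_zero hAc (h01 t ht) h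
        (by simpa using h01 1 (by simp))) h1
    · exact eventually_nhdsWithin_iff.1 h
  have hc : Tendsto (fun p : ℝ × ℝ => (p.2 + p.1 * Complex.I : ℂ)) (𝓝 (0, t)) (𝓝 t) := by
    have : Continuous fun p : ℝ × ℝ => (p.2 + p.1 * Complex.I : ℂ) := by fun_prop
    simpa using this.tendsto (0, t)
  filter_upwards [hc.eventually hev] with p hp
  refine ⟨hp.1, fun hp2 => hp.2 fun h => hp2 ?_⟩
  simpa using congrArg Complex.im h

theorem convex_preimage_line {E : Type*} [AddCommGroup E] [Module ℂ E] {A : Set E} (hA : Convex ℝ A)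
    (z h : E) : Convex ℝ ((fun t : ℂ => z + t • h) ⁻¹' A) := by
  intro x hx y hy a b ha hb hab
  have h1 := hA hx hy ha hb hab
  rw [mem_preimage]
  convert h1 using 1
  have h2 : (a : ℂ) + b = 1 := by exact_mod_cast hab
  simp only [← Complex.coe_smul, smul_add, smul_smul, smul_eq_mul]
  calc z + (a * x + b * y : ℂ) • h = ((a : ℂ) + b) • z + (a * x + b * y : ℂ) • h := by rw [h2, one_smul]
    _ = _ := by module

/-- Differentiating along a section. -/
theorem hasDerivAt_comp_section {u : (ι → ℂ) → ℂ} {α : (ι → ℂ) → (ι → ℂ) →L[ℂ] ℂ}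
    {σ : ℂ → ι → ℂ} {z h : ι → ℂ} {t : ℂ} {A : Set ℂ} (hA : A ∈ 𝓝 t)
    (hu : DifferentiableAt ℂ u (σ t)) (hΦ : DifferentiableAt ℂ Φ (σ t))
    (hα : fderiv ℂ u (σ t) = (α (σ t)).comp (fderiv ℂ Φ (σ t)))
    (hσ : DifferentiableAt ℂ σ t) (hs : ∀ t ∈ A, Φ (σ t) = z + t • h) :
    HasDerivAt (fun t => u (σ t)) (α (σ t) h) t := by
  have h1 := hu.hasFDerivAt.comp_hasDerivAt t hσ.hasDerivAt
  have h2 := hΦ.hasFDerivAt.comp_hasDerivAt t hσ.hasDerivAt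
  have h3 : HasDerivAt (Φ ∘ σ) h t := by
    have : HasDerivAt (fun t : ℂ => z + t • h) h t := by
      simpa using ((hasDerivAt_id t).smul_const h).const_add z
    exact this.congr_of_eventuallyEq (by filter_upwards [hA] with s hs' using hs s hs')
  rw [hα, ContinuousLinearMap.comp_apply, h2.unique h3] at h1
  exact h1

/-- Mean value inequality along a proper holomorphic map: a function whose differential factors
through that of the map changes in a controlled way along segments in the base. -/
theorem IsProperHol.exists_norm_sub_le (hP : IsProperHol Φ N V) {u : (ι → ℂ) → ℂ}
    (hu : AnalyticOnNhd ℂ u N) {α : (ι → ℂ) → (ι → ℂ) →L[ℂ] ℂ} (hαc : ContinuousOn α N)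
    (hα : ∀ x ∈ N, fderiv ℂ u x = (α x).comp (fderiv ℂ Φ x)) {z₀ z₁ : ι → ℂ}
    (hseg : segment ℝ z₀ z₁ ⊆ V) {L : ℝ}
    (hL : ∀ x ∈ N, Φ x ∈ segment ℝ z₀ z₁ → ‖α x (z₁ - z₀)‖ ≤ L) {x₁ : ι → ℂ} (hx₁ : x₁ ∈ N)
    (hx₁z : Φ x₁ = z₁) : ∃ x₀ ∈ N, Φ x₀ = z₀ ∧ ‖u x₁ - u x₀‖ ≤ L := by
  have hz₀ : z₀ ∈ V := hseg (left_mem_segment ℝ _ _)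
  have hz₁ : z₁ ∈ V := hseg (right_mem_segment ℝ _ _)
  have hL0 : 0 ≤ L := (norm_nonneg _).trans (hL x₁ hx₁ (hx₁z ▸ right_mem_segment ℝ _ _))
  suffices H : ∀ ε > 0, ∃ x₀ ∈ N, Φ x₀ = z₀ ∧ ‖u x₁ - u x₀‖ ≤ L + ε by
    have hne : (N ∩ Φ ⁻¹' {z₀}).Nonempty := by
      obtain ⟨x, hx, hxz, -⟩ := H 1 one_pos
      exact ⟨x, hx, hxz⟩
    obtain ⟨x₀, hx₀, hmin⟩ := Set.exists_min_image _ (fun x => ‖u x₁ - u x‖) (hP.finite_fiber hz₀) hne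
    refine ⟨x₀, hx₀.1, hx₀.2, le_of_forall_pos_le_add fun ε hε => ?_⟩
    obtain ⟨x, hx, hxz, hxε⟩ := H ε hε
    exact (hmin x ⟨hx, hxz⟩).trans hxε
  intro ε hε
  by_contra! hcon
  -- a ball around the initial point
  obtain ⟨r, hr, hrV, hrO⟩ := hP.exists_ball hz₀
    (O := N ∩ (fun x => ‖u x₁ - u x‖) ⁻¹' Ioi (L + ε))
    ((continuousOn_const.sub fun x hx => (hu x hx).continuousAt.continuousWithinAt).norm.isOpen_inter_preimage
      hP.isOpen_source isOpen_Ioi) fun x hx hxz => ⟨hx, hcon x hx hxz⟩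
  -- a thickening of the segment
  have hsegc : IsCompact (segment ℝ z₀ z₁) := by
    rw [segment_eq_image_lineMap]
    exact isCompact_Icc.image (AffineMap.lineMap_continuous)
  obtain ⟨δ, hδ, hδV⟩ := hsegc.exists_cthickening_subset_open
    (isOpen_interior (s := {z | z ∈ V ∧ ∀ x ∈ N, Φ x = z → ‖α x (z₁ - z₀)‖ < L + ε / 4})) (by
      intro z hz
      obtain ⟨r, hr, hrV, hrO⟩ := hP.exists_ball (hseg hz)
        (O := N ∩ (fun x => ‖α x (z₁ - z₀)‖) ⁻¹' Iio (L + ε / 4))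
        ((hαc.clm_apply continuousOn_const).norm.isOpen_inter_preimage hP.isOpen_source isOpen_Iio)
        fun x hx hxz => ⟨hx, by simpa using (hL x hx (hxz ▸ hz)).trans_lt (by linarith)⟩
      rw [mem_interior_iff_mem_nhds]
      filter_upwards [Metric.ball_mem_nhds z hr] with w hw
      exact ⟨hrV hw, fun x hx hxw => (hrO x hx (hxw ▸ hw)).2⟩)
  have hδG : ∀ z ∈ Metric.cthickening δ (segment ℝ z₀ z₁), z ∈ V ∧ ∀ x ∈ N, Φ x = z →
      ‖α x (z₁ - z₀)‖ < L + ε / 4 := by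
    intro z hz
    have := interior_subset (hδV hz)
    exact this
  have hKc := hP.isCompact_preimage (Metric.cthickening δ (segment ℝ z₀ z₁)) (fun z hz => (hδG z hz).1)
    hsegc.cthickening
  obtain ⟨M, hM⟩ := hKc.exists_bound_of_continuousOn (hαc.mono inter_subset_left)
  set V' := Metric.thickening δ (segment ℝ z₀ z₁) with hV'
  have hV'o : IsOpen V' := Metric.isOpen_thickening
  have hV'c : Convex ℝ V' := (convex_segment z₀ z₁).thickening δ
  have hV'sub : V' ⊆ Metric.cthickening δ (segment ℝ z₀ z₁) := Metric.thickening_subset_cthickening _ _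
  have hV'V : V' ⊆ V := fun z hz => (hδG z (hV'sub hz)).1
  have hsegV' : segment ℝ z₀ z₁ ⊆ V' := Metric.self_subset_thickening hδ _
  have hQ := hP.restrict hV'o hV'V
  obtain ⟨d, hd, hdr⟩ := hQ.exists_discriminant hV'c.isPreconnected
  -- a nearby regular end point
  have hev1 := hP.eventually_exists hx₁ (O := {x | ‖u x₁ - u x‖ < ε / 4}) (by
    have : ContinuousAt (fun x => ‖u x₁ - u x‖) x₁ := (continuousAt_const.sub (hu x₁ hx₁).continuousAt).norm
    exact this.eventually_lt_const (by simpa using by linarith))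
  rw [hx₁z] at hev1
  have hev2 : ∀ᶠ w in 𝓝 z₁, ‖w - z₁‖ * (|M| + 1) < ε / 4 := by
    have : ContinuousAt (fun w => ‖w - z₁‖ * (|M| + 1)) z₁ := by fun_prop
    exact this.eventually_lt_const (by simpa using by linarith)
  obtain ⟨z₁', hreg, hz₁'e, hz₁'M, hz₁'V⟩ := ((hQ.dense_regVal z₁).and_eventually
    ((eventually_eventually_nhds.2 hev1).and (hev2.and (hV'o.mem_nhds (hsegV' (right_mem_segment ℝ _ _)))))).exists
  set h := z₁' - z₀ with hh
  let l : ℂ → ι → ℂ := fun t => z₀ + t • h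
  have hl : Differentiable ℂ l := by fun_prop
  have hl1 : l 1 = z₁' := by simp [l, hh]
  have hαh : ∀ x ∈ N, Φ x ∈ V' → ‖α x h‖ ≤ L + ε / 2 := by
    intro x hx hxV
    have e : h = (z₁ - z₀) + (z₁' - z₁) := by simp [hh]
    have h1 := hM x ⟨hx, hV'sub hxV⟩
    have h2 := (hδG _ (hV'sub hxV)).2 x hx rfl
    calc ‖α x h‖ ≤ ‖α x (z₁ - z₀)‖ + ‖α x (z₁' - z₁)‖ := by rw [e, map_add]; exact norm_add_le _ _
      _ ≤ (L + ε / 4) + ‖z₁' - z₁‖ * (|M| + 1) := by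
        gcongr
        refine ((α x).le_opNorm _).trans ?_
        rw [mul_comm]
        gcongr
        linarith [le_abs_self M]
      _ ≤ L + ε / 2 := by linarith
  have hAc : Convex ℝ (l ⁻¹' V') := convex_preimage_line hV'c z₀ h
  have hAo : IsOpen (l ⁻¹' V') := hV'o.preimage hl.continuous
  have h01 : ∀ t ∈ Icc (0 : ℝ) 1, (t : ℂ) ∈ l ⁻¹' V' := by
    intro t ht
    have := hAc.segment_subset (x := (0 : ℂ)) (y := 1)
      (by simpa [l] using hsegV' (left_mem_segment ℝ _ _)) (by rw [mem_preimage, hl1]; exact hz₁'V)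
    refine this ?_
    rw [segment_eq_image_lineMap]
    exact ⟨t, ht, by simp [AffineMap.lineMap_apply]⟩
  have hqd : DifferentiableOn ℂ (fun t => d (l t)) (l ⁻¹' V') :=
    hd.comp hl.differentiableOn fun _ h => h
  have hev3 := eventually_shift_ne_zero hAo hAc.isPreconnected hqd h01 (by
    simpa only [hl1] using (hdr z₁' hz₁'V).1 hreg)
  have hlc : ∀ a : ℂ, Tendsto (fun η : ℝ => l (a + η * Complex.I)) (𝓝 0) (𝓝 (l a)) := by
    intro a
    have : Continuous fun η : ℝ => l (a + η * Complex.I) := hl.continuous.comp (by fun_prop)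
    simpa using this.tendsto 0
  have hev4 : ∀ᶠ η in 𝓝[≠] (0 : ℝ), η ≠ 0 := self_mem_nhdsWithin
  have hl0 : l 0 = z₀ := by simp [l]
  have hlc0 := hlc 0
  have hlc1 := hlc 1
  rw [hl0] at hlc0
  rw [hl1] at hlc1
  obtain ⟨η, hη0, hηq, hηr, hηe⟩ := (hev4.and (eventually_nhdsWithin_of_eventually_nhds
    (hev3.and (((hlc0.eventually (Metric.ball_mem_nhds z₀ hr))).and
      (hlc1.eventually hz₁'e))))).exists
  have hA₁o : IsOpen (l ⁻¹' V' ∩ (fun t => d (l t)) ⁻¹' {0}ᶜ) :=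
    hqd.continuousOn.isOpen_inter_preimage hAo isOpen_compl_singleton
  let c : ℂ := η * Complex.I
  have hcseg : segment ℝ c (1 + c) = (fun t : ℝ => (t + c : ℂ)) '' Icc 0 1 := by
    rw [segment_eq_image_lineMap]
    refine image_congr fun t _ => ?_
    simp [AffineMap.lineMap_apply]
  obtain ⟨ρ, hρ, hρA⟩ := (hcseg ▸ isCompact_Icc.image (by fun_prop) :
    IsCompact (segment ℝ c (1 + c))).exists_thickening_subset_open hA₁o (by
      rw [hcseg]
      rintro _ ⟨t, ht, rfl⟩
      exact ⟨(hηq t ht).1, (hηq t ht).2 hη0⟩)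
  set A := Metric.thickening ρ (segment ℝ c (1 + c)) with hA
  have hAseg : segment ℝ c (1 + c) ⊆ A := Metric.self_subset_thickening hρ _
  have h1A : 1 + c ∈ A := hAseg (right_mem_segment ℝ _ _)
  have h0A : c ∈ A := hAseg (left_mem_segment ℝ _ _)
  have hAconv : Convex ℝ A := (convex_segment _ _).thickening ρ
  obtain ⟨y, ⟨hyN, hyu⟩, hyz⟩ := hηe
  obtain ⟨σ, hσ1, hσ⟩ := hQ.exists_section Metric.isOpen_thickening hAconv hl (fun t ht => (hρA ht).1)
    (fun t ht => (hdr _ (hρA ht).1).2 (hρA ht).2) h1A (x := y)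
    ⟨hyN, by rw [mem_preimage, hyz]; exact (hρA h1A).1⟩ hyz
  have hder : ∀ t ∈ A, HasDerivAt (fun t => u (σ t)) (α (σ t) h) t := fun t ht =>
    hasDerivAt_comp_section (Metric.isOpen_thickening.mem_nhds ht) (hu _ (hσ t ht).1.1).differentiableAt
      (hP.analytic _ (hσ t ht).1.1).differentiableAt (hα _ (hσ t ht).1.1) (hσ t ht).2.2
      fun s hs => (hσ s hs).2.1
  have hmv := hAconv.norm_image_sub_le_of_norm_hasDerivWithin_le (C := L + ε / 2)
    (fun t ht => (hder t ht).hasDerivWithinAt)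
    (fun t ht => hαh _ (hσ t ht).1.1 (hσ t ht).1.2) h0A h1A
  simp only [add_sub_cancel_right, norm_one, mul_one, hσ1] at hmv
  have hfin := (hrO (σ c) (hσ c h0A).1.1 (by rw [(hσ c h0A).2.1]; simpa [c] using hηr)).2
  simp only [mem_preimage, mem_Ioi] at hfin
  simp only [mem_ofPred_eq] at hyu
  have : ‖u x₁ - u (σ c)‖ ≤ ‖u x₁ - u y‖ + ‖u y - u (σ c)‖ := norm_sub_le_norm_sub_add_norm_sub _ _ _
  linarith

end

section

variable {ι : Type*} [Fintype ι] [DecidableEq ι]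
variable {T X : Type*} [Fintype T] [DecidableEq T] [Fintype X] [DecidableEq X]

/-- The partial derivative of `f` in the direction of the `i`-th coordinate. -/
noncomputable def pd (f : (ι → ℂ) → ℂ) (i : ι) (z : ι → ℂ) : ℂ := fderiv ℂ f z (Pi.single i 1)

theorem AnalyticAt.pd {f : (ι → ℂ) → ℂ} {z : ι → ℂ} (hf : AnalyticAt ℂ f z) (i : ι) :
    AnalyticAt ℂ (pd f i) z :=
  ((ContinuousLinearMap.apply ℂ ℂ (Pi.single i (1 : ℂ) : ι → ℂ)).analyticAt _).comp hf.fderiv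

theorem fderiv_eq_sum_pd (f : (ι → ℂ) → ℂ) (z v : ι → ℂ) : fderiv ℂ f z v = ∑ i, v i * pd f i z :=
  clm_apply_eq_sum _ _

/-- The relative gradient map `(t, x) ↦ (t, ∂f/∂x)`. -/
noncomputable def relGrad (f : (T ⊕ X → ℂ) → ℂ) (z : T ⊕ X → ℂ) : T ⊕ X → ℂ :=
  Sum.elim (fun j => z (Sum.inl j)) fun k => pd f (Sum.inr k) z

@[simp] theorem relGrad_inl (f : (T ⊕ X → ℂ) → ℂ) (z : T ⊕ X → ℂ) (j : T) :
    relGrad f z (Sum.inl j) = z (Sum.inl j) := rfl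

@[simp] theorem relGrad_inr (f : (T ⊕ X → ℂ) → ℂ) (z : T ⊕ X → ℂ) (k : X) :
    relGrad f z (Sum.inr k) = pd f (Sum.inr k) z := rfl

theorem AnalyticAt.relGrad {f : (T ⊕ X → ℂ) → ℂ} {z : T ⊕ X → ℂ} (hf : AnalyticAt ℂ f z) :
    AnalyticAt ℂ (relGrad f) z := by
  refine AnalyticAt.pi fun i => ?_
  rcases i with j | k
  · exact (ContinuousLinearMap.proj (R := ℂ) (φ := fun _ : T ⊕ X => ℂ) (Sum.inl j)).analyticAt z
  · exact hf.pd _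

/-- The relative Legendre transform of `f`. -/
noncomputable def legendre (f : (T ⊕ X → ℂ) → ℂ) (z : T ⊕ X → ℂ) : ℂ :=
  f z - ∑ k, z (Sum.inr k) * pd f (Sum.inr k) z

/-- The differential of the relative Legendre transform with respect to the relative gradient map. -/
noncomputable def legendreForm (f : (T ⊕ X → ℂ) → ℂ) (z : T ⊕ X → ℂ) : (T ⊕ X → ℂ) →L[ℂ] ℂ :=
  ∑ j, pd f (Sum.inl j) z • ContinuousLinearMap.proj (R := ℂ) (φ := fun _ : T ⊕ X => ℂ) (Sum.inl j) -
    ∑ k, z (Sum.inr k) • ContinuousLinearMap.proj (R := ℂ) (φ := fun _ : T ⊕ X => ℂ) (Sum.inr k)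

theorem legendreForm_apply (f : (T ⊕ X → ℂ) → ℂ) (z h : T ⊕ X → ℂ) :
    legendreForm f z h = ∑ j, pd f (Sum.inl j) z * h (Sum.inl j) - ∑ k, z (Sum.inr k) * h (Sum.inr k) := by
  simp [legendreForm]

theorem AnalyticAt.legendre {f : (T ⊕ X → ℂ) → ℂ} {z : T ⊕ X → ℂ} (hf : AnalyticAt ℂ f z) :
    AnalyticAt ℂ (legendre f) z := by
  have h1 : ∀ k : X, AnalyticAt ℂ (fun z : T ⊕ X → ℂ => z (Sum.inr k) * _root_.pd f (Sum.inr k) z) z := fun k =>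
    ((ContinuousLinearMap.proj (R := ℂ) (φ := fun _ : T ⊕ X => ℂ) (Sum.inr k)).analyticAt z).mul (hf.pd _)
  exact hf.sub (Finset.univ.analyticAt_fun_sum fun k _ => h1 k)

theorem fderiv_legendre {f : (T ⊕ X → ℂ) → ℂ} {z : T ⊕ X → ℂ} (hf : AnalyticAt ℂ f z) :
    fderiv ℂ (legendre f) z = (legendreForm f z).comp (fderiv ℂ (relGrad f) z) := by
  ext1 v
  have hp : ∀ i, HasFDerivAt (pd f i) (fderiv ℂ (pd f i) z) z := fun i => (hf.pd i).differentiableAt.hasFDerivAt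
  have hx : ∀ i : T ⊕ X, HasFDerivAt (fun z : T ⊕ X → ℂ => z i)
      (ContinuousLinearMap.proj (R := ℂ) (φ := fun _ : T ⊕ X => ℂ) i) z := fun i =>
    (ContinuousLinearMap.proj (R := ℂ) (φ := fun _ : T ⊕ X => ℂ) i).hasFDerivAt
  have h1 : HasFDerivAt (legendre f) _ z := hf.differentiableAt.hasFDerivAt.sub
    (HasFDerivAt.fun_sum (u := Finset.univ) fun k _ => (hx (Sum.inr k)).mul (hp (Sum.inr k)))
  have h2 : ∀ i, fderiv ℂ (relGrad f) z v i = fderiv ℂ (fun z => relGrad f z i) z v := by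
    intro i
    rw [(hasFDerivAt_pi'.1 hf.relGrad.differentiableAt.hasFDerivAt i).fderiv]
    rfl
  have h3 : ∀ j : T, fderiv ℂ (relGrad f) z v (Sum.inl j) = v (Sum.inl j) := by
    intro j
    rw [h2]
    exact congrArg (· v) (hx (Sum.inl j)).fderiv
  have h4 : ∀ k : X, fderiv ℂ (relGrad f) z v (Sum.inr k) = fderiv ℂ (pd f (Sum.inr k)) z v := fun k => h2 _
  rw [h1.fderiv, ContinuousLinearMap.comp_apply, legendreForm_apply]
  simp only [h3, h4, sub_apply, fderiv_eq_sum_pd f, Fintype.sum_sum_type]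
  simp only [sum_apply, add_apply, smul_apply,
    ContinuousLinearMap.proj_apply, smul_eq_mul, Finset.sum_add_distrib]
  simp only [mul_comm (v _)]
  ring

variable {f : (T ⊕ X → ℂ) → ℂ} {N V : Set (T ⊕ X → ℂ)}

/-- Mean value inequality for the relative Legendre transform. -/
theorem IsProperHol.exists_legendre_sub_le (hP : IsProperHol (relGrad f) N V) (hf : AnalyticOnNhd ℂ f N)
    (ℓ : (T ⊕ X → ℂ) →L[ℂ] ℂ) {z₀ z₁ : T ⊕ X → ℂ} (hseg : segment ℝ z₀ z₁ ⊆ V) {L : ℝ}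
    (hL : ∀ x ∈ N, relGrad f x ∈ segment ℝ z₀ z₁ → ‖legendreForm f x (z₁ - z₀) + ℓ (z₁ - z₀)‖ ≤ L)
    {x₁ : T ⊕ X → ℂ} (hx₁ : x₁ ∈ N) (hx₁z : relGrad f x₁ = z₁) :
    ∃ x₀ ∈ N, relGrad f x₀ = z₀ ∧ ‖legendre f x₁ - legendre f x₀ + ℓ (z₁ - z₀)‖ ≤ L := by
  have hd : ∀ x ∈ N, fderiv ℂ (fun x => legendre f x + ℓ (relGrad f x)) x =
      (legendreForm f x + ℓ).comp (fderiv ℂ (relGrad f) x) := by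
    intro x hx
    have h1 := (hf x hx).legendre.differentiableAt.hasFDerivAt.add
      (ℓ.hasFDerivAt.comp x (hf x hx).relGrad.differentiableAt.hasFDerivAt)
    rw [ContinuousLinearMap.add_comp, ← fderiv_legendre (hf x hx)]
    exact h1.fderiv
  obtain ⟨x₀, hx₀, hx₀z, h⟩ := hP.exists_norm_sub_le (u := fun x => legendre f x + ℓ (relGrad f x))
    (fun x hx => (hf x hx).legendre.add ((ℓ.analyticAt _).comp (hf x hx).relGrad))
    (α := fun x => legendreForm f x + ℓ) (by
      refine ContinuousOn.add ?_ continuousOn_const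
      refine ContinuousOn.sub (continuousOn_finsetSum _ fun j _ => ?_) (by fun_prop)
      have : ContinuousOn (pd f (Sum.inl j)) N := fun x hx => ((hf x hx).pd _).continuousAt.continuousWithinAt
      fun_prop) hd hseg hL hx₁ hx₁z
  refine ⟨x₀, hx₀, hx₀z, ?_⟩
  simp only [hx₁z, hx₀z] at h
  convert h using 2
  rw [map_sub]
  ring

end

section

variable {T X : Type*} [Fintype T] [DecidableEq T] [Fintype X] [DecidableEq X]
variable {f : (T ⊕ X → ℂ) → ℂ} {N V : Set (T ⊕ X → ℂ)} {r : ℝ}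

theorem legendre_eq_of_inr {x : T ⊕ X → ℂ} (hx : relGrad f x ∘ Sum.inr = 0) : legendre f x = f x := by
  have : ∀ k, pd f (Sum.inr k) x = 0 := fun k => congrFun hx k
  simp [legendre, this]

/-- A linear form in the last group of coordinates. -/
noncomputable def inrForm (y : X → ℂ) : (T ⊕ X → ℂ) →L[ℂ] ℂ :=
  ∑ k, y k • ContinuousLinearMap.proj (R := ℂ) (φ := fun _ : T ⊕ X => ℂ) (Sum.inr k)

@[simp] theorem inrForm_apply (y : X → ℂ) (z : T ⊕ X → ℂ) : inrForm y z = ∑ k, y k * z (Sum.inr k) := by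
  simp [inrForm]

theorem norm_sum_mul_le (a b : X → ℂ) {A B : ℝ} (ha : ‖a‖ ≤ A) (hb : ‖b‖ ≤ B) :
    ‖∑ k, a k * b k‖ ≤ Fintype.card X * (A * B) := by
  have hA : 0 ≤ A := (norm_nonneg _).trans ha
  calc ‖∑ k, a k * b k‖ ≤ ∑ _k : X, A * B := norm_sum_le_of_le _ fun k _ => by
        rw [norm_mul]
        exact mul_le_mul ((norm_le_pi_norm _ _).trans ha) ((norm_le_pi_norm _ _).trans hb) (norm_nonneg _) hA
    _ = _ := by simp

theorem norm_comp_inr_le (z : T ⊕ X → ℂ) : ‖z ∘ Sum.inr‖ ≤ ‖z‖ :=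
  (pi_norm_le_iff_of_nonneg (norm_nonneg _)).2 fun k => norm_le_pi_norm z (Sum.inr k)

/-- Replacing the coordinates in the last group by zero. -/
def zeroInr (z : T ⊕ X → ℂ) : T ⊕ X → ℂ := Sum.elim (z ∘ Sum.inl) 0

theorem norm_zeroInr_sub_le {z b : T ⊕ X → ℂ} (hb : b ∘ Sum.inr = 0) : ‖zeroInr z - b‖ ≤ ‖z - b‖ := by
  refine (pi_norm_le_iff_of_nonneg (norm_nonneg _)).2 fun i => ?_
  rcases i with j | k
  · exact norm_le_pi_norm (z - b) (Sum.inl j)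
  · have : b (Sum.inr k) = 0 := congrFun hb k
    simp [zeroInr, this]

theorem legendre_add_le {b y : T ⊕ X → ℂ} (hP : IsProperHol (relGrad f) N (Metric.ball b r))
    (hb : b ∘ Sum.inr = 0) (hf : AnalyticOnNhd ℂ f N)
    (h0 : ∀ x ∈ N, relGrad f x ∘ Sum.inr = 0 → legendre f x = 0) {ε : ℝ} (hε : ∀ x ∈ N, ‖x - y‖ ≤ ε)
    {x : T ⊕ X → ℂ} (hx : x ∈ N) :
    ‖legendre f x + ∑ k, y (Sum.inr k) * relGrad f x (Sum.inr k)‖ ≤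
      Fintype.card X * (ε * ‖relGrad f x ∘ Sum.inr‖) := by
  have hxV := hP.mapsTo hx
  have hz₀ : zeroInr (relGrad f x) ∈ Metric.ball b r := by
    rw [mem_ball_iff_norm] at hxV ⊢
    exact (norm_zeroInr_sub_le hb).trans_lt hxV
  have hh : ∀ i, (relGrad f x - zeroInr (relGrad f x)) i = Sum.elim (fun _ => 0) (relGrad f x ∘ Sum.inr) i := by
    rintro (j | k) <;> simp [zeroInr]
  obtain ⟨x₀, hx₀, hx₀z, hle⟩ := hP.exists_legendre_sub_le hf (inrForm (y ∘ Sum.inr))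
    ((convex_ball b r).segment_subset hz₀ hxV) (L := Fintype.card X * (ε * ‖relGrad f x ∘ Sum.inr‖))
    (fun x' hx' _ => by
      rw [legendreForm_apply, inrForm_apply]
      simp only [hh, Sum.elim_inl, Sum.elim_inr, mul_zero, Finset.sum_const_zero, zero_sub]
      rw [neg_add_eq_sub, ← Finset.sum_sub_distrib]
      have := norm_sum_mul_le ((y - x') ∘ Sum.inr) (relGrad f x ∘ Sum.inr) (A := ε)
        ((norm_comp_inr_le _).trans (by rw [norm_sub_rev]; exact hε x' hx')) le_rfl
      simpa [sub_mul] using this) hx rfl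
  rw [h0 x₀ hx₀ (by rw [hx₀z]; rfl), inrForm_apply, sub_zero] at hle
  simpa only [hh, Sum.elim_inr, Function.comp_apply] using hle

/-- The local situation near an isolated point of a fibre of the relative gradient map, with the
relative critical locus equal to the critical locus. -/
structure IsCritCover (f : (T ⊕ X → ℂ) → ℂ) (N : Set (T ⊕ X → ℂ)) (r : ℝ) : Prop where
  pos : 0 < r
  proper : IsProperHol (relGrad f) N (Metric.ball 0 r)
  analytic : AnalyticOnNhd ℂ f N
  bounded : ∃ C, ∀ x ∈ N, ‖x‖ ≤ C
  zero_mem : 0 ∈ N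
  relGrad_zero : relGrad f 0 = 0
  eq_zero : ∀ x ∈ N, relGrad f x = 0 → x = 0
  crit : ∀ x ∈ N, relGrad f x ∘ Sum.inr = 0 → ∀ j, pd f (Sum.inl j) x = 0
  map_zero : f 0 = 0

namespace IsCritCover

theorem legendre_eq_zero (h : IsCritCover f N r) {x : T ⊕ X → ℂ} (hx : x ∈ N)
    (hw : relGrad f x ∘ Sum.inr = 0) : legendre f x = 0 := by
  obtain ⟨x₀, hx₀, hx₀z, hle⟩ := h.proper.exists_legendre_sub_le h.analytic 0
    ((convex_ball (0 : T ⊕ X → ℂ) r).segment_subset (Metric.mem_ball_self h.pos) (h.proper.mapsTo hx)) (L := 0)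
    (fun x' hx' hx's => by
      have hw' : relGrad f x' ∘ Sum.inr = 0 := by
        rw [segment_eq_image] at hx's
        obtain ⟨t, -, ht⟩ := hx's
        funext k
        have := congrFun hw k
        simp only [Function.comp_apply, Pi.zero_apply] at this
        simp [← ht, -relGrad_inr, this]
      have hc := h.crit x' hx' hw'
      have : ∀ k, relGrad f x (Sum.inr k) = 0 := fun k => congrFun hw k
      simp [legendreForm_apply, hc, this, -relGrad_inr]) hx rfl
  rw [h.eq_zero x₀ hx₀ hx₀z, legendre_eq_of_inr (x := 0) (by rw [h.relGrad_zero]; rfl), h.map_zero] at hle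
  simpa using hle

theorem exists_legendre_le (h : IsCritCover f N r) :
    ∃ C > 0, ∀ x ∈ N, ‖legendre f x‖ ≤ C * ‖relGrad f x ∘ Sum.inr‖ := by
  obtain ⟨C, hC⟩ := h.bounded
  have hC0 : 0 ≤ C := (norm_nonneg _).trans (hC 0 h.zero_mem)
  refine ⟨Fintype.card X * C + 1, by positivity, fun x hx => ?_⟩
  have := legendre_add_le (y := 0) h.proper rfl h.analytic (fun x hx => h.legendre_eq_zero hx)
    (ε := C) (fun x hx => by simpa using hC x hx) hx
  simp only [Pi.zero_apply, zero_mul, Finset.sum_const_zero, add_zero] at this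
  nlinarith [norm_nonneg (relGrad f x ∘ Sum.inr)]

theorem eventually_legendre_add_le (h : IsCritCover f N r) {y : T ⊕ X → ℂ} (hy : y ∈ N)
    (hyw : relGrad f y ∘ Sum.inr = 0) {ε : ℝ} (hε : 0 < ε) :
    ∀ᶠ x in 𝓝 y, ‖legendre f x + ∑ k, y (Sum.inr k) * relGrad f x (Sum.inr k)‖ ≤
      ε * ‖relGrad f x ∘ Sum.inr‖ := by
  set ε' := ε / (Fintype.card X + 1) with hε'
  have hε'0 : 0 < ε' := by positivity
  obtain ⟨ρ, hρ, hρN, hiso⟩ := h.proper.exists_isolating hy Metric.isOpen_ball (Metric.mem_ball_self hε'0)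
  obtain ⟨δ, hδ, hδP⟩ := exists_properNhd h.proper.analytic hρ (hρN.trans inter_subset_left) hiso
  have hP := hδP δ hδ le_rfl
  have hsub : Metric.ball y ρ ∩ relGrad f ⁻¹' Metric.ball (relGrad f y) δ ⊆ N :=
    fun x hx => (hρN (Metric.ball_subset_closedBall hx.1)).1
  filter_upwards [hP.isOpen_source.mem_nhds ⟨Metric.mem_ball_self hρ, Metric.mem_ball_self hδ⟩] with x hx
  have := legendre_add_le (y := y) hP hyw (h.analytic.mono hsub)
    (fun x hx => h.legendre_eq_zero (hsub hx)) (ε := ε') (fun x hx => by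
      have := (hρN (Metric.ball_subset_closedBall hx.1)).2
      rw [mem_ball_iff_norm] at this
      exact this.le) hx
  refine this.trans ?_
  rw [← mul_assoc]
  gcongr
  rw [hε', mul_div_assoc', div_le_iff₀ (by positivity)]
  nlinarith

theorem eventually_norm_le (h : IsCritCover f N r) {y : T ⊕ X → ℂ} (hy : y ∈ N)
    (hyw : relGrad f y ∘ Sum.inr = 0) {ε : ℝ} (hε : 0 < ε) :
    ∀ᶠ x in 𝓝 y, ‖f x‖ ≤ ε * ‖relGrad f x ∘ Sum.inr‖ := by
  set ε' := ε / 2 / (Fintype.card X + 1) with hε'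
  have hε'0 : 0 < ε' := by positivity
  filter_upwards [h.eventually_legendre_add_le hy hyw (half_pos hε), Metric.ball_mem_nhds y hε'0] with x hx hxy
  have h1 : f x = (legendre f x + ∑ k, y (Sum.inr k) * relGrad f x (Sum.inr k)) +
      ∑ k, ((x - y) ∘ Sum.inr) k * (relGrad f x ∘ Sum.inr) k := by
    simp only [legendre, Function.comp_apply, Pi.sub_apply, sub_mul, Finset.sum_sub_distrib, relGrad_inr]
    ring
  rw [h1]
  refine (norm_add_le _ _).trans ?_
  have h2 := norm_sum_mul_le ((x - y) ∘ Sum.inr) (relGrad f x ∘ Sum.inr) (A := ε')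
    ((norm_comp_inr_le _).trans (mem_ball_iff_norm.1 hxy).le) le_rfl
  have h3 : Fintype.card X * ε' ≤ ε / 2 := by
    rw [hε', mul_div_assoc', div_le_iff₀ (by positivity)]
    nlinarith
  have h4 := mul_le_mul_of_nonneg_right h3 (norm_nonneg (relGrad f x ∘ Sum.inr))
  linarith

end IsCritCover

end

section

section Integrals

variable {E : Type*} [NormedAddCommGroup E] [NormedSpace ℂ E]

/-- Cauchy's bound for the derivative of a bounded holomorphic function. -/
theorem norm_fderiv_le_of_forall_norm_le {g : E → ℂ} {z : E} {ρ M : ℝ} (hρ : 0 < ρ)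
    (hg : DifferentiableOn ℂ g (Metric.ball z ρ)) (hM : ∀ x ∈ Metric.ball z ρ, ‖g x‖ ≤ M) :
    ‖fderiv ℂ g z‖ ≤ 2 * M / ρ := by
  refine Complex.norm_fderiv_le_div_of_mapsTo_ball hg (fun x hx => ?_) hρ
  rw [mem_closedBall_iff_norm]
  have h1 := hM x hx
  have h2 := hM z (Metric.mem_ball_self hρ)
  linarith [norm_sub_le (g x) (g z)]

/-- An integral depending holomorphically on a parameter is holomorphic. -/
theorem differentiableOn_intervalIntegral [ProperSpace E] {O : Set E} (hO : IsOpen O) {G : E → ℝ → ℂ}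
    (hG : ContinuousOn (Function.uncurry G) (O ×ˢ univ)) (hd : ∀ t, DifferentiableOn ℂ (fun z => G z t) O)
    (a b : ℝ) : DifferentiableOn ℂ (fun z => ∫ t in a..b, G z t) O := by
  intro z₀ hz₀
  obtain ⟨ρ', hρ', hρ'O⟩ := Metric.isOpen_iff.1 hO z₀ hz₀
  set ρ := ρ' / 4 with hρdef
  have hρ : 0 < ρ := by positivity
  have hsub : Metric.closedBall z₀ (2 * ρ) ⊆ O :=
    (Metric.closedBall_subset_ball (by rw [hρdef]; linarith)).trans hρ'O
  have hat : ∀ z ∈ O, ∀ t, ContinuousAt (Function.uncurry G) (z, t) := fun z hz t =>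
    hG.continuousAt ((hO.prod isOpen_univ).mem_nhds ⟨hz, mem_univ t⟩)
  have hcont : ∀ z ∈ O, Continuous (G z) := fun z hz => continuous_iff_continuousAt.2 fun t =>
    (hat z hz t).comp (f := fun t => (z, t)) (by fun_prop)
  obtain ⟨M, hM⟩ := ((isCompact_closedBall z₀ (2 * ρ)).prod (isCompact_uIcc (a := a) (b := b))).exists_bound_of_continuousOn
    (hG.mono (prod_mono hsub (subset_univ _)))
  have hbs : ∀ z ∈ Metric.ball z₀ ρ, Metric.ball z ρ ⊆ Metric.closedBall z₀ (2 * ρ) := by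
    intro z hz x hx
    have h1 := dist_triangle x z z₀
    rw [Metric.mem_ball] at hz hx
    rw [Metric.mem_closedBall]
    linarith
  have hF'c : Continuous fun t => fderiv ℂ (fun z => G z t) z₀ := by
    refine continuous_iff_continuousAt.2 fun t₀ => Metric.tendsto_nhds.2 fun ε hε => ?_
    have hev : ∀ᶠ t in 𝓝 t₀, ∀ z ∈ Metric.closedBall z₀ ρ, ‖G z t - G z t₀‖ < ε * ρ / 4 := by
      refine (isCompact_closedBall z₀ ρ).eventually_forall_of_forall_eventually fun z hz => ?_
      have hzO : z ∈ O := hsub (Metric.closedBall_subset_closedBall (by linarith) hz)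
      have : ContinuousAt (fun p : ℝ × E => ‖G p.2 p.1 - G p.2 t₀‖) (t₀, z) := by
        refine ContinuousAt.norm (ContinuousAt.sub ?_ ?_)
        · exact (hat z hzO t₀).comp (f := fun p : ℝ × E => (p.2, p.1)) (x := (t₀, z)) (by fun_prop)
        · exact (hat z hzO t₀).comp (f := fun p : ℝ × E => (p.2, t₀)) (x := (t₀, z)) (by fun_prop)
      exact this.eventually_lt_const (by simpa using by positivity)
    filter_upwards [hev] with t ht
    have hdz : ∀ t, DifferentiableAt ℂ (fun z => G z t) z₀ := fun t => (hd t).differentiableAt (hO.mem_nhds hz₀)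
    rw [dist_eq_norm, ← fderiv_fun_sub (hdz t) (hdz t₀)]
    refine (norm_fderiv_le_of_forall_norm_le hρ (M := ε * ρ / 4) ?_ fun x hx =>
      (ht x (Metric.ball_subset_closedBall hx)).le).trans_lt ?_
    · refine ((hd t).sub (hd t₀)).mono fun x hx => hsub (Metric.closedBall_subset_closedBall (by linarith)
        (Metric.ball_subset_closedBall hx))
    · rw [div_lt_iff₀ hρ]
      nlinarith [mul_pos hε hρ]
  refine (intervalIntegral.hasFDerivAt_integral_of_dominated_of_fderiv_le (𝕜 := ℂ)
    (F' := fun z t => fderiv ℂ (fun z => G z t) z) (bound := fun _ => 2 * M / ρ)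
    (Metric.ball_mem_nhds z₀ hρ) ?_ ((hcont z₀ hz₀).intervalIntegrable _ _) hF'c.aestronglyMeasurable
    ?_ (by simp) ?_).differentiableAt.differentiableWithinAt
  · filter_upwards [hO.mem_nhds hz₀] with z hz using (hcont z hz).aestronglyMeasurable
  · refine ae_of_all _ fun t ht z hz => norm_fderiv_le_of_forall_norm_le hρ
      ((hd t).mono ((hbs z hz).trans hsub)) fun x hx => hM (x, t) ⟨hbs z hz hx, uIoc_subset_uIcc ht⟩
  · refine ae_of_all _ fun t _ z hz => ((hd t).differentiableAt (hO.mem_nhds (hsub ?_))).hasFDerivAt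
    exact Metric.closedBall_subset_closedBall (by linarith) (Metric.ball_subset_closedBall hz)

/-- An integral depending continuously on a parameter is continuous. -/
theorem continuousOn_intervalIntegral {P : Type*} [TopologicalSpace P] [FirstCountableTopology P] {O : Set P}
    {G : P → ℝ → ℂ} (hG : ContinuousOn (Function.uncurry G) (O ×ˢ univ)) (a b : ℝ) :
    ContinuousOn (fun z => ∫ t in a..b, G z t) O := by
  rw [continuousOn_iff_continuous_domRestrict]
  refine intervalIntegral.continuous_parametric_intervalIntegral_of_continuous' (f := fun (z : O) t => G z t) ?_ a b
  have : Continuous fun q : O × ℝ => (⟨(q.1, q.2), q.1.2, mem_univ _⟩ : ↥(O ×ˢ (univ : Set ℝ))) := by fun_prop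
  exact (continuousOn_iff_continuous_domRestrict.1 hG).comp this

end Integrals

section Hartogs

variable {ι : Type*} [Fintype ι] [DecidableEq ι]

/-- Extension of a holomorphic function from a shell across a box by the Cauchy integral. -/
theorem exists_extension {c : (ι → ℂ) → ℂ} {U V : Set (ι → ℂ)} (hc : DifferentiableOn ℂ c U)
    (hV : IsOpen V) (j : ι) {R : ℝ} (hR : 0 < R) (hVR : ∀ z ∈ V, ‖z j‖ < R)
    (hshell : ∀ z ∈ V, ∀ τ : ℂ, ‖τ‖ = R → Function.update z j τ ∈ U) :
    ∃ g : (ι → ℂ) → ℂ, DifferentiableOn ℂ g V ∧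
      ∀ z ∈ V, (∀ τ : ℂ, ‖τ‖ ≤ R → Function.update z j τ ∈ U) → g z = c z := by
  refine ⟨fun z => (2 * Real.pi * Complex.I : ℂ)⁻¹ • ∮ τ in C(0, R), (τ - z j)⁻¹ • c (Function.update z j τ), ?_, ?_⟩
  · suffices H : DifferentiableOn ℂ (fun z : ι → ℂ => ∮ τ in C(0, R), (τ - z j)⁻¹ • c (Function.update z j τ)) V from
      H.const_smul (2 * Real.pi * Complex.I : ℂ)⁻¹
    have hne : ∀ z ∈ V, ∀ t : ℝ, circleMap 0 R t - z j ≠ 0 := by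
      intro z hz t h0
      have := hVR z hz
      rw [← sub_eq_zero.1 h0, norm_circleMap_zero, abs_of_pos hR] at this
      exact lt_irrefl _ this
    have hup : ∀ τ, Differentiable ℂ fun z : ι → ℂ => Function.update z j τ := by
      intro τ
      rw [differentiable_pi]
      intro i
      by_cases h : i = j
      · subst h; simp
      · simp only [Function.update_of_ne h]; fun_prop
    refine differentiableOn_intervalIntegral hV ?_ ?_ _ _
    · have h1 : ContinuousOn (fun q : (ι → ℂ) × ℝ => c (Function.update q.1 j (circleMap 0 R q.2))) (V ×ˢ univ) := by
        refine hc.continuousOn.comp (Continuous.continuousOn ?_) fun q hq => hshell q.1 hq.1 _ (by simp [abs_of_pos hR])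
        exact continuous_fst.update j ((continuous_circleMap 0 R).comp continuous_snd)
      have h2 : ContinuousOn (fun q : (ι → ℂ) × ℝ => (circleMap 0 R q.2 - q.1 j)⁻¹) (V ×ˢ univ) := by
        refine ContinuousOn.inv₀ (Continuous.continuousOn ?_) fun q hq => hne q.1 hq.1 _
        have := (continuous_circleMap 0 R).comp (continuous_snd (X := ι → ℂ))
        fun_prop
      have h3 : ContinuousOn (fun q : (ι → ℂ) × ℝ => deriv (circleMap 0 R) q.2) (V ×ˢ univ) := by
        refine Continuous.continuousOn ?_
        simp only [deriv_circleMap]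
        have := (continuous_circleMap 0 R).comp (continuous_snd (X := ι → ℂ))
        fun_prop
      exact h3.smul (h2.smul h1)
    · intro t
      have h1 : DifferentiableOn ℂ (fun z : ι → ℂ => (circleMap 0 R t - z j)⁻¹) V :=
        DifferentiableOn.inv (by fun_prop) fun z hz => hne z hz t
      have h2 : DifferentiableOn ℂ (fun z : ι → ℂ => c (Function.update z j (circleMap 0 R t))) V :=
        hc.comp (hup _).differentiableOn fun z hz => hshell z hz _ (by simp [abs_of_pos hR])
      exact (h1.smul h2).const_smul (deriv (circleMap 0 R) t)
  · intro z hz hzU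
    have hd : DiffContOnCl ℂ (fun τ => c (Function.update z j τ)) (Metric.ball 0 R) := by
      refine DifferentiableOn.diffContOnCl ?_
      rw [closure_ball _ hR.ne']
      refine hc.comp (Differentiable.differentiableOn ?_) fun τ hτ => hzU τ (by simpa using hτ)
      rw [differentiable_pi]
      intro i
      by_cases h : i = j
      · subst h; simp
      · simp only [Function.update_of_ne h]; fun_prop
    have := hd.two_pi_i_inv_smul_circleIntegral_sub_inv_smul (w := z j) (by simpa using hVR z hz)
    simpa using this

end Hartogs

/-- The locus in the base over which the fibre lies in an open set contains a neighborhood of each compact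
set which it contains. -/
theorem IsProperHol.exists_thickening {ι : Type*} [Fintype ι] [DecidableEq ι] {Φ : (ι → ℂ) → ι → ℂ}
    {N V : Set (ι → ℂ)} (hP : IsProperHol Φ N V) {K O : Set (ι → ℂ)}
    (hK : IsCompact K) (hKV : K ⊆ V) (hO : IsOpen O) (h : ∀ x ∈ N, Φ x ∈ K → x ∈ O) :
    ∃ ε > 0, Metric.thickening ε K ⊆ V ∧ ∀ x ∈ N, Φ x ∈ Metric.thickening ε K → x ∈ O := by
  obtain ⟨ε, hε, hs⟩ := hK.exists_thickening_subset_open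
    (isOpen_interior (s := {z | z ∈ V ∧ ∀ x ∈ N, Φ x = z → x ∈ O})) (by
      intro z hz
      obtain ⟨r, hr, hrV, hrO⟩ := hP.exists_ball (hKV hz) hO fun x hx hxz => h x hx (hxz ▸ hz)
      rw [mem_interior_iff_mem_nhds]
      filter_upwards [Metric.ball_mem_nhds z hr] with w hw
      exact ⟨hrV hw, fun x hx hxw => hrO x hx (hxw ▸ hw)⟩)
  have hs' : Metric.thickening ε K ⊆ {z | z ∈ V ∧ ∀ x ∈ N, Φ x = z → x ∈ O} := hs.trans interior_subset
  exact ⟨ε, hε, fun z hz => (hs' hz).1, fun x hx hxz => (hs' hxz).2 x hx rfl⟩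

end

section

section Division

open Asymptotics

/-- Dividing a holomorphic function by a power. -/
theorem exists_eq_pow_mul {R : ℝ} (hR : 0 < R) (k : ℕ) {n : ℂ → ℂ} (hn : DifferentiableOn ℂ n (Metric.ball 0 R))
    (hO : n =O[𝓝[≠] 0] fun l : ℂ => l ^ k) :
    ∃ g : ℂ → ℂ, DifferentiableOn ℂ g (Metric.ball 0 R) ∧ ∀ l ∈ Metric.ball (0 : ℂ) R, n l = l ^ k * g l := by
  induction k generalizing n with
  | zero => exact ⟨n, hn, by simp⟩
  | succ k ih =>
    have hmem : Metric.ball (0 : ℂ) R ∈ 𝓝 0 := Metric.ball_mem_nhds _ hR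
    have h0 : n 0 = 0 := by
      have h1 : Tendsto n (𝓝[≠] 0) (𝓝 (n 0)) :=
        ((hn.differentiableAt hmem).continuousAt.tendsto).mono_left nhdsWithin_le_nhds
      have h2 : Tendsto (fun l : ℂ => l ^ (k + 1)) (𝓝[≠] 0) (𝓝 0) := by
        have : Continuous fun l : ℂ => l ^ (k + 1) := by fun_prop
        simpa using (this.tendsto 0).mono_left nhdsWithin_le_nhds
      exact tendsto_nhds_unique h1 (hO.trans_tendsto h2)
    have hds : ∀ l, n l = l * dslope n 0 l := fun l => by
      have := sub_smul_dslope n 0 l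
      simpa [h0] using this.symm
    obtain ⟨g, hg, hgn⟩ := ih (n := dslope n 0) ((Complex.differentiableOn_dslope hmem).2 hn) (by
      obtain ⟨C, hC⟩ := hO.bound
      refine IsBigO.of_bound C ?_
      filter_upwards [hC, self_mem_nhdsWithin] with l hl hl0
      have hl0' : 0 < ‖l‖ := norm_pos_iff.2 hl0
      rw [hds l, norm_mul, pow_succ', norm_mul, mul_left_comm] at hl
      exact le_of_mul_le_mul_left hl hl0')
    exact ⟨g, hg, fun l hl => by rw [hds l, hgn l hl, pow_succ']; ring⟩

variable {P : Type*} [TopologicalSpace P] [FirstCountableTopology P] {S : Set P} {n : P → ℂ → ℂ} {R R' : ℝ}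

/-- Dividing a family of holomorphic functions by a power. -/
theorem exists_family_eq_pow_mul (hR : 0 < R) (hRR' : R < R') (k : ℕ)
    (hn : ContinuousOn (Function.uncurry n) (S ×ˢ Metric.ball 0 R'))
    (hd : ∀ p ∈ S, DifferentiableOn ℂ (n p) (Metric.ball 0 R')) :
    ∃ h : P → ℂ → ℂ, ContinuousOn (Function.uncurry h) (S ×ˢ Metric.ball 0 R) ∧
      ∀ p ∈ S, (n p) =O[𝓝[≠] 0] (fun l : ℂ => l ^ k) → DifferentiableOn ℂ (h p) (Metric.ball 0 R) ∧
        ∀ l ∈ Metric.ball (0 : ℂ) R, n p l = l ^ k * h p l := by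
  refine ⟨fun p l => (2 * Real.pi * Complex.I : ℂ)⁻¹ • ∮ z in C(0, R), (z - l)⁻¹ • (n p z / z ^ k), ?_, ?_⟩
  · have hne : ∀ l ∈ Metric.ball (0 : ℂ) R, ∀ t : ℝ, circleMap 0 R t - l ≠ 0 := by
      intro l hl t h0
      rw [mem_ball_zero_iff, ← sub_eq_zero.1 h0, norm_circleMap_zero, abs_of_pos hR] at hl
      exact lt_irrefl _ hl
    have hI : ContinuousOn (fun q : P × ℂ => ∮ z in C(0, R), (z - q.2)⁻¹ • (n q.1 z / z ^ k))
        (S ×ˢ Metric.ball 0 R) := by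
      refine continuousOn_intervalIntegral ?_ _ _
      have hcm := (continuous_circleMap 0 R).comp (continuous_snd (X := P × ℂ))
      have h1 : ContinuousOn (fun q : (P × ℂ) × ℝ => n q.1.1 (circleMap 0 R q.2)) ((S ×ˢ Metric.ball 0 R) ×ˢ univ) :=
        hn.comp (f := fun q : (P × ℂ) × ℝ => (q.1.1, circleMap 0 R q.2))
          (Continuous.continuousOn (by exact (by fun_prop : Continuous fun q : (P × ℂ) × ℝ => q.1.1).prodMk hcm))
          fun q hq => ⟨hq.1.1, by simpa [abs_of_pos hR] using hRR'⟩
      have h2 : ContinuousOn (fun q : (P × ℂ) × ℝ => (circleMap 0 R q.2 - q.1.2)⁻¹) ((S ×ˢ Metric.ball 0 R) ×ˢ univ) := by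
        refine ContinuousOn.inv₀ (Continuous.continuousOn ?_) fun q hq => hne q.1.2 hq.1.2 _
        exact hcm.sub (by fun_prop)
      have h3 : Continuous fun q : (P × ℂ) × ℝ => deriv (circleMap 0 R) q.2 := by
        simp only [deriv_circleMap]
        exact hcm.mul continuous_const
      have h4 : ContinuousOn (fun q : (P × ℂ) × ℝ => n q.1.1 (circleMap 0 R q.2) / circleMap 0 R q.2 ^ k)
          ((S ×ˢ Metric.ball 0 R) ×ˢ univ) :=
        h1.div (hcm.pow k).continuousOn fun q _ => pow_ne_zero _ (by simp [hR.ne'])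
      exact h3.continuousOn.smul (h2.smul h4)
    exact hI.const_smul (2 * Real.pi * Complex.I : ℂ)⁻¹
  · intro p hp hO
    obtain ⟨g, hg, hgn⟩ := exists_eq_pow_mul (hR.trans hRR') k (hd p hp) hO
    have key : ∀ l ∈ Metric.ball (0 : ℂ) R,
        (2 * Real.pi * Complex.I : ℂ)⁻¹ • ∮ z in C(0, R), (z - l)⁻¹ • (n p z / z ^ k) = g l := by
      intro l hl
      have hd' : DiffContOnCl ℂ g (Metric.ball 0 R) := by
        refine DifferentiableOn.diffContOnCl (hg.mono ?_)
        rw [closure_ball _ hR.ne']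
        exact Metric.closedBall_subset_ball hRR'
      rw [← hd'.two_pi_i_inv_smul_circleIntegral_sub_inv_smul hl]
      congr 1
      refine circleIntegral.integral_congr hR.le fun z hz => ?_
      have hz' : ‖z‖ = R := by simpa using hz
      have hz0 : z ≠ 0 := by rw [← norm_pos_iff, hz']; exact hR
      rw [hgn z (by simpa [hz'] using hRR'), mul_div_cancel_left₀ _ (pow_ne_zero _ hz0)]
    refine ⟨(hg.mono (Metric.ball_subset_ball hRR'.le)).congr key, fun l hl => ?_⟩
    beta_reduce
    rw [key l hl, hgn l (Metric.ball_subset_ball hRR'.le hl)]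

/-- A family of holomorphic functions divisible by a power for a dense set of parameters is
divisible. -/
theorem exists_family_eq_pow_mul_of_frequently (hR : 0 < R) (hRR' : R < R') (k : ℕ)
    (hn : ContinuousOn (Function.uncurry n) (S ×ˢ Metric.ball 0 R'))
    (hd : ∀ p ∈ S, DifferentiableOn ℂ (n p) (Metric.ball 0 R'))
    (hO : ∀ p ∈ S, ∃ᶠ p' in 𝓝[S] p, (n p') =O[𝓝[≠] 0] (fun l : ℂ => l ^ k)) :
    ∃ h : P → ℂ → ℂ, ContinuousOn (Function.uncurry h) (S ×ˢ Metric.ball 0 R) ∧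
      ∀ p ∈ S, ∀ l ∈ Metric.ball (0 : ℂ) R, n p l = l ^ k * h p l := by
  obtain ⟨h, hh, hnh⟩ := exists_family_eq_pow_mul hR hRR' k hn hd
  refine ⟨h, hh, fun p hp l hl => ?_⟩
  by_contra hne
  have h1 : ContinuousWithinAt (fun p => n p l) S p :=
    (hn.comp (f := fun p => (p, l)) (by fun_prop)
      fun p hp => ⟨hp, Metric.ball_subset_ball hRR'.le hl⟩) p hp
  have h2 : ContinuousWithinAt (fun p => h p l) S p :=
    (hh.comp (f := fun p => (p, l)) (by fun_prop) fun p hp => ⟨hp, hl⟩) p hp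
  have h3 : ContinuousWithinAt (fun p => n p l - l ^ k * h p l) S p :=
    h1.sub (continuousWithinAt_const.mul h2)
  have h4 : ∀ᶠ p' in 𝓝[S] p, n p' l - l ^ k * h p' l ≠ 0 := h3.eventually_ne (sub_ne_zero.2 hne)
  obtain ⟨p', hp'O, hp'n, hp'S⟩ := ((hO p hp).and_eventually (h4.and self_mem_nhdsWithin)).exists
  exact hp'n (sub_eq_zero.2 ((hnh p' hp'S hp'O).2 l hl))

/-- A family of holomorphic functions of one variable vanishes, generically, at most at the origin near
the origin. -/
theorem exists_ball_ne_zero {n : ℂ → ℂ → ℂ} {ρ : ℝ} (hρ : 0 < ρ) (hR : 0 < R)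
    (hn : ContinuousOn (Function.uncurry n) (Metric.ball 0 ρ ×ˢ Metric.ball 0 R))
    (hd : ∀ p ∈ Metric.ball 0 ρ, DifferentiableOn ℂ (n p) (Metric.ball 0 R))
    {l : ℂ} (hl : l ∈ Metric.ball (0 : ℂ) R) (hnl : n 0 l ≠ 0) :
    ∃ ζ : ℂ, ∃ s > 0, Metric.closedBall ζ s ⊆ Metric.ball 0 ρ ∧
      ∀ ζ' ∈ Metric.closedBall ζ s, ∀ l : ℂ, l ≠ 0 → ‖l‖ < s → n ζ' l ≠ 0 := by
  have hmem : Metric.ball (0 : ℂ) R ∈ 𝓝 0 := Metric.ball_mem_nhds _ hR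
  have hex : ∃ k, ∃ ζ ∈ Metric.ball (0 : ℂ) ρ, ¬ (n ζ) =O[𝓝[≠] 0] fun l : ℂ => l ^ (k + 1) := by
    have h0 := hd 0 (Metric.mem_ball_self hρ)
    have han : AnalyticOnNhd ℂ (n 0) (Metric.ball 0 R) := h0.analyticOnNhd Metric.isOpen_ball
    have hnz : ¬ ∀ᶠ z in 𝓝 (0 : ℂ), n 0 z = 0 := fun hz =>
      hnl (han.eqOn_zero_of_preconnected_of_eventuallyEq_zero (convex_ball _ _).isPreconnected
        (Metric.mem_ball_self hR) hz hl)
    obtain ⟨k, g, hg, hg0, hgn⟩ := (han 0 (Metric.mem_ball_self hR)).exists_eventuallyEq_pow_smul_nonzero_iff.2 hnz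
    refine ⟨k, 0, Metric.mem_ball_self hρ, fun hO => hg0 ?_⟩
    obtain ⟨C, hC⟩ := hO.bound
    have h1 : Tendsto g (𝓝[≠] 0) (𝓝 (g 0)) := hg.continuousAt.tendsto.mono_left nhdsWithin_le_nhds
    have h2 : g =O[𝓝[≠] 0] fun l : ℂ => l := by
      refine IsBigO.of_bound C ?_
      filter_upwards [hC, self_mem_nhdsWithin, eventually_nhdsWithin_of_eventually_nhds hgn] with l hl hl0 hgl
      have hl0' : 0 < ‖l‖ ^ k := pow_pos (norm_pos_iff.2 hl0) k
      rw [hgl, sub_zero, norm_smul, norm_pow, norm_pow, pow_succ, mul_left_comm] at hl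
      exact le_of_mul_le_mul_left hl hl0'
    exact tendsto_nhds_unique h1 (h2.trans_tendsto (tendsto_id.mono_left nhdsWithin_le_nhds))
  classical
  obtain ⟨ζ, hζ, hζn⟩ := Nat.find_spec hex
  set k := Nat.find hex with hk
  have hall : ∀ ζ ∈ Metric.ball (0 : ℂ) ρ, (n ζ) =O[𝓝[≠] 0] fun l : ℂ => l ^ k := by
    intro ζ hζ
    rcases hk' : k with _ | m
    · simp only [pow_zero]
      exact (((hd ζ hζ).differentiableAt hmem).continuousAt.tendsto.mono_left nhdsWithin_le_nhds).isBigO_one ℂ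
    · have := Nat.find_min hex (m := m) (by omega)
      push Not at this
      exact this ζ hζ
  obtain ⟨h, hh, hnh⟩ := exists_family_eq_pow_mul (R := R / 2) (by positivity) (by linarith) k hn hd
  have hmem2 : Metric.ball (0 : ℂ) (R / 2) ∈ 𝓝 0 := Metric.ball_mem_nhds _ (by positivity)
  have hζ0 : h ζ 0 ≠ 0 := by
    intro h0
    refine hζn ?_
    obtain ⟨hdiff, heq⟩ := hnh ζ hζ (hall ζ hζ)
    have h1 := (hdiff.differentiableAt hmem2).hasDerivAt.differentiableAt.isBigO_sub
    simp only [h0, sub_zero] at h1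
    have h2 : (fun l : ℂ => l ^ k * h ζ l) =O[𝓝 0] fun l : ℂ => l ^ k * l := (isBigO_refl _ _).mul h1
    refine (h2.mono nhdsWithin_le_nhds).congr' ?_ ?_
    · filter_upwards [mem_nhdsWithin_of_mem_nhds hmem2] with l hl using (heq l hl).symm
    · exact Eventually.of_forall fun l => (pow_succ l k).symm
  have hat : ContinuousAt (Function.uncurry h) (ζ, 0) :=
    hh.continuousAt ((Metric.isOpen_ball.prod Metric.isOpen_ball).mem_nhds ⟨hζ, Metric.mem_ball_self (by positivity)⟩)
  have hev : ∀ᶠ q in 𝓝 (ζ, (0 : ℂ)), Function.uncurry h q ≠ 0 ∧ q ∈ Metric.ball (0 : ℂ) ρ ×ˢ Metric.ball (0 : ℂ) (R / 2) :=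
    (hat.eventually_ne hζ0).and
      ((Metric.isOpen_ball.prod Metric.isOpen_ball).mem_nhds ⟨hζ, Metric.mem_ball_self (by positivity)⟩)
  obtain ⟨s, hs, hsub⟩ := Metric.eventually_nhds_iff_ball.1 hev
  refine ⟨ζ, s / 2, by positivity, fun ζ' hζ' => ?_, fun ζ' hζ' l hl0 hl => ?_⟩
  · refine (hsub (ζ', 0) ?_).2.1
    rw [Metric.mem_ball, Prod.dist_eq]
    rw [Metric.mem_closedBall] at hζ'
    simpa [hs] using (by linarith : dist ζ' ζ < s)
  · have hq := hsub (ζ', l) (by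
      rw [Metric.mem_ball, Prod.dist_eq]
      rw [Metric.mem_closedBall] at hζ'
      simpa using ⟨by linarith, by linarith⟩)
    rw [(hnh ζ' hq.2.1 (hall ζ' hq.2.1)).2 l hq.2.2]
    exact mul_ne_zero (pow_ne_zero _ hl0) hq.1

end Division

section Roots

variable {μ : ℕ}

theorem norm_coeff_le_of_isRoot {c : ℕ → ℂ} {B : ℝ} (h : ∀ t, (monicPoly μ c).IsRoot t → ‖t‖ ≤ B) {i : ℕ}
    (hi : i < μ) : ‖c i‖ ≤ B ^ (μ - i) * μ.choose i := by
  have := Polynomial.coeff_le_of_roots_le (p := monicPoly μ c) (f := RingHom.id ℂ) i (monic_monicPoly μ c)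
    (IsAlgClosed.splits _) (fun t ht => h t (by simpa using (Polynomial.mem_roots'.1 ht).2))
  simpa [natDegree_monicPoly, coeff_monicPoly μ c hi] using this

theorem pow_le_norm_eval {c : ℕ → ℂ} {δ : ℝ} (hδ : 0 ≤ δ) {q : ℂ}
    (h : ∀ t, (monicPoly μ c).IsRoot t → δ ≤ ‖q - t‖) : δ ^ μ ≤ ‖(monicPoly μ c).eval q‖ := by
  have hs := IsAlgClosed.splits (monicPoly μ c)
  have hcard : (monicPoly μ c).roots.card = μ := by
    rw [← hs.natDegree_eq_card_roots, natDegree_monicPoly]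
  rw [hs.eval_eq_prod_roots_of_monic (monic_monicPoly μ c)]
  have : ∀ s : Multiset ℂ, (∀ t ∈ s, δ ≤ ‖q - t‖) → δ ^ s.card ≤ ‖(s.map fun t => q - t).prod‖ := by
    intro s
    induction s using Multiset.induction_on with
    | empty => simp
    | cons a s ih =>
      intro hs
      rw [Multiset.card_cons, Multiset.map_cons, Multiset.prod_cons, norm_mul, pow_succ']
      exact mul_le_mul (hs a (by simp)) (ih fun t ht => hs t (by simp [ht])) (by positivity) (norm_nonneg _)
  have := this (monicPoly μ c).roots fun t ht => h t (Polynomial.mem_roots'.1 ht).2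
  rwa [hcard] at this

theorem norm_le_of_isRoot {c : ℕ → ℂ} {q : ℂ} (hq : (monicPoly μ c).IsRoot q) :
    ‖q‖ ≤ 1 + ∑ i ∈ Finset.range μ, ‖c i‖ := by
  have hS : 0 ≤ ∑ i ∈ Finset.range μ, ‖c i‖ := Finset.sum_nonneg fun _ _ => norm_nonneg _
  by_contra! hlt
  have hq1 : 1 < ‖q‖ := by linarith
  rw [Polynomial.IsRoot, eval_monicPoly] at hq
  rcases μ with _ | m
  · simp at hq
  have h1 : q ^ (m + 1) = - ∑ j ∈ Finset.range (m + 1), c j * q ^ j := eq_neg_of_add_eq_zero_left hq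
  have h2 : ‖q‖ * ‖q‖ ^ m ≤ (∑ i ∈ Finset.range (m + 1), ‖c i‖) * ‖q‖ ^ m := by
    rw [← pow_succ', ← norm_pow, h1, norm_neg, Finset.sum_mul]
    refine norm_sum_le_of_le _ fun j hj => ?_
    rw [norm_mul, norm_pow]
    gcongr
    · exact hq1.le
    · have := Finset.mem_range.1 hj; omega
  have := le_of_mul_le_mul_right h2 (by positivity)
  linarith

/-- The roots of a monic polynomial depend continuously on the coefficients. -/
theorem eventually_roots_near {α : Type*} {l : Filter α} {c : α → ℕ → ℂ} {c₀ : ℕ → ℂ}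
    (hc : ∀ i < μ, Tendsto (fun a => c a i) l (𝓝 (c₀ i))) {δ : ℝ} (hδ : 0 < δ) :
    ∀ᶠ a in l, (∀ q, (monicPoly μ (c a)).IsRoot q → ∃ t, (monicPoly μ c₀).IsRoot t ∧ ‖q - t‖ < δ) ∧
      ∀ t, (monicPoly μ c₀).IsRoot t → ∃ q, (monicPoly μ (c a)).IsRoot q ∧ ‖q - t‖ < δ := by
  set M := 1 + ∑ i ∈ Finset.range μ, (‖c₀ i‖ + 1) with hM
  have hM0 : 0 ≤ M := by positivity
  have hev1 : ∀ᶠ a in l, ∀ i ∈ Finset.range μ, ‖c a i‖ < ‖c₀ i‖ + 1 :=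
    (Finset.range μ).eventually_all.2 fun i hi =>
      (hc i (Finset.mem_range.1 hi)).norm.eventually_lt_const (by linarith)
  have hev2 : ∀ᶠ a in l, ∑ i ∈ Finset.range μ, ‖c a i - c₀ i‖ * M ^ i < δ ^ μ := by
    have : Tendsto (fun a => ∑ i ∈ Finset.range μ, ‖c a i - c₀ i‖ * M ^ i) l
        (𝓝 (∑ i ∈ Finset.range μ, ‖c₀ i - c₀ i‖ * M ^ i)) :=
      tendsto_finsetSum _ fun i hi => (((hc i (Finset.mem_range.1 hi)).sub_const _).norm).mul_const _
    exact this.eventually_lt_const (by simpa using pow_pos hδ μ)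
  filter_upwards [hev1, hev2] with a h1 h2
  have hdiff : ∀ q, ‖q‖ ≤ M → ‖(monicPoly μ (c a)).eval q - (monicPoly μ c₀).eval q‖ < δ ^ μ := by
    intro q hq
    refine lt_of_le_of_lt ?_ h2
    rw [eval_monicPoly, eval_monicPoly, add_sub_add_left_eq_sub, ← Finset.sum_sub_distrib]
    refine norm_sum_le_of_le _ fun i _ => ?_
    rw [← sub_mul, norm_mul, norm_pow]
    gcongr
  constructor
  · intro q hq
    by_contra! hcon
    have hqM : ‖q‖ ≤ M := (norm_le_of_isRoot hq).trans (by
      rw [hM]; gcongr with i hi; exact (h1 i hi).le)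
    have := hdiff q hqM
    rw [hq.eq_zero, zero_sub, norm_neg] at this
    exact absurd this (not_lt.2 (pow_le_norm_eval hδ.le hcon))
  · intro q hq
    by_contra! hcon
    have hqM : ‖q‖ ≤ M := (norm_le_of_isRoot hq).trans (by
      rw [hM]; gcongr with i hi; linarith)
    have := hdiff q hqM
    rw [hq.eq_zero, sub_zero] at this
    exact absurd this (not_lt.2 (pow_le_norm_eval hδ.le fun t ht => by rw [norm_sub_rev]; exact hcon t ht))

end Roots

end

section Blowup

open Asymptotics

variable {T X : Type*} [Fintype T] [DecidableEq T] [Fintype X] [DecidableEq X]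
variable {f : (T ⊕ X → ℂ) → ℂ} {N V : Set (T ⊕ X → ℂ)} {r : ℝ}

/-- The lines transverse to the first coordinate space. -/
def slant (p : (T → ℂ) × (X → ℂ)) (l : ℂ) : T ⊕ X → ℂ := Sum.elim p.1 (l • p.2)

@[simp] theorem slant_inl (p : (T → ℂ) × (X → ℂ)) (l : ℂ) (j : T) : slant p l (Sum.inl j) = p.1 j := rfl

@[simp] theorem slant_inr (p : (T → ℂ) × (X → ℂ)) (l : ℂ) (k : X) : slant p l (Sum.inr k) = l * p.2 k := rfl

theorem slant_comp_inr (p : (T → ℂ) × (X → ℂ)) (l : ℂ) : slant p l ∘ Sum.inr = l • p.2 := rfl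

theorem continuous_slant : Continuous fun q : ((T → ℂ) × (X → ℂ)) × ℂ => slant q.1 q.2 := by
  refine continuous_pi fun i => ?_
  rcases i with j | k
  · simp only [slant_inl]; fun_prop
  · simp only [slant_inr]; fun_prop

theorem differentiable_slant (p : (T → ℂ) × (X → ℂ)) : Differentiable ℂ (slant p) := by
  rw [differentiable_pi]
  rintro (j | k)
  · simp only [slant_inl]; fun_prop
  · simp only [slant_inr]; fun_prop

/-- The parameters of the transverse lines. -/
def slantDom (T X : Type*) [Fintype T] [Fintype X] (r : ℝ) : Set ((T → ℂ) × (X → ℂ)) :=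
  Metric.ball 0 r ×ˢ Metric.ball 0 2

theorem isOpen_slantDom : IsOpen (slantDom T X r) := Metric.isOpen_ball.prod Metric.isOpen_ball

theorem slant_mem {p : (T → ℂ) × (X → ℂ)} (hr : 0 < r) (hp : p ∈ slantDom T X r) {l : ℂ}
    (hl : l ∈ Metric.ball (0 : ℂ) (r / 2)) : slant p l ∈ Metric.ball (0 : T ⊕ X → ℂ) r := by
  have h1 : ‖p.1‖ < r := by simpa using hp.1
  have h2 : ‖p.2‖ < 2 := by simpa using hp.2
  rw [mem_ball_zero_iff] at hl ⊢
  rw [pi_norm_lt_iff hr]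
  rintro (j | k)
  · exact (norm_le_pi_norm p.1 j).trans_lt h1
  · rw [slant_inr, norm_mul]
    have := norm_le_pi_norm p.2 k
    nlinarith [norm_nonneg l, norm_nonneg (p.2 k)]

namespace IsCritCover

theorem frequently_norm_pd_le (h : IsCritCover f N r) (j : T) {p : (T → ℂ) × (X → ℂ)} (hp : p ∈ slantDom T X r) :
    ∃ᶠ p' in 𝓝 p, ∃ C, ∀ᶠ l in 𝓝[≠] (0 : ℂ), ∀ x ∈ N, relGrad f x = slant p' l →
      ‖pd f (Sum.inl j) x‖ ≤ C * ‖l‖ := by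
  have hr := h.pos
  obtain ⟨C, hC0, hC⟩ := h.exists_legendre_le
  obtain ⟨d, hd, hdr⟩ := h.proper.exists_discriminant (convex_ball _ _).isPreconnected
  refine frequently_nhds_iff.2 fun O hpO hO => ?_
  set l₁ : ℂ := ((r / 4 : ℝ) : ℂ) with hl₁
  have hl₁n : ‖l₁‖ = r / 4 := by rw [hl₁, Complex.norm_real, Real.norm_of_nonneg (by positivity)]
  have hl₁0 : l₁ ≠ 0 := by rw [← norm_pos_iff, hl₁n]; positivity
  have hl₁m : l₁ ∈ Metric.ball (0 : ℂ) (r / 2) := by rw [mem_ball_zero_iff, hl₁n]; linarith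
  let inv : (T ⊕ X → ℂ) → (T → ℂ) × (X → ℂ) := fun z => (z ∘ Sum.inl, l₁⁻¹ • (z ∘ Sum.inr))
  have hinv : Continuous inv := by
    have h1 : Continuous fun z : T ⊕ X → ℂ => z ∘ Sum.inl := continuous_pi fun i => continuous_apply _
    have h2 : Continuous fun z : T ⊕ X → ℂ => z ∘ Sum.inr := continuous_pi fun i => continuous_apply _
    exact h1.prodMk (h2.const_smul l₁⁻¹)
  have hinv1 : inv (slant p l₁) = p := by
    refine Prod.ext rfl ?_
    simp only [inv, slant_comp_inr]
    rw [smul_smul, inv_mul_cancel₀ hl₁0, one_smul]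
  have hinv2 : ∀ z, slant (inv z) l₁ = z := by
    intro z
    funext i
    rcases i with j | k
    · rfl
    · simp [inv, hl₁0]
  have hev : ∀ᶠ z in 𝓝 (slant p l₁), inv z ∈ O ∩ slantDom T X r := by
    refine hinv.continuousAt.eventually ?_
    rw [hinv1]
    exact (hO.inter isOpen_slantDom).mem_nhds ⟨hpO, hp⟩
  obtain ⟨z₁, hz₁reg, hz₁⟩ := ((h.proper.dense_regVal (slant p l₁)).and_eventually hev).exists
  set p₁ := inv z₁ with hp₁
  let mv : ℂ → (T → ℂ) × (X → ℂ) := fun ζ => (p₁.1 + ζ • Pi.single j 1, p₁.2)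
  have hmv : Continuous mv := by fun_prop
  have hmv0 : mv 0 = p₁ := by simp [mv]
  obtain ⟨ρ, hρ, hρO⟩ := Metric.isOpen_iff.1 ((hO.inter isOpen_slantDom).preimage hmv) 0 (by
    rw [mem_preimage, hmv0]; exact hz₁)
  have hmvV : ∀ ζ ∈ Metric.ball (0 : ℂ) ρ, ∀ l ∈ Metric.ball (0 : ℂ) (r / 2), slant (mv ζ) l ∈ Metric.ball 0 r :=
    fun ζ hζ l hl => slant_mem hr (hρO hζ).2 hl
  obtain ⟨ζ, s, hs, hsρ, hsn⟩ := exists_ball_ne_zero (n := fun ζ l => d (slant (mv ζ) l)) hρ (half_pos hr)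
    (hd.continuousOn.comp (f := fun q : ℂ × ℂ => slant (mv q.1) q.2)
      (continuous_slant.comp (f := fun q : ℂ × ℂ => (mv q.1, q.2)) (by fun_prop)).continuousOn
      fun q hq => hmvV q.1 hq.1 q.2 hq.2)
    (fun ζ hζ => hd.comp (differentiable_slant _).differentiableOn fun l hl => hmvV ζ hζ l hl) hl₁m (by
      simp only [hmv0]
      rw [hp₁, hinv2]
      have := slant_mem hr hz₁.2 hl₁m
      rw [hinv2] at this
      exact (hdr z₁ this).1 hz₁reg)
  have hζρ : ζ ∈ Metric.ball 0 ρ := hsρ (Metric.mem_closedBall_self hs.le)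
  refine ⟨mv ζ, (hρO hζρ).1, C * 2 / (s / 2), ?_⟩
  have hev1 : ∀ᶠ l in 𝓝[≠] (0 : ℂ), l ≠ 0 := self_mem_nhdsWithin
  have hev2 : ∀ᶠ l in 𝓝[≠] (0 : ℂ), ‖l‖ < s ∧ l ∈ Metric.ball (0 : ℂ) (r / 2) := by
    refine eventually_nhdsWithin_of_eventually_nhds ?_
    filter_upwards [Metric.ball_mem_nhds (0 : ℂ) hs, Metric.ball_mem_nhds (0 : ℂ) (half_pos hr)] with l h1 h2
    exact ⟨by simpa using h1, h2⟩
  filter_upwards [hev1, hev2] with l hl0 hl x hx hxz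
  have hgeq : ∀ t : ℂ, slant (mv ζ) l + t • Pi.single (Sum.inl j) 1 = slant (mv (ζ + t)) l := by
    intro t
    funext i
    rcases i with i | k
    · by_cases hij : i = j
      · subst hij; simp [mv]; ring
      · simp [mv, hij]
    · simp [mv]
  have hζt : ∀ t ∈ Metric.ball (0 : ℂ) s, ζ + t ∈ Metric.closedBall ζ s := fun t ht => by
    rw [mem_closedBall_iff_norm, add_sub_cancel_left]
    exact (mem_ball_zero_iff.1 ht).le
  obtain ⟨σ, hσ0, hσ⟩ := h.proper.exists_section (A := Metric.ball (0 : ℂ) s)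
    (g := fun t => slant (mv ζ) l + t • Pi.single (Sum.inl j) 1)
    Metric.isOpen_ball (convex_ball _ _) (by fun_prop)
    (fun t ht => by rw [hgeq]; exact hmvV _ (hsρ (hζt t ht)) _ hl.2)
    (fun t ht => by
      rw [hgeq]
      exact (hdr _ (hmvV _ (hsρ (hζt t ht)) _ hl.2)).2 (hsn _ (hζt t ht) l hl0 hl.1))
    (Metric.mem_ball_self hs) hx (by simpa using hxz)
  have hder : ∀ t ∈ Metric.ball (0 : ℂ) s, HasDerivAt (fun t => legendre f (σ t)) (pd f (Sum.inl j) (σ t)) t := by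
    intro t ht
    obtain ⟨hσN, hσz, hσd⟩ := hσ t ht
    have hfa := h.analytic _ hσN
    have := hasDerivAt_comp_section (Metric.isOpen_ball.mem_nhds ht) hfa.legendre.differentiableAt
      hfa.relGrad.differentiableAt (fderiv_legendre hfa) hσd fun s hs => (hσ s hs).2.1
    convert this using 1
    rw [legendreForm_apply]
    simp [Pi.single_apply]
  have hbd : ∀ t ∈ Metric.ball (0 : ℂ) s, ‖legendre f (σ t)‖ ≤ C * (2 * ‖l‖) := by
    intro t ht
    obtain ⟨hσN, hσz, hσd⟩ := hσ t ht
    refine (hC _ hσN).trans ?_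
    gcongr
    rw [hσz, hgeq, slant_comp_inr, norm_smul, mul_comm]
    gcongr
    have := (hρO (hsρ (hζt t ht))).2.2
    rw [mem_ball_zero_iff] at this
    exact this.le
  have hcl : Metric.closedBall (0 : ℂ) (s / 2) ⊆ Metric.ball 0 s := Metric.closedBall_subset_ball (by linarith)
  have hdc : DiffContOnCl ℂ (fun t => legendre f (σ t)) (Metric.ball 0 (s / 2)) := by
    refine DifferentiableOn.diffContOnCl ?_
    rw [closure_ball _ (by positivity)]
    exact fun t ht => (hder t (hcl ht)).differentiableAt.differentiableWithinAt
  have := Complex.norm_deriv_le_of_forall_mem_sphere_norm_le (half_pos hs) hdc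
    fun t ht => hbd t (hcl (Metric.sphere_subset_closedBall ht))
  rw [(hder 0 (Metric.mem_ball_self hs)).deriv, hσ0] at this
  refine this.trans (le_of_eq ?_)
  ring

/-- The characteristic polynomial of `∂f/∂z_j / λ` along the transverse lines extends continuously
to `λ = 0`. -/
theorem exists_blowup (h : IsCritCover f N r) (j : T) :
    ∃ μ ≠ 0, ∃ B : ℕ → (T → ℂ) × (X → ℂ) → ℂ → ℂ,
      (∀ i < μ, ContinuousOn (Function.uncurry (B i)) (slantDom T X r ×ˢ Metric.ball 0 (r / 4))) ∧
      (∀ p ∈ slantDom T X r, ∀ l ∈ Metric.ball (0 : ℂ) (r / 4), l ≠ 0 → ∀ q,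
        (monicPoly μ fun i => B i p l).IsRoot q ↔
          ∃ x ∈ N, relGrad f x = slant p l ∧ pd f (Sum.inl j) x = l * q) ∧
      ∃ L : (X → ℂ) →L[ℂ] ℂ, ∀ ω ∈ Metric.ball (0 : X → ℂ) 2, B (μ - 1) (0, ω) 0 = L ω := by
  have hr := h.pos
  obtain ⟨μ, hμ, hc⟩ := h.proper.exists_charpoly (convex_ball _ _).isPreconnected
  have hμ0 : μ ≠ 0 := hμ ⟨0, h.zero_mem⟩
  obtain ⟨c, hcd, hcr⟩ := hc (pd f (Sum.inl j)) fun x hx => (h.analytic x hx).pd _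
  have hmaps : ∀ p ∈ slantDom T X r, ∀ l ∈ Metric.ball (0 : ℂ) (r / 2), slant p l ∈ Metric.ball 0 r :=
    fun p hp l hl => slant_mem hr hp hl
  have hdiv : ∀ i, ∃ b : (T → ℂ) × (X → ℂ) → ℂ → ℂ, i < μ →
      ContinuousOn (Function.uncurry b) (slantDom T X r ×ˢ Metric.ball 0 (r / 4)) ∧
      ∀ p ∈ slantDom T X r, ∀ l ∈ Metric.ball (0 : ℂ) (r / 4), c i (slant p l) = l ^ (μ - i) * b p l := by
    intro i
    by_cases hi : i < μ
    · obtain ⟨b, hb⟩ := exists_family_eq_pow_mul_of_frequently (S := slantDom T X r)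
        (n := fun p l => c i (slant p l)) (R := r / 4) (R' := r / 2) (by positivity) (by linarith) (μ - i)
        ((hcd i).continuousOn.comp (f := fun q : ((T → ℂ) × (X → ℂ)) × ℂ => slant q.1 q.2)
          continuous_slant.continuousOn fun q hq => hmaps q.1 hq.1 q.2 hq.2)
        (fun p hp => (hcd i).comp (differentiable_slant _).differentiableOn fun l hl => hmaps p hp l hl)
        (by
          intro p hp
          rw [isOpen_slantDom.nhdsWithin_eq hp]
          have hS : ∀ᶠ p' in 𝓝 p, p' ∈ slantDom T X r := isOpen_slantDom.mem_nhds hp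
          refine ((h.frequently_norm_pd_le j hp).and_eventually hS).mono ?_
          rintro p' ⟨⟨C, hC⟩, hp'⟩
          refine IsBigO.of_bound (C ^ (μ - i) * μ.choose i) ?_
          filter_upwards [hC, eventually_nhdsWithin_of_eventually_nhds
            (Metric.ball_mem_nhds (0 : ℂ) (half_pos hr))] with l hl hlr
          have := norm_coeff_le_of_isRoot (μ := μ) (c := fun i => c i (slant p' l)) (B := C * ‖l‖) (fun t ht => by
            obtain ⟨x, hx, hxz, rfl⟩ := (hcr _ (hmaps p' hp' l hlr) t).1 ht
            exact hl x hx hxz) hi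
          rw [norm_pow]
          refine this.trans (le_of_eq ?_)
          rw [mul_pow]; ring)
      exact ⟨b, fun _ => hb⟩
    · exact ⟨0, fun h => absurd h hi⟩
  choose B hB using hdiv
  refine ⟨μ, hμ0, B, fun i hi => (hB i hi).1, fun p hp l hl hl0 q => ?_, ?_⟩
  · have hl' : l ∈ Metric.ball (0 : ℂ) (r / 2) := Metric.ball_subset_ball (by linarith) hl
    rw [← hcr _ (hmaps p hp l hl') (l * q)]
    have : (monicPoly μ fun i => c i (slant p l)).eval (l * q) = l ^ μ * (monicPoly μ fun i => B i p l).eval q := by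
      rw [eval_monicPoly, eval_monicPoly, mul_add, Finset.mul_sum, mul_pow]
      congr 1
      refine Finset.sum_congr rfl fun i hi => ?_
      have hi' := Finset.mem_range.1 hi
      rw [(hB i hi').2 p hp l hl, mul_pow]
      calc l ^ (μ - i) * B i p l * (l ^ i * q ^ i) = l ^ (μ - i) * l ^ i * (B i p l * q ^ i) := by ring
        _ = _ := by rw [← pow_add, Nat.sub_add_cancel hi'.le]
    simp [Polynomial.IsRoot, this, hl0]
  · have hμ1 : μ - 1 < μ := by omega
    have hμ2 : μ - (μ - 1) = 1 := by omega
    let ext : (X → ℂ) →L[ℂ] (T ⊕ X → ℂ) := ContinuousLinearMap.pi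
      (Sum.rec (fun _ => 0) fun k => ContinuousLinearMap.proj k)
    have hext : ∀ (ω : X → ℂ) (l : ℂ), slant (0, ω) l = l • ext ω := by
      intro ω l
      funext i
      rcases i with j | k <;> simp [ext]
    refine ⟨(fderiv ℂ (c (μ - 1)) 0).comp ext, fun ω hω => ?_⟩
    have hp : ((0 : T → ℂ), ω) ∈ slantDom T X r := ⟨Metric.mem_ball_self hr, hω⟩
    have h0r : (0 : ℂ) ∈ Metric.ball (0 : ℂ) (r / 4) := Metric.mem_ball_self (by positivity)
    have h1 : HasDerivAt (fun l : ℂ => c (μ - 1) (slant (0, ω) l)) (fderiv ℂ (c (μ - 1)) 0 (ext ω)) 0 := by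
      have hc0 : DifferentiableAt ℂ (c (μ - 1)) ((0 : ℂ) • ext ω) := by
        rw [zero_smul]
        exact (hcd _).differentiableAt (Metric.ball_mem_nhds _ hr)
      have := hc0.hasFDerivAt.comp_hasDerivAt (0 : ℂ) ((hasDerivAt_id (0 : ℂ)).smul_const (ext ω))
      simpa [hext, Function.comp_def] using this
    have h2 : Tendsto (fun l : ℂ => B (μ - 1) (0, ω) l) (𝓝[≠] 0) (𝓝 (B (μ - 1) (0, ω) 0)) := by
      have h3 : ContinuousAt (Function.uncurry (B (μ - 1))) ((0, ω), 0) :=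
        (hB _ hμ1).1.continuousAt ((isOpen_slantDom.prod Metric.isOpen_ball).mem_nhds ⟨hp, h0r⟩)
      exact (h3.comp (f := fun l : ℂ => (((0 : T → ℂ), ω), l)) (by fun_prop)).tendsto.mono_left nhdsWithin_le_nhds
    refine tendsto_nhds_unique h2 ((hasDerivAt_iff_tendsto_slope_zero.1 h1).congr' ?_)
    filter_upwards [self_mem_nhdsWithin, mem_nhdsWithin_of_mem_nhds (Metric.isOpen_ball.mem_nhds h0r)] with l hl0 hl
    have hl0' : l ≠ 0 := hl0
    rw [zero_add, (hB _ hμ1).2 _ hp l hl, (hB _ hμ1).2 _ hp 0 h0r, hμ2]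
    simp [hl0']

end IsCritCover

end Blowup

section

section Flat

variable {ι : Type*} [Fintype ι] [DecidableEq ι]

/-- Replacing one coordinate by zero. -/
noncomputable def flat (j : ι) : (ι → ℂ) →L[ℂ] (ι → ℂ) :=
  ContinuousLinearMap.id ℂ _ - (ContinuousLinearMap.single ℂ (fun _ => ℂ) j).comp (ContinuousLinearMap.proj j)

theorem flat_apply (j : ι) (z : ι → ℂ) : flat j z = z - Pi.single j (z j) := by
  ext i
  simp [flat]

@[simp] theorem flat_apply_same (j : ι) (z : ι → ℂ) : flat j z j = 0 := by simp [flat_apply]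

theorem flat_apply_of_ne {i j : ι} (h : i ≠ j) (z : ι → ℂ) : flat j z i = z i := by simp [flat_apply, h]

theorem norm_flat_le (j : ι) (z : ι → ℂ) : ‖flat j z‖ ≤ ‖z‖ := by
  refine (pi_norm_le_iff_of_nonneg (norm_nonneg _)).2 fun i => ?_
  by_cases h : i = j
  · subst h; simp
  · rw [flat_apply_of_ne h]; exact norm_le_pi_norm z i

theorem norm_lt_of_flat {j : ι} {z : ι → ℂ} {r : ℝ} (h1 : ‖z j‖ < r) (h2 : ‖flat j z‖ < r) : ‖z‖ < r := by
  rw [pi_norm_lt_iff ((norm_nonneg _).trans_lt h1)]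
  intro i
  by_cases h : i = j
  · subst h; exact h1
  · rw [← flat_apply_of_ne h z]; exact (norm_le_pi_norm _ i).trans_lt h2

@[simp] theorem flat_update (j : ι) (z : ι → ℂ) (τ : ℂ) : flat j (Function.update z j τ) = flat j z := by
  ext i
  by_cases h : i = j
  · subst h; simp
  · simp [flat_apply_of_ne h, h]

@[simp] theorem flat_flat (j : ι) (z : ι → ℂ) : flat j (flat j z) = flat j z := by
  ext i
  by_cases h : i = j
  · subst h; simp
  · simp [flat_apply_of_ne h]

/-- The points whose coordinate `j` has norm in `s`, and with the remaining coordinates near `c`. -/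
def cyl (j : ι) (s : Set ℝ) (c : ι → ℂ) (ρ : ℝ) : Set (ι → ℂ) := {z | ‖z j‖ ∈ s ∧ ‖flat j z - c‖ < ρ}

theorem isOpen_cyl (j : ι) {s : Set ℝ} (hs : IsOpen s) (c : ι → ℂ) (ρ : ℝ) : IsOpen (cyl j s c ρ) :=
  (hs.preimage (by fun_prop : Continuous fun z : ι → ℂ => ‖z j‖)).inter
    (isOpen_lt (by fun_prop : Continuous fun z : ι → ℂ => ‖flat j z - c‖) continuous_const)

theorem convex_cyl (j : ι) (a : ℝ) (c : ι → ℂ) (ρ : ℝ) : Convex ℝ (cyl j (Iio a) c ρ) := by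
  have h1 := (convex_ball (0 : ℂ) a).linear_preimage
    ((LinearMap.proj (R := ℂ) (φ := fun _ : ι => ℂ) j).restrictScalars ℝ)
  have h2 := (convex_ball c ρ).linear_preimage ((flat j).toLinearMap.restrictScalars ℝ)
  have h3 : cyl j (Iio a) c ρ = {z | z j ∈ Metric.ball (0 : ℂ) a} ∩ {z | flat j z ∈ Metric.ball c ρ} := by
    ext z
    change _ ∧ _ ↔ z j ∈ Metric.ball (0 : ℂ) a ∧ flat j z ∈ Metric.ball c ρ
    rw [mem_ball_zero_iff, mem_ball_iff_norm]
    rfl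
  rw [h3]
  exact h1.inter h2

theorem isPreconnected_annulus (a b : ℝ) : IsPreconnected {ζ : ℂ | ‖ζ‖ ∈ Ioo a b} := by
  by_cases ha : 0 ≤ a
  · have : {ζ : ℂ | ‖ζ‖ ∈ Ioo a b} = (fun q : ℝ × ℝ => circleMap 0 q.1 q.2) '' (Ioo a b ×ˢ univ) := by
      ext ζ
      constructor
      · intro h
        exact ⟨(‖ζ‖, ζ.arg), ⟨h, mem_univ _⟩, by simp [circleMap]⟩
      · rintro ⟨q, hq, rfl⟩
        have : |q.1| = q.1 := abs_of_nonneg (ha.trans hq.1.1.le)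
        simpa [this] using hq.1
    rw [this]
    refine (isPreconnected_Ioo.prod isPreconnected_univ).image _ (Continuous.continuousOn ?_)
    simp only [circleMap]
    fun_prop
  · have : {ζ : ℂ | ‖ζ‖ ∈ Ioo a b} = Metric.ball 0 b := by
      ext ζ
      simp only [mem_ofPred_eq, mem_Ioo, mem_ball_zero_iff, and_iff_right_iff_imp]
      intro _
      linarith [norm_nonneg ζ]
    rw [this]
    exact (convex_ball _ _).isPreconnected

theorem isPreconnected_cyl_Ioo (j : ι) (a b ρ : ℝ) : IsPreconnected (cyl j (Ioo a b) 0 ρ) := by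
  have : cyl j (Ioo a b) 0 ρ =
      (fun q : ℂ × (ι → ℂ) => Function.update q.2 j q.1) '' ({ζ : ℂ | ‖ζ‖ ∈ Ioo a b} ×ˢ Metric.ball 0 ρ) := by
    ext z
    constructor
    · rintro ⟨h1, h2⟩
      refine ⟨(z j, flat j z), ⟨h1, by simpa using h2⟩, ?_⟩
      ext i
      by_cases h : i = j
      · subst h; simp
      · simp [h, flat_apply_of_ne h]
    · rintro ⟨⟨ζ, v⟩, ⟨h1, h2⟩, rfl⟩
      refine ⟨by simpa using h1, ?_⟩
      simp only [flat_update, sub_zero]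
      exact (norm_flat_le j v).trans_lt (by simpa using h2)
  rw [this]
  refine ((isPreconnected_annulus a b).prod (convex_ball _ _).isPreconnected).image _ (Continuous.continuousOn ?_)
  exact continuous_snd.update j continuous_fst

end Flat

section Separation

variable {T X : Type*} [Fintype T] [DecidableEq T] [Fintype X] [DecidableEq X]
variable {f : (T ⊕ X → ℂ) → ℂ} {N V : Set (T ⊕ X → ℂ)} {r : ℝ}

theorem norm_slant_zero_le {ω : X → ℂ} (hω : ‖ω‖ ≤ 1) (l : ℂ) : ‖slant ((0 : T → ℂ), ω) l‖ ≤ ‖l‖ := by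
  refine (pi_norm_le_iff_of_nonneg (norm_nonneg _)).2 ?_
  rintro (j | k)
  · simp
  · rw [slant_inr, norm_mul]
    exact mul_le_of_le_one_right (norm_nonneg _) ((norm_le_pi_norm ω k).trans hω)

theorem norm_flat_le_of_mem_cyl {j : T} {s : Set ℝ} {ω : X → ℂ} (hω : ‖ω‖ ≤ 1) {l : ℂ} {η : ℝ} (hη : η ≤ 1)
    {z : T ⊕ X → ℂ} (hz : z ∈ cyl (Sum.inl j) s (slant ((0 : T → ℂ), ω) l) (η * ‖l‖)) :
    ‖flat (Sum.inl j) z‖ ≤ 2 * ‖l‖ := by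
  have h1 := norm_slant_zero_le (T := T) hω l
  have h2 := hz.2
  have h3 := norm_le_norm_sub_add (flat (Sum.inl j) z) (slant ((0 : T → ℂ), ω) l)
  nlinarith [norm_nonneg l]

/-- A linear form controlling the branches of the relative gradient map. -/
noncomputable def tilt (j : T) (ω : X → ℂ) (κ : ℂ) (x : T ⊕ X → ℂ) : ℂ :=
  -(∑ k, ω k * x (Sum.inr k)) - κ * x (Sum.inl j)

theorem continuous_tilt (j : T) (ω : X → ℂ) (κ : ℂ) : Continuous (tilt j ω κ) := by
  unfold tilt; fun_prop

theorem norm_sub_mul_le_tilt (j : T) (ω : X → ℂ) (κ κ' : ℂ) (x : T ⊕ X → ℂ) :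
    ‖κ - κ'‖ * ‖x (Sum.inl j)‖ ≤ ‖tilt j ω κ x‖ + ‖tilt j ω κ' x‖ := by
  rw [← norm_mul]
  have : (κ - κ') * x (Sum.inl j) = tilt j ω κ' x - tilt j ω κ x := by unfold tilt; ring
  rw [this, add_comm]
  exact norm_sub_le _ _

/-- The branch of the relative gradient map on which `∂f/∂z_j` is near `κ * l`. -/
def branch (f : (T ⊕ X → ℂ) → ℂ) (j : T) (δ : ℝ) (κ l : ℂ) : Set (T ⊕ X → ℂ) :=
  {x | ‖pd f (Sum.inl j) x - κ * l‖ < δ * ‖l‖}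

/-- The values of `∂f/∂z_j / λ` on the fibres over boxes transverse to the axis of `z_j` are close to a
finite set of well separated values. -/
structure IsSeparated (f : (T ⊕ X → ℂ) → ℂ) (N : Set (T ⊕ X → ℂ)) (j : T) (ω : X → ℂ) (R : Finset ℂ)
    (δ η : ℝ) : Prop where
  norm_le : ‖ω‖ ≤ 1
  pos : 0 < δ
  radius_pos : 0 < η
  radius_le : η ≤ 1
  sep : ∀ κ ∈ R, ∀ κ' ∈ R, κ ≠ κ' → 4 * δ ≤ ‖κ - κ'‖
  cover : ∀ᶠ l in 𝓝[≠] (0 : ℂ), ∀ x ∈ N, ‖flat (Sum.inl j) (relGrad f x) - slant ((0 : T → ℂ), ω) l‖ < η * ‖l‖ →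
    ∃ κ ∈ R, x ∈ branch f j δ κ l
  exists_mem : ∀ᶠ l in 𝓝[≠] (0 : ℂ), ∀ κ ∈ R, ∃ x ∈ N, relGrad f x = slant ((0 : T → ℂ), ω) l ∧ x ∈ branch f j δ κ l

theorem eq_of_mem_branch {j : T} {R : Finset ℂ} {δ : ℝ} (hsep : ∀ κ ∈ R, ∀ κ' ∈ R, κ ≠ κ' → 4 * δ ≤ ‖κ - κ'‖)
    {κ κ' l : ℂ} (hδ : 0 < δ) (hl : l ≠ 0) (hκ : κ ∈ R) (hκ' : κ' ∈ R) {x : T ⊕ X → ℂ} (h1 : x ∈ branch f j δ κ l)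
    (h2 : x ∈ branch f j δ κ' l) : κ = κ' := by
  by_contra hne
  have h3 := hsep κ hκ κ' hκ' hne
  have hl' := norm_pos_iff.2 hl
  have h4 : ‖κ - κ'‖ * ‖l‖ < 2 * δ * ‖l‖ := by
    rw [← norm_mul]
    have : (κ - κ') * l = (pd f (Sum.inl j) x - κ' * l) - (pd f (Sum.inl j) x - κ * l) := by ring
    rw [this]
    have h1' : ‖pd f (Sum.inl j) x - κ * l‖ < δ * ‖l‖ := h1
    have h2' : ‖pd f (Sum.inl j) x - κ' * l‖ < δ * ‖l‖ := h2
    linarith [norm_sub_le (pd f (Sum.inl j) x - κ' * l) (pd f (Sum.inl j) x - κ * l)]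
  have := lt_of_mul_lt_mul_right h4 hl'.le
  linarith

namespace IsCritCover

theorem isOpen_branch (h : IsCritCover f N r) (j : T) (δ : ℝ) (κ l : ℂ) : IsOpen (N ∩ branch f j δ κ l) := by
  have hc : ContinuousOn (fun x => ‖pd f (Sum.inl j) x - κ * l‖) N := fun x hx =>
    (((h.analytic x hx).pd _).continuousAt.sub continuousAt_const).norm.continuousWithinAt
  exact hc.isOpen_inter_preimage h.proper.isOpen_source isOpen_Iio

theorem proper_branch (h : IsCritCover f N r) {j : T} {ω : X → ℂ} {R : Finset ℂ} {δ η : ℝ} {l : ℂ}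
    (hδ : 0 < δ) (hl : l ≠ 0) (hsep : ∀ κ ∈ R, ∀ κ' ∈ R, κ ≠ κ' → 4 * δ ≤ ‖κ - κ'‖)
    (hsub : cyl (Sum.inl j) (Iio r) (slant ((0 : T → ℂ), ω) l) (η * ‖l‖) ⊆ Metric.ball 0 r)
    (hcov : ∀ x ∈ N, ‖flat (Sum.inl j) (relGrad f x) - slant ((0 : T → ℂ), ω) l‖ < η * ‖l‖ →
      ∃ κ ∈ R, x ∈ branch f j δ κ l) {κ : ℂ} (hκ : κ ∈ R) :
    IsProperHol (relGrad f) (N ∩ relGrad f ⁻¹' cyl (Sum.inl j) (Iio r) (slant ((0 : T → ℂ), ω) l) (η * ‖l‖) ∩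
      branch f j δ κ l) (cyl (Sum.inl j) (Iio r) (slant ((0 : T → ℂ), ω) l) (η * ‖l‖)) := by
  set D := cyl (Sum.inl j) (Iio r) (slant ((0 : T → ℂ), ω) l) (η * ‖l‖) with hD
  have hDo : IsOpen D := isOpen_cyl _ isOpen_Iio _ _
  have hND : IsOpen (N ∩ relGrad f ⁻¹' D) := h.proper.continuousOn.isOpen_inter_preimage h.proper.isOpen_source hDo
  have hop : ∀ κ', IsOpen (N ∩ relGrad f ⁻¹' D ∩ branch f j δ κ' l) := by
    intro κ'
    have : N ∩ relGrad f ⁻¹' D ∩ branch f j δ κ' l = (N ∩ relGrad f ⁻¹' D) ∩ (N ∩ branch f j δ κ' l) := by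
      ext x; simp only [mem_inter_iff]; tauto
    rw [this]
    exact hND.inter (h.isOpen_branch j δ κ' l)
  refine h.proper.split hDo hsub (hop κ) (N₂ := ⋃ κ' ∈ {κ' | κ' ∈ R ∧ κ' ≠ κ}, N ∩ relGrad f ⁻¹' D ∩ branch f j δ κ' l)
    (isOpen_biUnion fun κ' _ => hop κ') ?_ ?_
  · rw [Set.disjoint_left]
    intro x hx hx'
    simp only [mem_iUnion] at hx'
    obtain ⟨κ', hκ', hx'⟩ := hx'
    exact hκ'.2 (eq_of_mem_branch hsep hδ hl hκ'.1 hκ hx'.2 hx.2)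
  · ext x
    simp only [mem_union, mem_iUnion]
    constructor
    · rintro hx
      obtain ⟨κ', hκ', hb⟩ := hcov x hx.1 hx.2.2
      by_cases hk : κ' = κ
      · subst hk; exact Or.inl ⟨hx, hb⟩
      · exact Or.inr ⟨κ', ⟨hκ', hk⟩, hx, hb⟩
    · rintro (hx | ⟨κ', -, hx⟩)
      · exact hx.1
      · exact hx.1

end IsCritCover

end Separation

end

section Monodromy

variable {T X : Type*} [Fintype T] [DecidableEq T] [Fintype X] [DecidableEq X]
variable {f : (T ⊕ X → ℂ) → ℂ} {N V : Set (T ⊕ X → ℂ)} {r : ℝ}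

/-- A compact annulus on a coordinate axis. -/
def axisAnnulus {ι : Type*} [DecidableEq ι] (j : ι) (a b : ℝ) : Set (ι → ℂ) :=
  (fun ζ : ℂ => (Pi.single j ζ : ι → ℂ)) '' {ζ | ‖ζ‖ ∈ Icc a b}

theorem isCompact_axisAnnulus {ι : Type*} [Fintype ι] [DecidableEq ι] (j : ι) (a b : ℝ) :
    IsCompact (axisAnnulus j a b) := by
  refine IsCompact.image ?_ (continuous_single (A := fun _ : ι => ℂ) j)
  refine Metric.isCompact_of_isClosed_isBounded (isClosed_Icc.preimage continuous_norm) ?_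
  exact (Metric.isBounded_closedBall (x := (0 : ℂ)) (r := b)).subset fun ζ hζ => by simpa using hζ.2

theorem mem_thickening_axisAnnulus {ι : Type*} [Fintype ι] [DecidableEq ι] {j : ι} {a b ε : ℝ} {z : ι → ℂ}
    (h1 : ‖z j‖ ∈ Icc a b) (h2 : ‖flat j z‖ < ε) : z ∈ Metric.thickening ε (axisAnnulus j a b) := by
  refine Metric.mem_thickening_iff.2 ⟨Pi.single j (z j), ⟨z j, h1, rfl⟩, ?_⟩
  rwa [dist_eq_norm, ← flat_apply]

theorem norm_le_of_mem_axisAnnulus {ι : Type*} [Fintype ι] [DecidableEq ι] {j : ι} {a b : ℝ} {z : ι → ℂ}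
    (h : z ∈ axisAnnulus j a b) : ‖z‖ ≤ b := by
  obtain ⟨ζ, hζ, rfl⟩ := h
  exact (Pi.norm_single (ι := ι) (G := fun _ => ℂ) ζ).trans_le hζ.2

theorem IsSeparated.mono {j : T} {ω : X → ℂ} {R : Finset ℂ} {δ η η' : ℝ} (h : IsSeparated f N j ω R δ η)
    (h0 : 0 < η') (hle : η' ≤ η) : IsSeparated f N j ω R δ η' where
  norm_le := h.norm_le
  pos := h.pos
  radius_pos := h0
  radius_le := hle.trans h.radius_le
  sep := h.sep
  cover := h.cover.mono fun l hl x hx hx' => hl x hx (hx'.trans_le (by gcongr))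
  exists_mem := h.exists_mem

theorem norm_comp_inr_sub_le (j : T) (z w : T ⊕ X → ℂ) : ‖(z - w) ∘ Sum.inr‖ ≤ ‖flat (Sum.inl j) z - w‖ := by
  refine (pi_norm_le_iff_of_nonneg (norm_nonneg _)).2 fun k => ?_
  have := norm_le_pi_norm (flat (Sum.inl j) z - w) (Sum.inr k)
  rwa [Pi.sub_apply, flat_apply_of_ne (by simp)] at this

theorem norm_comp_inr_le_flat (j : T) (z : T ⊕ X → ℂ) : ‖z ∘ Sum.inr‖ ≤ ‖flat (Sum.inl j) z‖ := by
  simpa using norm_comp_inr_sub_le j z 0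

theorem cyl_subset_ball {j : T} {ω : X → ℂ} (hω : ‖ω‖ ≤ 1) {l : ℂ} {η : ℝ} (hη : η ≤ 1) (hl : 2 * ‖l‖ < r) :
    cyl (Sum.inl j) (Iio r) (slant ((0 : T → ℂ), ω) l) (η * ‖l‖) ⊆ Metric.ball 0 r := fun z hz => by
  rw [mem_ball_zero_iff]
  exact norm_lt_of_flat hz.1 ((norm_flat_le_of_mem_cyl hω hη hz).trans_lt hl)

namespace IsCritCover

theorem exists_thickening_norm_le (h : IsCritCover f N r) (j : T) {ε : ℝ} (hε : 0 < ε) :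
    ∃ ρ > 0, ∀ x ∈ N, relGrad f x ∈ Metric.thickening ρ (axisAnnulus (Sum.inl j) (r / 4) (r / 2)) →
      ‖f x‖ ≤ ε * ‖relGrad f x ∘ Sum.inr‖ := by
  have hr := h.pos
  obtain ⟨ρ, hρ, -, hO⟩ := h.proper.exists_thickening (isCompact_axisAnnulus (Sum.inl j) (r / 4) (r / 2))
    (fun z hz => by
      rw [mem_ball_zero_iff]
      linarith [norm_le_of_mem_axisAnnulus hz])
    (isOpen_interior (s := {x | ‖f x‖ ≤ ε * ‖relGrad f x ∘ Sum.inr‖}))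
    (fun x hx hxK => by
      refine mem_interior_iff_mem_nhds.2 (h.eventually_norm_le hx ?_ hε)
      obtain ⟨ζ, -, hζ⟩ := hxK
      rw [← hζ]
      ext k
      simp)
  exact ⟨ρ, hρ, fun x hx hxT => by
    have := interior_subset (hO x hx hxT)
    exact this⟩

theorem exists_ball_legendre_le (h : IsCritCover f N r) {ε : ℝ} (hε : 0 < ε) :
    ∃ ρ > 0, ∀ x ∈ N, ‖relGrad f x‖ < ρ → ‖legendre f x‖ ≤ ε * ‖relGrad f x ∘ Sum.inr‖ := by
  obtain ⟨ρ, hρ, -, hO⟩ := h.proper.exists_ball (Metric.mem_ball_self h.pos)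
    (isOpen_interior (s := {x | ‖legendre f x‖ ≤ ε * ‖relGrad f x ∘ Sum.inr‖}))
    (fun x hx hx0 => by
      rw [h.eq_zero x hx hx0]
      refine mem_interior_iff_mem_nhds.2 ?_
      have := h.eventually_legendre_add_le h.zero_mem (by rw [h.relGrad_zero]; rfl) hε
      simp only [Pi.zero_apply, zero_mul, Finset.sum_const_zero, add_zero] at this
      exact this)
  exact ⟨ρ, hρ, fun x hx hxT => by
    have := interior_subset (hO x hx (by simpa using hxT))
    exact this⟩

theorem exists_tilt_le (h : IsCritCover f N r) {j : T} {ω : X → ℂ} {R : Finset ℂ} {δ η : ℝ}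
    (hS : IsSeparated f N j ω R δ η) :
    ∃ η', IsSeparated f N j ω R δ η' ∧ ∀ᶠ l in 𝓝[≠] (0 : ℂ), ∀ x ∈ N,
      relGrad f x ∈ cyl (Sum.inl j) (Icc (r / 4) (r / 2)) (slant ((0 : T → ℂ), ω) l) (η' * ‖l‖) →
      ∀ κ ∈ R, x ∈ branch f j δ κ l → ‖tilt j ω κ x‖ ≤ 3 / 2 * δ * ‖x (Sum.inl j)‖ := by
  have hr := h.pos
  have hδ := hS.pos
  obtain ⟨C, hC⟩ := h.bounded
  have hC0 : 0 ≤ C := (norm_nonneg _).trans (hC 0 h.zero_mem)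
  set a := δ * r / 8 with ha
  have ha0 : 0 < a := by positivity
  set B : ℝ := Fintype.card X * C + 1 with hB
  have hB0 : 0 < B := by positivity
  set η' := min η (a / 2 / B) with hη'
  have hη'0 : 0 < η' := lt_min hS.radius_pos (by positivity)
  have hS' := hS.mono hη'0 (min_le_left _ _)
  have hη'B : Fintype.card X * C * η' ≤ a / 2 := by
    have h1 : η' * B ≤ a / 2 := (le_div_iff₀ hB0).1 (min_le_right _ _)
    nlinarith
  obtain ⟨ρ₁, hρ₁, hf1⟩ := h.exists_thickening_norm_le j (ε := a / 8) (by positivity)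
  obtain ⟨ρ₀, hρ₀, hf0⟩ := h.exists_ball_legendre_le (ε := a / 8) (by positivity)
  refine ⟨η', hS', ?_⟩
  have hsmall : ∀ ρ > 0, ∀ᶠ l in 𝓝[≠] (0 : ℂ), 2 * ‖l‖ < ρ := fun ρ hρ => by
    filter_upwards [nhdsWithin_le_nhds (Metric.ball_mem_nhds (0 : ℂ) (half_pos hρ))] with l hl
    rw [mem_ball_zero_iff] at hl
    linarith
  filter_upwards [hS'.cover, hsmall r hr, hsmall ρ₀ hρ₀, hsmall ρ₁ hρ₁, self_mem_nhdsWithin]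
    with l hcov hlr hl0 hl1 hl x hx hxz κ hκ hxκ
  have hl' : 0 < ‖l‖ := norm_pos_iff.2 hl
  have hP := h.proper_branch hS.pos hl hS.sep (cyl_subset_ball hS.norm_le hS'.radius_le hlr) hcov hκ
  set D := cyl (Sum.inl j) (Iio r) (slant ((0 : T → ℂ), ω) l) (η' * ‖l‖) with hD
  have hzD : relGrad f x ∈ D := ⟨hxz.1.2.trans_lt (half_lt_self hr), hxz.2⟩
  have hfD : flat (Sum.inl j) (relGrad f x) ∈ D := ⟨by simpa using hr, by simpa using hxz.2⟩
  have hflat : ‖flat (Sum.inl j) (relGrad f x)‖ ≤ 2 * ‖l‖ := norm_flat_le_of_mem_cyl hS.norm_le hS'.radius_le hzD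
  have hdiff : relGrad f x - flat (Sum.inl j) (relGrad f x) = Pi.single (Sum.inl j) (x (Sum.inl j)) := by
    rw [flat_apply]; simp
  obtain ⟨x₀, hx₀, hx₀z, hle⟩ := hP.exists_legendre_sub_le
    (h.analytic.mono (inter_subset_left.trans inter_subset_left))
    (-((κ * l) • ContinuousLinearMap.proj (R := ℂ) (φ := fun _ : T ⊕ X => ℂ) (Sum.inl j)))
    ((convex_cyl _ _ _ _).segment_subset hfD hzD) (L := δ * ‖l‖ * ‖x (Sum.inl j)‖)
    (fun x' hx' _ => by
      rw [hdiff, legendreForm_apply]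
      have : ‖(pd f (Sum.inl j) x' - κ * l) * x (Sum.inl j)‖ ≤ δ * ‖l‖ * ‖x (Sum.inl j)‖ := by
        rw [norm_mul]
        gcongr
        exact hx'.2.le
      convert this using 2
      simp [Pi.single_apply]
      ring) ⟨⟨hx, hzD⟩, hxκ⟩ rfl
  rw [hdiff] at hle
  simp only [neg_apply, smul_apply, ContinuousLinearMap.proj_apply,
    Pi.single_eq_same, smul_eq_mul] at hle
  have e0 : ‖legendre f x₀‖ ≤ a / 8 * (2 * ‖l‖) := by
    refine (hf0 x₀ hx₀.1.1 (by rw [hx₀z]; exact hflat.trans_lt hl0)).trans ?_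
    gcongr
    rw [hx₀z]
    exact (norm_comp_inr_le_flat j _).trans (by simpa using hflat)
  have e1 : ‖f x‖ ≤ a / 8 * (2 * ‖l‖) := by
    refine (hf1 x hx (mem_thickening_axisAnnulus hxz.1 (hflat.trans_lt hl1))).trans ?_
    gcongr
    exact (norm_comp_inr_le_flat j _).trans hflat
  have e2 : ‖∑ k, x (Sum.inr k) * ((relGrad f x - slant ((0 : T → ℂ), ω) l) ∘ Sum.inr) k‖ ≤
      Fintype.card X * (C * (η' * ‖l‖)) :=
    norm_sum_mul_le (x ∘ Sum.inr) _ ((norm_comp_inr_le _).trans (hC x hx))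
      ((norm_comp_inr_sub_le j _ _).trans hxz.2.le)
  have key : l * tilt j ω κ x = (legendre f x - legendre f x₀ + -(κ * l * x (Sum.inl j))) + legendre f x₀ - f x +
      ∑ k, x (Sum.inr k) * ((relGrad f x - slant ((0 : T → ℂ), ω) l) ∘ Sum.inr) k := by
    simp only [Function.comp_apply, Pi.sub_apply, slant_inr, relGrad_inr, mul_sub, Finset.sum_sub_distrib, tilt,
      legendre, Finset.mul_sum, mul_neg]
    have : ∀ k, x (Sum.inr k) * (l * ω k) = l * (ω k * x (Sum.inr k)) := fun k => by ring
    simp only [this]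
    ring
  have h4 : ‖l‖ * ‖tilt j ω κ x‖ ≤ δ * ‖l‖ * ‖x (Sum.inl j)‖ + a / 8 * (2 * ‖l‖) + a / 8 * (2 * ‖l‖) +
      Fintype.card X * (C * (η' * ‖l‖)) := by
    rw [← norm_mul, key]
    refine (norm_add_le _ _).trans (add_le_add ?_ e2)
    refine (norm_sub_le _ _).trans (add_le_add ?_ e1)
    exact (norm_add_le _ _).trans (add_le_add hle e0)
  have h5 : r / 4 ≤ ‖x (Sum.inl j)‖ := by simpa using hxz.1.1
  have h6 : Fintype.card X * (C * (η' * ‖l‖)) ≤ a / 2 * ‖l‖ := by nlinarith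
  have h7 : a * ‖l‖ ≤ δ * ‖x (Sum.inl j)‖ / 2 * ‖l‖ := by
    gcongr
    rw [ha]
    nlinarith
  refine le_of_mul_le_mul_left (a := ‖l‖) ?_ hl'
  nlinarith

end IsCritCover

end Monodromy

section Monodromy

variable {T X : Type*} [Fintype T] [DecidableEq T] [Fintype X] [DecidableEq X]
variable {f : (T ⊕ X → ℂ) → ℂ} {N V : Set (T ⊕ X → ℂ)} {r : ℝ}

namespace IsCritCover

theorem exists_tilt_lt (h : IsCritCover f N r) {j : T} {ω : X → ℂ} {R : Finset ℂ} {δ η : ℝ}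
    (hS : IsSeparated f N j ω R δ η) (hest : ∀ᶠ l in 𝓝[≠] (0 : ℂ), ∀ x ∈ N,
      relGrad f x ∈ cyl (Sum.inl j) (Icc (r / 4) (r / 2)) (slant ((0 : T → ℂ), ω) l) (η * ‖l‖) →
      ∀ κ ∈ R, x ∈ branch f j δ κ l → ‖tilt j ω κ x‖ ≤ 3 / 2 * δ * ‖x (Sum.inl j)‖) :
    ∃ ρ > 0, ∀ x ∈ N, relGrad f x ∈ cyl (Sum.inl j) (Ioo (r / 4) (r / 2)) 0 ρ →
      ∃ κ ∈ R, ‖tilt j ω κ x‖ < 2 * δ * ‖x (Sum.inl j)‖ := by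
  have hr := h.pos
  have hδ := hS.pos
  have hO : IsOpen {x | ∃ κ ∈ R, ‖tilt j ω κ x‖ < 2 * δ * ‖x (Sum.inl j)‖} := by
    have : {x | ∃ κ ∈ R, ‖tilt j ω κ x‖ < 2 * δ * ‖x (Sum.inl j)‖} =
        ⋃ κ ∈ R, {x | ‖tilt j ω κ x‖ < 2 * δ * ‖x (Sum.inl j)‖} := by
      ext x; simp
    rw [this]
    refine isOpen_biUnion fun κ _ => isOpen_lt ?_ ?_
    · exact (continuous_tilt j ω κ).norm
    · fun_prop
  obtain ⟨ρ, hρ, -, hρO⟩ := h.proper.exists_thickening (isCompact_axisAnnulus (Sum.inl j) (r / 4) (r / 2))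
    (fun z hz => by
      rw [mem_ball_zero_iff]
      linarith [norm_le_of_mem_axisAnnulus hz]) hO
    (fun x hx hxK => by
      by_contra hcon
      obtain ⟨ζ, hζ, hζx⟩ := hxK
      have hζx' : relGrad f x = Pi.single (Sum.inl j) ζ := hζx.symm
      have hxj : x (Sum.inl j) = ζ := by simpa using congrFun hζx' (Sum.inl j)
      have hxj0 : 0 < ‖x (Sum.inl j)‖ := by rw [hxj]; exact lt_of_lt_of_le (by positivity) hζ.1
      have hO' : IsOpen {y | ∀ κ ∈ R, 3 / 2 * δ * ‖y (Sum.inl j)‖ < ‖tilt j ω κ y‖} := by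
        have : {y | ∀ κ ∈ R, 3 / 2 * δ * ‖y (Sum.inl j)‖ < ‖tilt j ω κ y‖} =
            ⋂ κ ∈ R, {y | 3 / 2 * δ * ‖y (Sum.inl j)‖ < ‖tilt j ω κ y‖} := by
          ext x; simp
        rw [this]
        refine isOpen_biInter_finset fun κ _ => isOpen_lt ?_ ?_
        · fun_prop
        · exact (continuous_tilt j ω κ).norm
      have hxO' : x ∈ {y | ∀ κ ∈ R, 3 / 2 * δ * ‖y (Sum.inl j)‖ < ‖tilt j ω κ y‖} := fun κ hκ => by
        by_contra hlt
        refine hcon ⟨κ, hκ, ?_⟩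
        have := mul_pos hδ hxj0
        linarith
      have hev := h.proper.eventually_exists hx (hO'.mem_nhds hxO')
      have ht : Tendsto (fun l : ℂ => relGrad f x + slant ((0 : T → ℂ), ω) l) (𝓝[≠] 0) (𝓝 (relGrad f x)) := by
        have hc : Continuous fun l : ℂ => relGrad f x + slant ((0 : T → ℂ), ω) l := by
          refine continuous_const.add (continuous_pi ?_)
          rintro (i | k)
          · simp only [slant_inl]; fun_prop
          · simp only [slant_inr]; fun_prop
        have h0 : relGrad f x + slant ((0 : T → ℂ), ω) 0 = relGrad f x := by
          ext i; rcases i with i | k <;> simp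
        have := hc.tendsto 0
        rw [h0] at this
        exact this.mono_left nhdsWithin_le_nhds
      obtain ⟨l, ⟨⟨y, hy, hyl⟩, hcov⟩, hest, hl⟩ :=
        (((ht.eventually hev).and hS.cover).and (hest.and self_mem_nhdsWithin)).exists
      have hl' : 0 < ‖l‖ := norm_pos_iff.2 hl
      have hfl : flat (Sum.inl j) (relGrad f y) = slant ((0 : T → ℂ), ω) l := by
        rw [hyl, hζx', flat_apply]
        ext i
        simp
      have hyj : relGrad f y (Sum.inl j) = ζ := by rw [hyl, hζx']; simp
      obtain ⟨κ, hκ, hb⟩ := hcov y hy.1 (by rw [hfl, sub_self, norm_zero]; exact mul_pos hS.radius_pos hl')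
      have h1 := hest y hy.1 ⟨by rw [hyj]; exact hζ, by
        rw [hfl, sub_self, norm_zero]; exact mul_pos hS.radius_pos hl'⟩ κ hκ hb
      exact absurd (hy.2 κ hκ) (not_lt.2 h1))
  exact ⟨ρ, hρ, fun x hx hxz => hρO x hx (mem_thickening_axisAnnulus (Ioo_subset_Icc_self hxz.1)
    (by simpa using hxz.2))⟩

end IsCritCover

end Monodromy

section Monodromy

variable {T X : Type*} [Fintype T] [DecidableEq T] [Fintype X] [DecidableEq X]
variable {f : (T ⊕ X → ℂ) → ℂ} {N V : Set (T ⊕ X → ℂ)} {r : ℝ}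

namespace IsCritCover

theorem subsingleton_of_isSeparated (h : IsCritCover f N r) {j : T} {ω : X → ℂ} {R : Finset ℂ} {δ η : ℝ}
    (hS : IsSeparated f N j ω R δ η) {κ₁ κ₂ : ℂ} (hκ₁ : κ₁ ∈ R) (hκ₂ : κ₂ ∈ R) : κ₁ = κ₂ := by
  have hr := h.pos
  have hδ := hS.pos
  obtain ⟨η', hS', hest⟩ := h.exists_tilt_le hS
  clear hS
  obtain ⟨ρ', hρ', hsh'⟩ := h.exists_tilt_lt hS' hest
  obtain ⟨ρ, hρ, hρr, hsh⟩ : ∃ ρ > 0, ρ ≤ r ∧ ∀ x ∈ N, relGrad f x ∈ cyl (Sum.inl j) (Ioo (r / 4) (r / 2)) 0 ρ →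
      ∃ κ ∈ R, ‖tilt j ω κ x‖ < 2 * δ * ‖x (Sum.inl j)‖ :=
    ⟨min ρ' r, lt_min hρ' hr, min_le_right _ _, fun x hx hxz =>
      hsh' x hx ⟨hxz.1, hxz.2.trans_le (min_le_left _ _)⟩⟩
  have hsmall : ∀ᶠ l in 𝓝[≠] (0 : ℂ), 2 * ‖l‖ < ρ := by
    filter_upwards [nhdsWithin_le_nhds (Metric.ball_mem_nhds (0 : ℂ) (half_pos hρ))] with l hl
    rw [mem_ball_zero_iff] at hl
    linarith
  obtain ⟨l, hest, hcov, hmem, hlρ, hl0⟩ :=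
    (hest.and (hS'.cover.and (hS'.exists_mem.and (hsmall.and self_mem_nhdsWithin)))).exists
  have hl' : 0 < ‖l‖ := norm_pos_iff.2 hl0
  set z₀ := slant ((0 : T → ℂ), ω) l with hz₀
  set S := cyl (Sum.inl j) (Ioo (r / 4) (r / 2)) (0 : T ⊕ X → ℂ) ρ with hSdef
  set B := cyl (Sum.inl j) (Iio (r / 2)) z₀ (η' * ‖l‖) with hB
  have hSo : IsOpen S := isOpen_cyl _ isOpen_Ioo _ _
  have hBo : IsOpen B := isOpen_cyl _ isOpen_Iio _ _
  have hBflat : ∀ z ∈ B, ‖flat (Sum.inl j) z‖ < ρ := fun z hz =>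
    (norm_flat_le_of_mem_cyl hS'.norm_le hS'.radius_le hz).trans_lt hlρ
  have hWr : S ∪ B ⊆ Metric.ball 0 r := by
    rintro z (hz | hz)
    · rw [mem_ball_zero_iff]
      exact norm_lt_of_flat (by linarith [hz.1.2]) ((by simpa using hz.2 : ‖flat (Sum.inl j) z‖ < ρ).trans_le hρr)
    · rw [mem_ball_zero_iff]
      exact norm_lt_of_flat ((show ‖z (Sum.inl j)‖ < r / 2 from hz.1).trans (half_lt_self hr))
        ((hBflat z hz).trans_le hρr)
  have hz₀j : z₀ (Sum.inl j) = 0 := by simp [hz₀]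
  have hflat₀ : flat (Sum.inl j) z₀ = z₀ := by rw [flat_apply, hz₀j]; simp
  have hz₀B : z₀ ∈ B := by
    refine ⟨by rw [hz₀j]; simpa using hr, ?_⟩
    rw [hflat₀, sub_self, norm_zero]
    exact mul_pos hS'.radius_pos hl'
  have hWc : IsPreconnected (S ∪ B) := by
    have hu : ‖((3 * r / 8 : ℝ) : ℂ)‖ = 3 * r / 8 := by
      rw [Complex.norm_real, Real.norm_eq_abs, abs_of_pos (by positivity)]
    have hvB : Function.update z₀ (Sum.inl j) ((3 * r / 8 : ℝ) : ℂ) ∈ B := by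
      refine ⟨?_, ?_⟩
      · rw [Function.update_self, hu, mem_Iio]; linarith
      · rw [flat_update]; exact hz₀B.2
    refine IsPreconnected.union (Function.update z₀ (Sum.inl j) ((3 * r / 8 : ℝ) : ℂ)) ⟨?_, ?_⟩ hvB
      (isPreconnected_cyl_Ioo _ _ _ _) (convex_cyl _ _ _ _).isPreconnected
    · rw [Function.update_self, hu]
      constructor <;> linarith
    · simpa using hBflat _ hvB
  -- the sheet of the cover singled out by an approximate value
  let P : ℂ → Set (T ⊕ X → ℂ) := fun κ => (N ∩ relGrad f ⁻¹' S ∩ {x | ‖tilt j ω κ x‖ < 2 * δ * ‖x (Sum.inl j)‖}) ∪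
    (N ∩ relGrad f ⁻¹' B ∩ (N ∩ branch f j δ κ l))
  have hPo : ∀ κ, IsOpen (P κ) := by
    intro κ
    refine IsOpen.union (IsOpen.inter ?_ (isOpen_lt (continuous_tilt j ω κ).norm (by fun_prop)))
      (IsOpen.inter ?_ (h.isOpen_branch _ _ _ _))
    · exact h.proper.continuousOn.isOpen_inter_preimage h.proper.isOpen_source hSo
    · exact h.proper.continuousOn.isOpen_inter_preimage h.proper.isOpen_source hBo
  have hmix : ∀ κ ∈ R, ∀ κ' ∈ R, ∀ x, x ∈ N ∩ relGrad f ⁻¹' S ∩ {x | ‖tilt j ω κ x‖ < 2 * δ * ‖x (Sum.inl j)‖} →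
      ‖tilt j ω κ' x‖ < 2 * δ * ‖x (Sum.inl j)‖ → κ = κ' := by
    intro κ hκ κ' hκ' x hx hx'
    by_contra hne
    have h1 := hS'.sep κ hκ κ' hκ' hne
    have h2 := norm_sub_mul_le_tilt j ω κ κ' x
    have h3 : ‖tilt j ω κ x‖ < 2 * δ * ‖x (Sum.inl j)‖ := hx.2
    have h4 := mul_le_mul_of_nonneg_right h1 (norm_nonneg (x (Sum.inl j)))
    linarith
  have hbox : ∀ κ ∈ R, ∀ x ∈ N, relGrad f x ∈ S → relGrad f x ∈ B → x ∈ branch f j δ κ l →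
      ‖tilt j ω κ x‖ < 2 * δ * ‖x (Sum.inl j)‖ := by
    intro κ hκ x hx hxS hxB hb
    have h1 := hest x hx ⟨Ioo_subset_Icc_self hxS.1, hxB.2⟩ κ hκ hb
    have h2 : r / 4 < ‖x (Sum.inl j)‖ := by simpa using hxS.1.1
    have h3 : 0 < δ * ‖x (Sum.inl j)‖ := mul_pos hδ (lt_trans (by positivity) h2)
    linarith
  have hPuniq : ∀ κ ∈ R, ∀ κ' ∈ R, ∀ x, x ∈ P κ → x ∈ P κ' → κ = κ' := by
    rintro κ hκ κ' hκ' x (hx | hx) (hx' | hx')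
    · exact hmix κ hκ κ' hκ' x hx hx'.2
    · exact hmix κ hκ κ' hκ' x hx (hbox κ' hκ' x hx.1.1 hx.1.2 hx'.1.2 hx'.2.2)
    · exact (hmix κ' hκ' κ hκ x hx' (hbox κ hκ x hx.1.1 hx'.1.2 hx.1.2 hx.2.2)).symm
    · exact eq_of_mem_branch hS'.sep hδ hl0 hκ hκ' hx.2.2 hx'.2.2
  have hPex : ∀ x ∈ N, relGrad f x ∈ S ∪ B → ∃ κ ∈ R, x ∈ P κ := by
    rintro x hx (hxS | hxB)
    · obtain ⟨κ, hκ, ht⟩ := hsh x hx hxS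
      exact ⟨κ, hκ, Or.inl ⟨⟨hx, hxS⟩, ht⟩⟩
    · obtain ⟨κ, hκ, ht⟩ := hcov x hx hxB.2
      exact ⟨κ, hκ, Or.inr ⟨⟨hx, hxB⟩, hx, ht⟩⟩
  have hPsub : ∀ κ, P κ ⊆ N ∩ relGrad f ⁻¹' (S ∪ B) := by
    rintro κ x (hx | hx)
    · exact ⟨hx.1.1, Or.inl hx.1.2⟩
    · exact ⟨hx.1.1, Or.inr hx.1.2⟩
  have hprop : IsProperHol (relGrad f) (P κ₁) (S ∪ B) := by
    refine h.proper.split (hSo.union hBo) hWr (hPo κ₁) (N₂ := ⋃ κ ∈ {κ | κ ∈ R ∧ κ ≠ κ₁}, P κ)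
      (isOpen_biUnion fun κ _ => hPo κ) ?_ ?_
    · rw [Set.disjoint_left]
      intro x hx hx'
      simp only [mem_iUnion] at hx'
      obtain ⟨κ', hκ', hx'⟩ := hx'
      exact hκ'.2 (hPuniq κ' hκ'.1 κ₁ hκ₁ x hx' hx)
    · ext x
      simp only [mem_union, mem_iUnion]
      constructor
      · rintro hx
        obtain ⟨κ', hκ', hb⟩ := hPex x hx.1 hx.2
        by_cases hk : κ' = κ₁
        · subst hk; exact Or.inl hb
        · exact Or.inr ⟨κ', ⟨hκ', hk⟩, hb⟩
      · rintro (hx | ⟨κ', -, hx⟩)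
        · exact hPsub _ hx
        · exact hPsub _ hx
  obtain ⟨μ, -, hμ⟩ := hprop.exists_charpoly hWc
  obtain ⟨c, hcd, hc⟩ := hμ (pd f (Sum.inl j)) fun x hx => (h.analytic x (hPsub _ hx).1).pd _
  set V' := cyl (Sum.inl j) (Iio (3 * r / 8)) (0 : T ⊕ X → ℂ) ρ with hV'
  have hV'o : IsOpen V' := isOpen_cyl _ isOpen_Iio _ _
  have hV'r : V' ⊆ Metric.ball 0 r := fun z hz => by
    rw [mem_ball_zero_iff]
    exact norm_lt_of_flat ((show ‖z (Sum.inl j)‖ < 3 * r / 8 from hz.1).trans (by linarith))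
      ((by simpa using hz.2 : ‖flat (Sum.inl j) z‖ < ρ).trans_le hρr)
  have hext := fun i => exists_extension (hcd i) hV'o (Sum.inl j) (R := 3 * r / 8) (by positivity) (fun z hz => hz.1)
    (fun z hz τ hτ => Or.inl ⟨by
      rw [Function.update_self, hτ]
      constructor <;> linarith, by rw [flat_update]; exact hz.2⟩)
  choose g hgd hg using hext
  have hgc : ∀ i, ∀ z ∈ V' ∩ B, g i z = c i z := fun i z hz => hg i z hz.1 fun τ hτ => Or.inr ⟨by
    rw [Function.update_self, mem_Iio]; linarith, by rw [flat_update]; exact hz.2.2⟩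
  have hz₀V' : z₀ ∈ V' := ⟨by rw [hz₀j]; simpa using hr, by simpa using hBflat _ hz₀B⟩
  have hres := h.proper.restrict hV'o hV'r
  set n : (T ⊕ X → ℂ) → ℂ := fun x => (monicPoly μ fun i => g i (relGrad f x)).eval (pd f (Sum.inl j) x) with hn
  have hnd : DifferentiableOn ℂ n (N ∩ relGrad f ⁻¹' V') := by
    have hp : DifferentiableOn ℂ (pd f (Sum.inl j)) (N ∩ relGrad f ⁻¹' V') := fun x hx =>
      ((h.analytic x hx.1).pd _).differentiableAt.differentiableWithinAt
    have hcomp : ∀ i, DifferentiableOn ℂ (fun x => g i (relGrad f x)) (N ∩ relGrad f ⁻¹' V') := fun i =>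
      (hgd i).comp hres.analytic.differentiableOn hres.mapsTo
    simp only [hn, eval_monicPoly]
    refine (hp.pow μ).add ?_
    exact DifferentiableOn.fun_sum fun i _ => (hcomp i).mul (hp.pow i)
  have hconn := hres.isPreconnected_source (convex_cyl _ _ _ _).isPreconnected (z₀ := 0) (x₀ := 0)
    ⟨by simpa using hr, by simpa using hρ⟩ (fun x hx hx0 => h.eq_zero x hx.1 hx0)
  obtain ⟨x₁, hx₁, hx₁z, hb₁⟩ := hmem κ₁ hκ₁
  obtain ⟨x₂, hx₂, hx₂z, hb₂⟩ := hmem κ₂ hκ₂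
  have hx₁P : x₁ ∈ P κ₁ := Or.inr ⟨⟨hx₁, by rw [mem_preimage, hx₁z]; exact hz₀B⟩, hx₁, hb₁⟩
  have hn0 : n =ᶠ[𝓝 x₁] 0 := by
    have hopen : IsOpen (N ∩ relGrad f ⁻¹' (V' ∩ B)) :=
      h.proper.continuousOn.isOpen_inter_preimage h.proper.isOpen_source (hV'o.inter hBo)
    have hm : x₁ ∈ N ∩ relGrad f ⁻¹' (V' ∩ B) := ⟨hx₁, by rw [mem_preimage, hx₁z]; exact ⟨hz₀V', hz₀B⟩⟩
    filter_upwards [(hPo κ₁).mem_nhds hx₁P, hopen.mem_nhds hm] with x hxP hxB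
    have h1 := (hc (relGrad f x) (Or.inr hxB.2.2) (pd f (Sum.inl j) x)).2 ⟨x, hxP, rfl, rfl⟩
    simp only [hn, fun i => hgc i _ hxB.2]
    exact h1
  have hx₂0 : n x₂ = 0 := eqOn_zero_of_isPreconnected hres.isOpen_source hconn hnd
    ⟨hx₁, by rw [mem_preimage, hx₁z]; exact hz₀V'⟩ hn0 ⟨hx₂, by rw [mem_preimage, hx₂z]; exact hz₀V'⟩
  simp only [hn, hx₂z, fun i => hgc i z₀ ⟨hz₀V', hz₀B⟩] at hx₂0
  obtain ⟨x, hxP, hxz, hxe⟩ := (hc z₀ (Or.inr hz₀B) _).1 hx₂0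
  rcases hxP with hx | hx
  · have h1 : relGrad f x ∈ S := hx.1.2
    rw [hxz] at h1
    have h2 := h1.1.1
    rw [hz₀j, norm_zero] at h2
    linarith
  · refine eq_of_mem_branch hS'.sep hδ hl0 hκ₁ hκ₂ hx.2.2 ?_
    unfold branch at hb₂ ⊢
    rw [mem_ofPred_eq] at hb₂ ⊢
    rwa [hxe]

end IsCritCover

end Monodromy

section Linearity

variable {T X : Type*} [Fintype T] [DecidableEq T] [Fintype X] [DecidableEq X]
variable {f : (T ⊕ X → ℂ) → ℂ} {N V : Set (T ⊕ X → ℂ)} {r : ℝ}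

theorem eq_neg_of_forall_isRoot {μ : ℕ} (hμ : μ ≠ 0) {c : ℕ → ℂ} {κ : ℂ}
    (h : ∀ q, (monicPoly μ c).IsRoot q → q = κ) : κ = -(μ : ℂ)⁻¹ * c (μ - 1) := by
  have hs := IsAlgClosed.splits (monicPoly μ c)
  have hm := monic_monicPoly μ c
  have hr : (monicPoly μ c).roots = Multiset.replicate μ κ := by
    rw [Multiset.eq_replicate]
    refine ⟨by rw [← hs.natDegree_eq_card_roots, natDegree_monicPoly], fun q hq => h q (Polynomial.mem_roots'.1 hq).2⟩
  have h1 := hs.nextCoeff_eq_neg_sum_roots_of_monic hm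
  have hd : (monicPoly μ c).natDegree = μ := natDegree_monicPoly μ c
  rw [Polynomial.nextCoeff_of_natDegree_pos (by rw [hd]; exact Nat.pos_of_ne_zero hμ), hd,
    coeff_monicPoly μ c (Nat.sub_lt (Nat.pos_of_ne_zero hμ) one_pos), hr, Multiset.sum_replicate, nsmul_eq_mul] at h1
  have : (μ : ℂ) ≠ 0 := by exact_mod_cast hμ
  rw [h1]
  field_simp

theorem eq_slant {z : T ⊕ X → ℂ} {l : ℂ} (hl : l ≠ 0) : z = slant (z ∘ Sum.inl, l⁻¹ • (z ∘ Sum.inr)) l := by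
  ext i
  rcases i with i | k
  · simp
  · simp [hl]

namespace IsCritCover

theorem restrict (h : IsCritCover f N r) {ρ : ℝ} (hρ : 0 < ρ) (hρr : ρ ≤ r) :
    IsCritCover f (N ∩ relGrad f ⁻¹' Metric.ball 0 ρ) ρ where
  pos := hρ
  proper := h.proper.restrict Metric.isOpen_ball (Metric.ball_subset_ball hρr)
  analytic := h.analytic.mono inter_subset_left
  bounded := h.bounded.imp fun C hC x hx => hC x hx.1
  zero_mem := ⟨h.zero_mem, by simpa [h.relGrad_zero] using hρ⟩
  relGrad_zero := h.relGrad_zero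
  eq_zero := fun x hx => h.eq_zero x hx.1
  crit := fun x hx => h.crit x hx.1
  map_zero := h.map_zero

theorem eq_of_isRoot (h : IsCritCover f N r) {j : T} {μ : ℕ} {B : ℕ → (T → ℂ) × (X → ℂ) → ℂ → ℂ}
    (hB : ∀ i < μ, ContinuousOn (Function.uncurry (B i)) (slantDom T X r ×ˢ Metric.ball 0 (r / 4)))
    (hroot : ∀ p ∈ slantDom T X r, ∀ l ∈ Metric.ball (0 : ℂ) (r / 4), l ≠ 0 → ∀ q,
      (monicPoly μ fun i => B i p l).IsRoot q ↔ ∃ x ∈ N, relGrad f x = slant p l ∧ pd f (Sum.inl j) x = l * q)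
    {ω : X → ℂ} (hω : ‖ω‖ ≤ 1) {κ₁ κ₂ : ℂ} (h₁ : (monicPoly μ fun i => B i (0, ω) 0).IsRoot κ₁)
    (h₂ : (monicPoly μ fun i => B i (0, ω) 0).IsRoot κ₂) : κ₁ = κ₂ := by
  have hr := h.pos
  set p := monicPoly μ fun i => B i (0, ω) 0 with hp
  have hp0 : p ≠ 0 := (monic_monicPoly μ _).ne_zero
  set R : Finset ℂ := p.roots.toFinset with hR
  have hRmem : ∀ κ, κ ∈ R ↔ p.IsRoot κ := fun κ => by simp [hR, hp0]
  obtain ⟨δ, hsep, hδ⟩ : ∃ δ : ℝ, (∀ κ ∈ R, ∀ κ' ∈ R, κ ≠ κ' → 4 * δ ≤ ‖κ - κ'‖) ∧ 0 < δ := by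
    have hev : ∀ᶠ δ : ℝ in 𝓝[>] 0, ∀ κ ∈ R, ∀ κ' ∈ R, κ ≠ κ' → 4 * δ ≤ ‖κ - κ'‖ := by
      refine (Finset.eventually_all R).2 fun κ _ => (Finset.eventually_all R).2 fun κ' _ => ?_
      by_cases hne : κ = κ'
      · exact Eventually.of_forall fun δ hne' => absurd hne hne'
      · have hpos : 0 < ‖κ - κ'‖ / 4 := by
          have := norm_pos_iff.2 (sub_ne_zero.2 hne)
          positivity
        filter_upwards [nhdsWithin_le_nhds (Iio_mem_nhds hpos)] with δ hδ _
        have : δ < ‖κ - κ'‖ / 4 := hδ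
        linarith
    exact (hev.and self_mem_nhdsWithin).exists
  have hmem0 : (((0 : T → ℂ), ω), (0 : ℂ)) ∈ slantDom T X r ×ˢ Metric.ball (0 : ℂ) (r / 4) := by
    refine ⟨⟨by simpa using hr, ?_⟩, by simpa using hr⟩
    rw [mem_ball_zero_iff]
    linarith
  have hnear := eventually_roots_near (l := 𝓝 (((0 : T → ℂ), ω), (0 : ℂ))) (μ := μ)
    (c := fun a i => B i a.1 a.2) (c₀ := fun i => B i (0, ω) 0)
    (fun i hi => (hB i hi).continuousAt ((isOpen_slantDom.prod Metric.isOpen_ball).mem_nhds hmem0)) hδ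
  obtain ⟨ρ', hρ', hnear⟩ := Metric.eventually_nhds_iff_ball.1 hnear
  set ρ := min ρ' (min (r / 4) 1) with hρdef
  have hρ : 0 < ρ := lt_min hρ' (lt_min (by positivity) one_pos)
  have hρ1 : ρ ≤ ρ' := min_le_left _ _
  have hρ2 : ρ ≤ r / 4 := (min_le_right _ _).trans (min_le_left _ _)
  have hρ3 : ρ ≤ 1 := (min_le_right _ _).trans (min_le_right _ _)
  have hnear' : ∀ t : T → ℂ, ∀ ω' : X → ℂ, ∀ l : ℂ, ‖t‖ < ρ → ‖ω' - ω‖ < ρ → ‖l‖ < ρ → ((t, ω'), l) ∈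
      Metric.ball (((0 : T → ℂ), ω), (0 : ℂ)) ρ' ∧ (t, ω') ∈ slantDom T X r ∧ l ∈ Metric.ball (0 : ℂ) (r / 4) := by
    intro t ω' l ht hω' hl
    refine ⟨?_, ⟨?_, ?_⟩, ?_⟩
    · rw [mem_ball_iff_norm]
      simp only [Prod.mk_sub_mk, Prod.norm_mk, sub_zero]
      exact max_lt (max_lt (ht.trans_le hρ1) (hω'.trans_le hρ1)) (hl.trans_le hρ1)
    · rw [mem_ball_zero_iff]
      exact ht.trans_le (by linarith)
    · rw [mem_ball_zero_iff]
      have := norm_le_norm_sub_add ω' ω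
      simp only
      linarith
    · rw [mem_ball_zero_iff]
      exact hl.trans_le hρ2
  have hsmall : ∀ᶠ l in 𝓝[≠] (0 : ℂ), ‖l‖ < ρ := by
    filter_upwards [nhdsWithin_le_nhds (Metric.ball_mem_nhds (0 : ℂ) hρ)] with l hl
    rwa [mem_ball_zero_iff] at hl
  have hS : IsSeparated f (N ∩ relGrad f ⁻¹' Metric.ball 0 ρ) j ω R δ ρ :=
    { norm_le := hω
      pos := hδ
      radius_pos := hρ
      radius_le := hρ3
      sep := hsep
      cover := by
        filter_upwards [hsmall, self_mem_nhdsWithin] with l hl hl0 x hx hxl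
        have hl' : 0 < ‖l‖ := norm_pos_iff.2 hl0
        have hxρ : ‖relGrad f x‖ < ρ := by simpa using hx.2
        have e1 : ‖relGrad f x ∘ Sum.inl‖ < ρ := lt_of_le_of_lt
          ((pi_norm_le_iff_of_nonneg (norm_nonneg _)).2 fun k => norm_le_pi_norm (relGrad f x) (Sum.inl k)) hxρ
        have e2 : ‖l⁻¹ • (relGrad f x ∘ Sum.inr) - ω‖ < ρ := by
          have h1 : l⁻¹ • (relGrad f x ∘ Sum.inr) - ω =
              l⁻¹ • ((relGrad f x - slant ((0 : T → ℂ), ω) l) ∘ Sum.inr) := by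
            ext k
            have : l ≠ 0 := hl0
            simp [mul_sub, this]
          rw [h1, norm_smul, norm_inv, inv_mul_lt_iff₀ hl', mul_comm]
          exact (norm_comp_inr_sub_le j _ _).trans_lt hxl
        obtain ⟨m1, m2, m3⟩ := hnear' _ _ l e1 e2 hl
        have hq := (hroot _ m2 l m3 hl0 (pd f (Sum.inl j) x / l)).2 ⟨x, hx.1, eq_slant hl0, by
          rw [mul_div_cancel₀ _ hl0]⟩
        obtain ⟨κ, hκ, hκq⟩ := (hnear _ m1).1 _ hq
        refine ⟨κ, (hRmem κ).2 hκ, ?_⟩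
        have : pd f (Sum.inl j) x - κ * l = (pd f (Sum.inl j) x / l - κ) * l := by
          have : l ≠ 0 := hl0
          field_simp
        change ‖_‖ < _
        rw [this, norm_mul]
        gcongr
      exists_mem := by
        filter_upwards [hsmall, self_mem_nhdsWithin] with l hl hl0 κ hκ
        have hl' : 0 < ‖l‖ := norm_pos_iff.2 hl0
        obtain ⟨m1, m2, m3⟩ := hnear' 0 ω l (by simpa using hρ) (by simpa using hρ) hl
        obtain ⟨q, hq, hqκ⟩ := (hnear _ m1).2 κ ((hRmem κ).1 hκ)
        obtain ⟨x, hx, hxz, hxq⟩ := (hroot _ m2 l m3 hl0 q).1 hq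
        refine ⟨x, ⟨hx, ?_⟩, hxz, ?_⟩
        · rw [mem_preimage, mem_ball_zero_iff, hxz]
          exact (norm_slant_zero_le hω l).trans_lt hl
        · change ‖_‖ < _
          rw [hxq, mul_comm l q, ← sub_mul, norm_mul]
          gcongr }
  exact (h.restrict hρ (by linarith)).subsingleton_of_isSeparated hS ((hRmem _).2 h₁) ((hRmem _).2 h₂)

theorem exists_linear (h : IsCritCover f N r) (j : T) :
    ∃ ℓ : (X → ℂ) →L[ℂ] ℂ, ∀ ε > 0, ∃ ρ > 0, ∀ x ∈ N, ‖relGrad f x‖ < ρ →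
      ‖pd f (Sum.inl j) x - ℓ (relGrad f x ∘ Sum.inr)‖ ≤ ε * ‖relGrad f x ∘ Sum.inr‖ := by
  have hr := h.pos
  obtain ⟨μ, hμ, B, hB, hroot, L, hL⟩ := h.exists_blowup j
  set ℓ : (X → ℂ) →L[ℂ] ℂ := (-(μ : ℂ)⁻¹) • L with hℓ
  have hval : ∀ ω : X → ℂ, ‖ω‖ ≤ 1 → ∀ q, (monicPoly μ fun i => B i (0, ω) 0).IsRoot q → q = ℓ ω := by
    intro ω hω q hq
    have := eq_neg_of_forall_isRoot hμ (κ := q) fun q' hq' => h.eq_of_isRoot hB hroot hω hq' hq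
    rw [this, hL ω (by rw [mem_ball_zero_iff]; linarith)]
    simp [hℓ]
  refine ⟨ℓ, fun ε hε => ?_⟩
  have hev : ∀ᶠ a in 𝓝 ((0 : T → ℂ), (0 : ℂ)), ∀ ω ∈ Metric.closedBall (0 : X → ℂ) 1,
      ∀ q, (monicPoly μ fun i => B i (a.1, ω) a.2).IsRoot q → ‖q - ℓ ω‖ < ε := by
    refine (isCompact_closedBall (0 : X → ℂ) 1).eventually_forall_of_forall_eventually fun ω hω => ?_
    have hω1 : ‖ω‖ ≤ 1 := by simpa using hω
    have hmem0 : (((0 : T → ℂ), ω), (0 : ℂ)) ∈ slantDom T X r ×ˢ Metric.ball (0 : ℂ) (r / 4) := by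
      refine ⟨⟨by simpa using hr, ?_⟩, by simpa using hr⟩
      rw [mem_ball_zero_iff]
      linarith
    have hc : Continuous fun b : ((T → ℂ) × ℂ) × (X → ℂ) => ((b.1.1, b.2), b.1.2) := by fun_prop
    have hnear := eventually_roots_near (l := 𝓝 (((0 : T → ℂ), (0 : ℂ)), ω)) (μ := μ)
      (c := fun b i => B i (b.1.1, b.2) b.1.2) (c₀ := fun i => B i (0, ω) 0)
      (fun i hi => ((hB i hi).continuousAt ((isOpen_slantDom.prod Metric.isOpen_ball).mem_nhds hmem0)).tendsto.comp
        (hc.tendsto (((0 : T → ℂ), (0 : ℂ)), ω))) (half_pos hε)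
    have hℓc : ∀ᶠ b : ((T → ℂ) × ℂ) × (X → ℂ) in 𝓝 (((0 : T → ℂ), (0 : ℂ)), ω), ‖ℓ ω - ℓ b.2‖ < ε / 2 := by
      have : Continuous fun b : ((T → ℂ) × ℂ) × (X → ℂ) => ‖ℓ ω - ℓ b.2‖ := by fun_prop
      exact this.continuousAt.eventually_lt_const (by simpa using hε)
    filter_upwards [hnear, hℓc] with b hb hbℓ q hq
    obtain ⟨t, ht, htq⟩ := hb.1 q hq
    rw [hval ω hω1 t ht] at htq
    have := norm_sub_le_norm_sub_add_norm_sub q (ℓ ω) (ℓ b.2)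
    linarith
  obtain ⟨ρ', hρ', hev⟩ := Metric.eventually_nhds_iff_ball.1 hev
  refine ⟨min ρ' (r / 4), lt_min hρ' (by positivity), fun x hx hxρ => ?_⟩
  by_cases hw : relGrad f x ∘ Sum.inr = 0
  · rw [h.crit x hx hw j, hw]; simp
  · have hw' : 0 < ‖relGrad f x ∘ Sum.inr‖ := norm_pos_iff.2 hw
    set l : ℂ := ((‖relGrad f x ∘ Sum.inr‖ : ℝ) : ℂ) with hl
    have hln : ‖l‖ = ‖relGrad f x ∘ Sum.inr‖ := by rw [hl, Complex.norm_real, norm_norm]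
    have hl0 : l ≠ 0 := by rw [← norm_pos_iff, hln]; exact hw'
    have hω : ‖l⁻¹ • (relGrad f x ∘ Sum.inr)‖ = 1 := by
      rw [norm_smul, norm_inv, hln, inv_mul_cancel₀ hw'.ne']
    have hl1 : ‖l‖ < min ρ' (r / 4) := by rw [hln]; exact (norm_comp_inr_le _).trans_lt hxρ
    have ht : ‖relGrad f x ∘ Sum.inl‖ < min ρ' (r / 4) := lt_of_le_of_lt
      ((pi_norm_le_iff_of_nonneg (norm_nonneg _)).2 fun k => norm_le_pi_norm (relGrad f x) (Sum.inl k)) hxρ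
    have hq := (hroot (relGrad f x ∘ Sum.inl, l⁻¹ • (relGrad f x ∘ Sum.inr))
      ⟨by rw [mem_ball_zero_iff]; linarith [min_le_right ρ' (r / 4)], by
        rw [mem_ball_zero_iff, hω]; norm_num⟩ l (by
        rw [mem_ball_zero_iff]; exact hl1.trans_le (min_le_right _ _)) hl0 (pd f (Sum.inl j) x / l)).2
      ⟨x, hx, eq_slant hl0, by rw [mul_div_cancel₀ _ hl0]⟩
    have := hev (relGrad f x ∘ Sum.inl, l) (by
      rw [mem_ball_iff_norm]
      simp only [Prod.norm_mk, sub_zero, Prod.mk_zero_zero]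
      exact max_lt (ht.trans_le (min_le_left _ _)) (hl1.trans_le (min_le_left _ _))) _ (by simp [hω]) _ hq
    have h3 : pd f (Sum.inl j) x - ℓ (relGrad f x ∘ Sum.inr) =
        l * (pd f (Sum.inl j) x / l - ℓ (l⁻¹ • (relGrad f x ∘ Sum.inr))) := by
      rw [map_smul, smul_eq_mul]
      field_simp
    rw [h3, norm_mul, hln, mul_comm]
    gcongr

end IsCritCover

end Linearity

section Tangent

variable {T X : Type*} [Fintype T] [DecidableEq T] [Fintype X] [DecidableEq X]
variable {f : (T ⊕ X → ℂ) → ℂ} {N V : Set (T ⊕ X → ℂ)} {r : ℝ}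

namespace IsCritCover

/-- The linear forms which approximate the partial derivatives along the first group of coordinates also describe the
tangent directions of the critical locus. -/
theorem exists_sum_le (h : IsCritCover f N r) {ℓ : T → (X → ℂ) →L[ℂ] ℂ}
    (hℓ : ∀ j, ∀ ε > 0, ∃ ρ > 0, ∀ x ∈ N, ‖relGrad f x‖ < ρ →
      ‖pd f (Sum.inl j) x - ℓ j (relGrad f x ∘ Sum.inr)‖ ≤ ε * ‖relGrad f x ∘ Sum.inr‖)
    {ω : X → ℂ} (hω : ‖ω‖ ≤ 1) {ε : ℝ} (hε : 0 < ε) :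
    ∃ ρ > 0, ∀ y ∈ N, relGrad f y ∘ Sum.inr = 0 → ‖relGrad f y‖ < ρ →
      ‖∑ k, y (Sum.inr k) * ω k + ∑ j, ℓ j ω * y (Sum.inl j)‖ ≤ ε * ‖y ∘ Sum.inl‖ := by
  have hr := h.pos
  set e := ε / (Fintype.card T + 1) with he
  have he0 : 0 < e := by positivity
  choose ρ hρ hℓρ using fun j => hℓ j e he0
  obtain ⟨ρ₁, hρ₁, hρ₁j⟩ : ∃ ρ₁ > 0, ∀ j, ρ₁ ≤ ρ j := by
    have hev : ∀ᶠ a : ℝ in 𝓝[>] 0, ∀ j, a ≤ ρ j :=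
      eventually_all.2 fun j => nhdsWithin_le_nhds (Iic_mem_nhds (hρ j))
    obtain ⟨a, ha, ha0⟩ := (hev.and self_mem_nhdsWithin).exists
    exact ⟨a, ha0, ha⟩
  refine ⟨min ρ₁ r, lt_min hρ₁ hr, fun y hy hyw hyρ => ?_⟩
  set t : T → ℂ := y ∘ Sum.inl with ht
  have htρ : ‖t‖ < min ρ₁ r := lt_of_le_of_lt
    ((pi_norm_le_iff_of_nonneg (norm_nonneg _)).2 fun k => norm_le_pi_norm (relGrad f y) (Sum.inl k)) hyρ
  have hyz : relGrad f y = slant (t, ω) 0 := by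
    ext i
    rcases i with i | k
    · simp [ht]
    · rw [slant_inr, zero_mul]; exact congrFun hyw k
  set A := ∑ k, y (Sum.inr k) * ω k + ∑ j, ℓ j ω * y (Sum.inl j) with hA
  suffices H : ∀ ε' > 0, ‖A‖ ≤ Fintype.card T * (e * ‖t‖) + (2 + Fintype.card X) * ε' by
    have h1 : ‖A‖ ≤ Fintype.card T * (e * ‖t‖) := by
      refine le_of_forall_pos_le_add fun a ha => ?_
      have := H (a / (2 + Fintype.card X)) (by positivity)
      rwa [mul_div_cancel₀ _ (by positivity)] at this
    have h2 : e * (Fintype.card T + 1) = ε := by rw [he]; field_simp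
    have h3 : 0 ≤ e * ‖t‖ := by positivity
    nlinarith
  intro ε' hε'
  obtain ⟨ρ₀, hρ₀, hf0⟩ := h.exists_ball_legendre_le hε'
  have hev := h.proper.eventually_exists hy ((h.eventually_norm_le hy hyw hε').and (Metric.ball_mem_nhds y hε'))
  have hc : Continuous fun l : ℂ => slant (t, ω) l :=
    continuous_slant.comp (by fun_prop : Continuous fun l : ℂ => ((t, ω), l))
  have htend : Tendsto (fun l : ℂ => slant (t, ω) l) (𝓝[≠] 0) (𝓝 (relGrad f y)) := by
    rw [hyz]
    exact (hc.tendsto 0).mono_left nhdsWithin_le_nhds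
  have hsmall : ∀ a > 0, ∀ᶠ l in 𝓝[≠] (0 : ℂ), ‖l‖ < a := fun a ha => by
    filter_upwards [nhdsWithin_le_nhds (Metric.ball_mem_nhds (0 : ℂ) ha)] with l hl
    rwa [mem_ball_zero_iff] at hl
  obtain ⟨l, ⟨⟨x₁, ⟨hx₁, hx₁f, hx₁y⟩, hx₁z⟩, hl0⟩, hlρ, hne⟩ := (((htend.eventually hev).and (hsmall ρ₀ hρ₀)).and
    ((hsmall (min ρ₁ r) (lt_min hρ₁ hr)).and self_mem_nhdsWithin)).exists
  have hl' : 0 < ‖l‖ := norm_pos_iff.2 hne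
  have hball : ∀ s : T → ℂ, ‖s‖ < min ρ₁ r → slant (s, ω) l ∈ Metric.ball (0 : T ⊕ X → ℂ) (min ρ₁ r) := by
    intro s hs
    rw [mem_ball_zero_iff, pi_norm_lt_iff (lt_min hρ₁ hr)]
    rintro (j | k)
    · exact (norm_le_pi_norm s j).trans_lt hs
    · rw [slant_inr, norm_mul]
      exact (mul_le_of_le_one_right (norm_nonneg _) ((norm_le_pi_norm ω k).trans hω)).trans_lt hlρ
  have hseg := (convex_ball (0 : T ⊕ X → ℂ) (min ρ₁ r)).segment_subset (hball 0 (by simpa using ⟨hρ₁, hr⟩)) (hball t htρ)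
  have hwl : ‖l • ω‖ ≤ ‖l‖ := by rw [norm_smul]; exact mul_le_of_le_one_right (norm_nonneg _) hω
  have hdl : ∀ j, (slant (t, ω) l - slant ((0 : T → ℂ), ω) l) (Sum.inl j) = t j := fun j => by simp
  have hdr : ∀ k, (slant (t, ω) l - slant ((0 : T → ℂ), ω) l) (Sum.inr k) = 0 := fun k => by simp
  obtain ⟨x₀, hx₀, hx₀z, hle⟩ := h.proper.exists_legendre_sub_le h.analytic
    (-(∑ j, ℓ j (l • ω) • ContinuousLinearMap.proj (R := ℂ) (φ := fun _ : T ⊕ X => ℂ) (Sum.inl j)))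
    (hseg.trans (Metric.ball_subset_ball (min_le_right _ _))) (L := Fintype.card T * (e * ‖l‖ * ‖t‖))
    (fun x hx hxs => by
      have hxw : relGrad f x ∘ Sum.inr = l • ω := by
        rw [segment_eq_image'] at hxs
        obtain ⟨θ, -, hθ⟩ := hxs
        rw [← hθ]
        ext k
        simp
      have hxρ : ‖relGrad f x‖ < ρ₁ := by
        have := hseg hxs
        rw [mem_ball_zero_iff] at this
        exact this.trans_le (min_le_left _ _)
      have h1 : ‖(fun j => pd f (Sum.inl j) x - ℓ j (l • ω))‖ ≤ e * ‖l‖ := by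
        refine (pi_norm_le_iff_of_nonneg (by positivity)).2 fun j => ?_
        have := hℓρ j x hx (hxρ.trans_le (hρ₁j j))
        rw [hxw] at this
        exact this.trans (by gcongr)
      have h2 := norm_sum_mul_le (fun j => pd f (Sum.inl j) x - ℓ j (l • ω)) t h1 le_rfl
      refine le_trans (le_of_eq ?_) h2
      rw [legendreForm_apply]
      simp only [hdl, hdr, mul_zero, Finset.sum_const_zero, sub_zero, neg_apply, sum_apply, smul_apply,
        ContinuousLinearMap.proj_apply, smul_eq_mul, sub_mul, Finset.sum_sub_distrib]
      rfl) hx₁ hx₁z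
  simp only [hdl, neg_apply, sum_apply, smul_apply, ContinuousLinearMap.proj_apply, smul_eq_mul, map_smul] at hle
  have e1 : ‖f x₁‖ ≤ ε' * ‖l‖ := by
    refine hx₁f.trans ?_
    gcongr
    rw [hx₁z, slant_comp_inr]
    exact hwl
  have e0 : ‖legendre f x₀‖ ≤ ε' * ‖l‖ := by
    refine (hf0 x₀ hx₀ ?_).trans ?_
    · rw [hx₀z]; exact (norm_slant_zero_le hω l).trans_lt hl0
    · gcongr
      rw [hx₀z, slant_comp_inr]
      exact hwl
  have e2 := norm_sum_mul_le ((x₁ - y) ∘ Sum.inr) (l • ω) (A := ε')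
    ((norm_comp_inr_le _).trans (by rw [← dist_eq_norm]; exact (Metric.mem_ball.1 hx₁y).le)) hwl
  have key : l * A = f x₁ - legendre f x₀ - (legendre f x₁ - legendre f x₀ + -∑ j, l * ℓ j ω * t j) -
      ∑ k, ((x₁ - y) ∘ Sum.inr) k * (l • ω) k := by
    have hw : ∀ k, pd f (Sum.inr k) x₁ = l * ω k := fun k => by
      rw [← relGrad_inr, hx₁z, slant_inr]
    simp only [legendre, hw, hA, ht, Function.comp_apply, Pi.sub_apply, Pi.smul_apply, smul_eq_mul, sub_mul,
      Finset.sum_sub_distrib, mul_add, Finset.mul_sum]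
    have a1 : ∀ k, l * (y (Sum.inr k) * ω k) = y (Sum.inr k) * (l * ω k) := fun k => by ring
    have a2 : ∀ j, l * (ℓ j ω * y (Sum.inl j)) = l * ℓ j ω * y (Sum.inl j) := fun k => by ring
    simp only [a1, a2]
    ring
  have h4 : ‖l‖ * ‖A‖ ≤ ε' * ‖l‖ + ε' * ‖l‖ + Fintype.card T * (e * ‖l‖ * ‖t‖) + Fintype.card X * (ε' * ‖l‖) := by
    rw [← norm_mul, key]
    refine (norm_sub_le _ _).trans (add_le_add ?_ e2)
    refine (norm_sub_le _ _).trans (add_le_add ?_ hle)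
    exact (norm_sub_le _ _).trans (add_le_add e1 e0)
  refine le_of_mul_le_mul_left (a := ‖l‖) ?_ hl'
  linarith

end IsCritCover

end Tangent

section Thom

theorem apply_eq_zero_of_mem_tangentConeAt {E F : Type*} [NormedAddCommGroup E] [NormedSpace ℝ E]
    [NormedAddCommGroup F] [NormedSpace ℝ F] {G : E →L[ℝ] F} {S : Set E} {v : E}
    (hG : ∀ ε > 0, ∀ᶠ y in 𝓝[S] 0, ‖G y‖ ≤ ε * ‖y‖) (hv : v ∈ tangentConeAt ℝ S 0) : G v = 0 := by
  have h0 : HasFDerivWithinAt G (0 : E →L[ℝ] F) S 0 := by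
    refine HasFDerivWithinAt.of_isLittleO (Asymptotics.isLittleO_iff.2 fun ε hε => ?_)
    simpa using hG ε hε
  exact G.hasFDerivWithinAt.unique_on h0 hv

variable {T X : Type*} [Fintype T] [DecidableEq T] [Fintype X] [DecidableEq X]
variable {f : (T ⊕ X → ℂ) → ℂ} {N : Set (T ⊕ X → ℂ)} {r : ℝ}

theorem norm_comp_inl_le (z : T ⊕ X → ℂ) : ‖z ∘ Sum.inl‖ ≤ ‖z‖ :=
  (pi_norm_le_iff_of_nonneg (norm_nonneg _)).2 fun k => norm_le_pi_norm z (Sum.inl k)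

namespace IsCritCover

theorem tendsto_relGrad (h : IsCritCover f N r) : Tendsto (relGrad f) (𝓝 0) (𝓝 0) := by
  have := (h.proper.analytic 0 h.zero_mem).continuousAt.tendsto
  rwa [h.relGrad_zero] at this

theorem eventually_norm_relGrad_lt (h : IsCritCover f N r) {ρ : ℝ} (hρ : 0 < ρ) :
    ∀ᶠ x in 𝓝 0, x ∈ N ∧ ‖relGrad f x‖ < ρ := by
  have hN : ∀ᶠ x in 𝓝 0, x ∈ N := h.proper.isOpen_source.mem_nhds h.zero_mem
  refine hN.and ?_
  filter_upwards [h.tendsto_relGrad (Metric.ball_mem_nhds 0 hρ)] with x hx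
  simpa using hx

/-- Thom's condition at the origin: limits of scaled differentials vanish on the tangent cone of the set of critical
points. -/
theorem sum_mul_eq_zero (h : IsCritCover f N r) {q : ℕ → T ⊕ X → ℂ} (hq : Tendsto q atTop (𝓝 0)) {a : ℕ → ℂ}
    {b : T ⊕ X → ℂ} (hb : ∀ i, Tendsto (fun k => a k * pd f i (q k)) atTop (𝓝 (b i))) {S : Set (T ⊕ X → ℂ)}
    (hS : ∀ x ∈ S, relGrad f x ∘ Sum.inr = 0) {v : T ⊕ X → ℂ} (hv : v ∈ tangentConeAt ℝ S 0) :
    ∑ i, b i * v i = 0 := by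
  choose ℓ hℓ using h.exists_linear
  have hbX : Tendsto (fun k => a k • (relGrad f (q k) ∘ Sum.inr)) atTop (𝓝 (b ∘ Sum.inr)) :=
    tendsto_pi_nhds.2 fun i => hb (Sum.inr i)
  have hbT : ∀ j, b (Sum.inl j) = ℓ j (b ∘ Sum.inr) := by
    intro j
    have key : ∀ ε > 0, ‖b (Sum.inl j) - ℓ j (b ∘ Sum.inr)‖ ≤ ε * ‖b ∘ Sum.inr‖ := by
      intro ε hε
      obtain ⟨ρ, hρ, H⟩ := hℓ j ε hε
      refine le_of_tendsto_of_tendsto ((hb (Sum.inl j)).sub (((ℓ j).continuous.tendsto _).comp hbX)).norm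
        (hbX.norm.const_mul ε) ?_
      filter_upwards [hq.eventually (h.eventually_norm_relGrad_lt hρ)] with k hk
      have := mul_le_mul_of_nonneg_left (H _ hk.1 hk.2) (norm_nonneg (a k))
      simp only [Function.comp_apply, map_smul, smul_eq_mul, ← mul_sub, norm_mul, norm_smul]
      linarith
    rw [← sub_eq_zero, ← norm_le_zero_iff]
    refine le_of_forall_pos_le_add fun ε hε => (key (ε / (‖b ∘ Sum.inr‖ + 1)) (by positivity)).trans ?_
    rw [zero_add, div_mul_eq_mul_div, div_le_iff₀ (by positivity)]
    nlinarith [norm_nonneg (b ∘ Sum.inr)]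
  set m : ℂ := ((1 + ‖b ∘ Sum.inr‖ : ℝ) : ℂ) with hm
  have hm0 : m ≠ 0 := by
    rw [hm, Complex.ofReal_ne_zero]
    positivity
  set ω : X → ℂ := m⁻¹ • (b ∘ Sum.inr) with hω
  have hω1 : ‖ω‖ ≤ 1 := by
    have h1 : ‖m‖ = 1 + ‖b ∘ Sum.inr‖ := by
      rw [hm, Complex.norm_real, Real.norm_of_nonneg (by positivity)]
    rw [hω, norm_smul, norm_inv, h1, inv_mul_le_one₀ (by positivity)]
    linarith
  let G : (T ⊕ X → ℂ) →L[ℂ] ℂ :=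
    ∑ k, ω k • ContinuousLinearMap.proj (R := ℂ) (φ := fun _ : T ⊕ X => ℂ) (Sum.inr k) +
      ∑ j, ℓ j ω • ContinuousLinearMap.proj (R := ℂ) (φ := fun _ : T ⊕ X => ℂ) (Sum.inl j)
  have hG : ∀ y, G y = ∑ k, y (Sum.inr k) * ω k + ∑ j, ℓ j ω * y (Sum.inl j) := fun y => by
    simp [G, mul_comm]
  have hGv : G.restrictScalars ℝ v = 0 := by
    refine apply_eq_zero_of_mem_tangentConeAt (fun ε hε => ?_) hv
    obtain ⟨ρ, hρ, H⟩ := h.exists_sum_le hℓ hω1 hε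
    filter_upwards [nhdsWithin_le_nhds (h.eventually_norm_relGrad_lt hρ), self_mem_nhdsWithin] with y hy hyS
    rw [ContinuousLinearMap.coe_restrictScalars', hG]
    exact (H y hy.1 (hS y hyS) hy.2).trans (mul_le_mul_of_nonneg_left (norm_comp_inl_le y) hε.le)
  rw [ContinuousLinearMap.coe_restrictScalars', hG] at hGv
  have hbω : ∀ i, b i = m * Sum.elim (fun j => ℓ j ω) ω i := by
    rintro (j | k)
    · simp only [Sum.elim_inl, hbT, hω, map_smul, smul_eq_mul, mul_inv_cancel_left₀ hm0]
    · simp only [Sum.elim_inr, hω, Pi.smul_apply, smul_eq_mul, mul_inv_cancel_left₀ hm0, Function.comp_apply]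
  simp only [hbω, mul_assoc, ← Finset.mul_sum, Fintype.sum_sum_type, Sum.elim_inl, Sum.elim_inr]
  rw [add_comm]
  simp only [mul_comm (ω _), hGv, mul_zero]

end IsCritCover

end Thom

section ThomNear

variable {T X : Type*} [Fintype T] [DecidableEq T] [Fintype X] [DecidableEq X]
variable {g : (T ⊕ X → ℂ) → ℂ} {D : Set (T ⊕ X → ℂ)}

theorem pd_translate (g : (T ⊕ X → ℂ) → ℂ) (p : T ⊕ X → ℂ) (c : ℂ) (i : T ⊕ X) (z : T ⊕ X → ℂ) :
    pd (fun z => g (z + p) - c) i z = pd g i (z + p) := by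
  rw [pd, pd, fderiv_sub_const, fderiv_comp_add_right]

theorem relGrad_translate (g : (T ⊕ X → ℂ) → ℂ) {p : T ⊕ X → ℂ} (hp : relGrad g p ∘ Sum.inr = 0) (c : ℂ)
    (z : T ⊕ X → ℂ) : relGrad (fun z => g (z + p) - c) z = relGrad g (z + p) - relGrad g p := by
  ext (j | k)
  · simp
  · have : pd g (Sum.inr k) p = 0 := congrFun hp k
    simp [pd_translate, this]

/-- Near a critical point at which the relative gradient is isolated, the translate of the function has a covering by
its relative gradient. -/
theorem exists_isCritCover (hg : AnalyticOnNhd ℂ g D)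
    (hcrit : ∀ z ∈ D, relGrad g z ∘ Sum.inr = 0 → ∀ j, pd g (Sum.inl j) z = 0) {p : T ⊕ X → ℂ}
    (hp : relGrad g p ∘ Sum.inr = 0) {ρ : ℝ} (hρ : 0 < ρ) (hsub : Metric.closedBall p ρ ⊆ D)
    (hiso : ∀ y ∈ Metric.closedBall p ρ, relGrad g y = relGrad g p → y = p) :
    ∃ N r, IsCritCover (fun z => g (z + p) - g p) N r := by
  have hmem : ∀ z ∈ Metric.closedBall (0 : T ⊕ X → ℂ) ρ, z + p ∈ Metric.closedBall p ρ := fun z hz => by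
    simpa using hz
  have han : AnalyticOnNhd ℂ (fun z => g (z + p) - g p) (Metric.closedBall 0 ρ) := fun z hz => by
    have h1 : AnalyticAt ℂ (fun z : T ⊕ X → ℂ => z + p) z := analyticAt_id.add analyticAt_const
    exact (AnalyticAt.fun_comp (g := g) (f := fun z => z + p) (hg (z + p) (hsub (hmem z hz))) h1).sub analyticAt_const
  have h0 : relGrad (fun z => g (z + p) - g p) 0 = 0 := by rw [relGrad_translate g hp, zero_add, sub_self]
  have hiso' : ∀ y ∈ Metric.closedBall (0 : T ⊕ X → ℂ) ρ, relGrad (fun z => g (z + p) - g p) y = 0 → y = 0 :=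
    fun y hy h => by
      rw [relGrad_translate g hp, sub_eq_zero] at h
      simpa using hiso _ (hmem y hy) h
  obtain ⟨δ, hδ, H⟩ := exists_properNhd (fun z hz => (han z hz).relGrad) hρ le_rfl
    (fun y hy h => hiso' y hy (h.trans h0))
  have hP := H δ hδ le_rfl
  rw [h0] at hP
  have hN : ∀ x ∈ Metric.ball (0 : T ⊕ X → ℂ) ρ ∩ relGrad (fun z => g (z + p) - g p) ⁻¹' Metric.ball 0 δ,
      x ∈ Metric.closedBall (0 : T ⊕ X → ℂ) ρ := fun x hx => Metric.ball_subset_closedBall hx.1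
  refine ⟨_, δ, ⟨hδ, hP, fun x hx => han x (hN x hx), ⟨ρ, fun x hx => by simpa using hN x hx⟩,
    ⟨Metric.mem_ball_self hρ, ?_⟩, h0, fun x hx => hiso' x (hN x hx), fun x hx hxw j => ?_, by simp⟩⟩
  · rw [mem_preimage, h0]
    exact Metric.mem_ball_self hδ
  · rw [pd_translate]
    refine hcrit _ (hsub (hmem x (hN x hx))) ?_ j
    funext k
    have := congrFun hxw k
    rwa [Function.comp_apply, relGrad_inr, pd_translate] at this

/-- Thom's condition near the origin, in coordinates. -/
theorem exists_nhds_sum_mul_eq_zero (hD : IsOpen D) (h0D : 0 ∈ D) (hg : AnalyticOnNhd ℂ g D)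
    (hcrit : ∀ z ∈ D, relGrad g z ∘ Sum.inr = 0 → ∀ j, pd g (Sum.inl j) z = 0)
    (h0 : relGrad g 0 = 0) (hiso : ∀ z ∈ D, relGrad g z = 0 → z = 0) :
    ∃ W ⊆ D, IsOpen W ∧ 0 ∈ W ∧ ∀ p ∈ W, relGrad g p ∘ Sum.inr = 0 → ∀ (q : ℕ → T ⊕ X → ℂ) (a : ℕ → ℂ)
      (b : T ⊕ X → ℂ), Tendsto q atTop (𝓝 p) → (∀ i, Tendsto (fun k => a k * pd g i (q k)) atTop (𝓝 (b i))) →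
      ∀ S : Set (T ⊕ X → ℂ), (∀ x ∈ S, relGrad g x ∘ Sum.inr = 0) → ∀ v ∈ tangentConeAt ℝ S p,
        ∑ i, b i * v i = 0 := by
  obtain ⟨ρ, hρ, hρD⟩ := Metric.nhds_basis_closedBall.mem_iff.1 (hD.mem_nhds h0D)
  obtain ⟨δ, hδ, H⟩ := exists_properNhd (fun z hz => (hg z hz).relGrad) hρ hρD
    (fun y hy h => hiso y (hρD hy) (h.trans h0))
  have hP := H δ hδ le_rfl
  rw [h0] at hP
  refine ⟨_, fun x hx => hρD (Metric.ball_subset_closedBall hx.1), hP.isOpen_source,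
    ⟨Metric.mem_ball_self hρ, ?_⟩, fun p hp hpw q a b hq hb S hS v hv => ?_⟩
  · rw [mem_preimage, h0]
    exact Metric.mem_ball_self hδ
  obtain ⟨ρ', hρ', hsub, hiso'⟩ := hP.exists_isolating hp isOpen_univ (mem_univ p)
  obtain ⟨N, r, hC⟩ := exists_isCritCover hg hcrit hpw hρ'
    (fun x hx => hρD (Metric.ball_subset_closedBall (hsub hx).1.1)) hiso'
  have hq' : Tendsto (fun k => q k - p) atTop (𝓝 0) := by simpa using hq.sub_const p
  have hv' : v ∈ tangentConeAt ℝ ((fun z => z - p) '' S) 0 := by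
    have h1 : HasFDerivWithinAt (fun z : T ⊕ X → ℂ => z - p) (ContinuousLinearMap.id ℝ _) S p :=
      (hasFDerivWithinAt_id p S).sub_const p
    simpa using h1.mapsTo_tangent_cone hv
  refine hC.sum_mul_eq_zero hq' (a := a) (fun i => ?_) ?_ hv'
  · simpa only [pd_translate, sub_add_cancel] using hb i
  · rintro _ ⟨x, hx, rfl⟩
    funext k
    have := congrFun (hS x hx) k
    rwa [Function.comp_apply, relGrad_inr, pd_translate, sub_add_cancel]

end ThomNear

/- STATEMENT 3: central isolation together with the Jacobian set equality near 0
implies that (U ∖ Σf, Σf) satisfies the a_f (Thom) condition near 0. -/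
theorem stmt_3 (n s : ℕ) (hn : 1 ≤ n) (hs : s ≤ n)
    (U : Set (Csp n s)) (hU : IsOpen U) (h0U : (0 : Csp n s) ∈ U)
    (f : Csp n s → ℂ) (hf : ∀ z ∈ U, AnalyticAt ℂ f z)
    (h0crit : (0 : Csp n s) ∈ SigmaF n s f U)
    (hiso : CentralIsolation n s f U)
    (hjac : JacobianEq n s f U) :
    AfCondition n s f U := by
  obtain ⟨Wi, hWi, h0Wi, hWiso⟩ := hiso
  obtain ⟨W₀, hW₀, h0W₀, hW₀U, hW₀eq⟩ := hjac
  let e : (Fin s ⊕ Fin (n + 1 - s) → ℂ) ≃L[ℂ] Csp n s :=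
    ContinuousLinearEquiv.sumPiEquivProdPi ℂ (Fin s) (Fin (n + 1 - s)) fun _ => ℂ
  have he1 : ∀ z j, (e z).1 j = z (Sum.inl j) := fun _ _ => rfl
  have he2 : ∀ z k, (e z).2 k = z (Sum.inr k) := fun _ _ => rfl
  have hinr : ∀ k, e (Pi.single (Sum.inr k) 1) = (0, Pi.single k 1) := by
    intro k
    ext i
    · simp [he1]
    · simp [he2, Pi.single_apply]
  have hpd : ∀ z i, pd (f ∘ e) i z = fderiv ℂ f (e z) (e (Pi.single i 1)) := fun z i => by
    rw [pd, e.comp_right_fderiv]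
    rfl
  have hpv : ∀ z, relGrad (f ∘ e) z ∘ Sum.inr = 0 ↔ PartialsVanish n s f (e z) := fun z => by
    simp only [funext_iff, Function.comp_apply, relGrad_inr, hpd, hinr, PartialsVanish, Pi.zero_apply]
  have hsig : ∀ z ∈ SigmaF n s f U, PartialsVanish n s f z := fun z hz j => by rw [hz.2]; rfl
  obtain ⟨W, hWD, hWo, h0W, hW⟩ := exists_nhds_sum_mul_eq_zero (g := f ∘ e) (D := e ⁻¹' (W₀ ∩ Wi))
    ((hW₀.inter hWi).preimage e.continuous) (by simpa using ⟨h0W₀, h0Wi⟩)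
    (fun z hz => (hf _ (hW₀U hz.1)).comp ((e : (Fin s ⊕ Fin (n + 1 - s) → ℂ) →L[ℂ] Csp n s).analyticAt z))
    (fun z hz hw j => by
      have h1 : e z ∈ SigmaF n s f U ∩ W₀ := hW₀eq ▸ ⟨hz.1, (hpv z).1 hw⟩
      rw [hpd, h1.1.2]
      rfl)
    (by
      have h1 := (hpv 0).2 (by rw [map_zero]; exact hsig 0 h0crit)
      ext (j | k)
      · simp
      · exact congrFun h1 k)
    (fun z hz hz0 => by
      have h1 : e z = 0 := hWiso (e z) ⟨hW₀U hz.1, hz.2⟩ (funext fun j => congrFun hz0 (Sum.inl j))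
        ((hpv z).1 (funext fun k => congrFun hz0 (Sum.inr k)))
      simpa using h1)
  refine ⟨e.symm ⁻¹' W, hWo.preimage e.symm.continuous, by simpa using h0W, fun z hz => ?_,
    fun p hp q _ hqp η hη v hv => ?_⟩
  · have := (hWD hz).1
    rw [e.apply_symm_apply] at this
    exact hW₀U this
  have hq : Tendsto (fun k => e.symm (q k)) atTop (𝓝 (e.symm p)) := (e.symm.continuous.tendsto p).comp hqp
  have hv' : e.symm v ∈ tangentConeAt ℝ (e.symm '' SigmaF n s f U) (e.symm p) :=
    ((e.symm : Csp n s →L[ℂ] (Fin s ⊕ Fin (n + 1 - s) → ℂ)).restrictScalars ℝ).hasFDerivWithinAt.mapsTo_tangent_cone hv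
  have key := hW (e.symm p) hp.2 ((hpv _).2 (by rw [e.apply_symm_apply]; exact hsig p hp.1)) _
    (fun k => (((‖fderiv ℂ f (q k)‖)⁻¹ : ℝ) : ℂ)) (fun i => η (e (Pi.single i 1))) hq
    (fun i => by
      have h1 := ((ContinuousLinearMap.apply ℂ ℂ (e (Pi.single i (1 : ℂ)))).continuous.tendsto η).comp hη
      refine h1.congr fun k => ?_
      rw [hpd, e.apply_symm_apply]
      simp) _
    (by
      rintro _ ⟨x, hx, rfl⟩
      rw [hpv, e.apply_symm_apply]
      exact hsig x hx) _ hv'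
  have h1 := clm_apply_eq_sum (η.comp (e : (Fin s ⊕ Fin (n + 1 - s) → ℂ) →L[ℂ] Csp n s)) (e.symm v)
  rw [← e.apply_symm_apply v]
  exact h1.trans ((Finset.sum_congr rfl fun i _ => mul_comm _ _).trans key)
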